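/- Let s ∈ (0,1) and let f : ℝ → ℝ be of class C^{1,γ} for some γ > max(0, 1−2s). Assume f(−1) = f(1) = 0 (equivalently G′(−1) = G′(1) = 0) and G(r) > G(−1) = G(1) for every r ∈ (−1,1). Then there exists a layer solution v of (-∂ₓₓ)^s v = f(v) in ℝ, i.e., a bounded C² function v with v′ > 0 in ℝ, lim_{x→−∞} v(x) = −1, lim_{x→+∞} v(x) = 1, satisfying the equation at every point. -/

import Mathlib

open Real MeasureTheory Filter Set

/-- Normalizing constant of the one-dimensional fractional Laplacian. -/
noncomputable def fracLapCoef (s : ℝ) : ℝ :=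
  (4:ℝ) ^ s * s * Real.Gamma (s + 1/2) / (Real.sqrt π * Real.Gamma (1 - s))

/-- The one-dimensional fractional Laplacian `(-∂ₓₓ)^s v (x)`. -/
noncomputable def fracLap (s : ℝ) (v : ℝ → ℝ) (x : ℝ) : ℝ :=
  fracLapCoef s * ∫ y in Set.Ioi (0:ℝ), (2 * v x - v (x + y) - v (x - y)) * y ^ (-1 - 2*s)

/-- `f` is of class `C^{1,γ}`: continuously differentiable with `γ`-Hölder derivative. -/
def IsC1Holder (γ : ℝ) (f : ℝ → ℝ) : Prop :=
  ContDiff ℝ 1 f ∧ ∃ C : ℝ, ∀ x y : ℝ, |deriv f x - deriv f y| ≤ C * |x - y| ^ γ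

/-- A layer solution of `(-∂ₓₓ)^s v = f(v)` in `ℝ`. -/
structure IsLayerSolution (s : ℝ) (f : ℝ → ℝ) (v : ℝ → ℝ) : Prop where
  bounded : ∃ M : ℝ, ∀ x, |v x| ≤ M
  smooth : ContDiff ℝ 2 v
  eqn : ∀ x, fracLap s v x = f (v x)
  mono : ∀ x, 0 < deriv v x
  limNeg : Tendsto v atBot (nhds (-1))
  limPos : Tendsto v atTop (nhds 1)

/-- The potential `G(r) = -∫₀^r f`. -/
noncomputable def potG (f : ℝ → ℝ) (r : ℝ) : ℝ := -∫ u in (0:ℝ)..r, f u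

open Real MeasureTheory Filter Set

/-- Second difference. -/
def sdf (w : ℝ → ℝ) (x z : ℝ) : ℝ := 2 * w x - w (x + z) - w (x - z)

/-- Nonlocal operator with kernel `K`. -/
noncomputable def Lop (K w : ℝ → ℝ) (x : ℝ) : ℝ := ∫ z in Set.Ioi (0:ℝ), sdf w x z * K z

/-- Kernels dominated by the fractional one. -/
structure IsKer (s : ℝ) (K : ℝ → ℝ) : Prop where
  meas : Measurable K
  nonneg : ∀ z, 0 ≤ K z
  le : ∀ z, 0 < z → K z ≤ z ^ (-1 - 2*s)

/-- Convolution. -/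
noncomputable def mol (ρ u : ℝ → ℝ) (x : ℝ) : ℝ := ∫ t, ρ t * u (x - t)

/-- Test functions. -/
structure IsTest (ρ : ℝ → ℝ) : Prop where
  smooth : ContDiff ℝ ((⊤ : ℕ∞) : WithTop ℕ∞) ρ
  supp : HasCompactSupport ρ

lemma IsTest.deriv {ρ : ℝ → ℝ} (h : IsTest ρ) : IsTest (deriv ρ) := by
  refine ⟨?_, h.supp.deriv⟩
  have := h.smooth
  exact ((contDiff_infty_iff_deriv (𝕜 := ℝ)).1 this).2

lemma IsTest.cont {ρ : ℝ → ℝ} (h : IsTest ρ) : Continuous ρ := h.smooth.continuous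

lemma IsTest.integrable {ρ : ℝ → ℝ} (h : IsTest ρ) : Integrable ρ :=
  h.cont.integrable_of_hasCompactSupport h.supp

lemma mol_eq_conv (ρ u : ℝ → ℝ) :
    mol ρ u = convolution ρ u (ContinuousLinearMap.lsmul ℝ ℝ) volume := by
  ext x; rfl

lemma locInt_of_bdd {u : ℝ → ℝ} (hu : Measurable u) {A : ℝ} (hA : ∀ x, |u x| ≤ A) :
    LocallyIntegrable u := by
  intro x
  refine ⟨Metric.ball x 1, Metric.ball_mem_nhds x one_pos, ?_⟩
  refine Measure.integrableOn_of_bounded (M := A) ?_ hu.aestronglyMeasurable ?_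
  · exact measure_ball_lt_top.ne
  · exact Eventually.of_forall hA

lemma mol_hasDerivAt {ρ u : ℝ → ℝ} (h : IsTest ρ) (hu : Measurable u) {A : ℝ}
    (hA : ∀ x, |u x| ≤ A) (x : ℝ) : HasDerivAt (mol ρ u) (mol (deriv ρ) u x) x := by
  rw [mol_eq_conv, mol_eq_conv]
  exact h.supp.hasDerivAt_convolution_left _ (h.smooth.of_le (by exact_mod_cast le_top))
    (locInt_of_bdd hu hA) x

lemma mol_integrable {ρ u : ℝ → ℝ} (h : Integrable ρ) (hu : Measurable u) {A : ℝ}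
    (hA : ∀ x, |u x| ≤ A) (x : ℝ) : Integrable (fun t => ρ t * u (x - t)) := by
  refine h.mul_bdd (c := A) ?_ ?_
  · exact (hu.comp (measurable_const.sub measurable_id)).aestronglyMeasurable
  · exact Eventually.of_forall fun t => hA _

lemma mol_bdd {ρ u : ℝ → ℝ} (h : Integrable ρ) {A : ℝ}
    (hA : ∀ x, |u x| ≤ A) (x : ℝ) : |mol ρ u x| ≤ A * ∫ t, |ρ t| := by
  unfold mol
  rw [← integral_const_mul]
  refine norm_integral_le_of_norm_le (f := fun t => ρ t * u (x - t)) (h.abs.const_mul A)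
    (Eventually.of_forall fun t => ?_)
  rw [Real.norm_eq_abs, abs_mul, mul_comm]
  exact mul_le_mul_of_nonneg_right (hA _) (abs_nonneg _)

lemma mol_cont {ρ u : ℝ → ℝ} (h : IsTest ρ) (hu : Measurable u) {A : ℝ}
    (hA : ∀ x, |u x| ≤ A) : Continuous (mol ρ u) :=
  continuous_iff_continuousAt.2 fun x => (mol_hasDerivAt h hu hA x).continuousAt

lemma lip_of_deriv_bdd {p p' : ℝ → ℝ} (h : ∀ x, HasDerivAt p (p' x) x) {B : ℝ}
    (hB : ∀ x, |p' x| ≤ B) (x y : ℝ) : |p x - p y| ≤ B * |x - y| := by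
  have := Convex.norm_image_sub_le_of_norm_hasDerivWithin_le (f := p) (f' := p') (C := B)
    (s := univ) (fun x _ => (h x).hasDerivWithinAt) (fun x _ => hB x) convex_univ
    (mem_univ y) (mem_univ x)
  simpa [Real.norm_eq_abs] using this

lemma sd_bound {w w' : ℝ → ℝ} (h : ∀ x, HasDerivAt w (w' x) x) {B : ℝ} 
    (hB : ∀ x y, |w' x - w' y| ≤ B * |x - y|) (x : ℝ) {z : ℝ} (hz : 0 ≤ z) :
    |sdf w x z| ≤ 2 * B * z ^ 2 := by
  have hd : ∀ t, HasDerivAt (fun t => sdf w x t) (- w' (x + t) + w' (x - t)) t := by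
    intro t
    have h1 : HasDerivAt (fun t => w (x + t)) (w' (x + t)) t := by
      simpa using HasDerivAt.comp_const_add x t (h (x+t))
    have h2 : HasDerivAt (fun t => w (x - t)) (- w' (x - t)) t := by
      simpa using HasDerivAt.comp_const_sub x t (h (x-t))
    have h3 := ((hasDerivAt_const t (2 * w x)).sub h1).sub h2
    exact h3.congr_deriv (by ring)
  have hb0 : 0 ≤ B := by
    have := hB 1 0
    norm_num at this
    exact (abs_nonneg _).trans this
  have := Convex.norm_image_sub_le_of_norm_hasDerivWithin_le (f := fun t => sdf w x t)
    (f' := fun t => - w' (x + t) + w' (x - t)) (C := 2 * B * z)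
    (s := Icc 0 z) (fun t _ => (hd t).hasDerivWithinAt) (fun t ht => by
      have := hB (x - t) (x + t)
      rw [show x - t - (x + t) = -(2 * t) by ring, abs_neg, abs_of_nonneg (a := 2 * t) (by linarith [ht.1])] at this
      rw [Real.norm_eq_abs, neg_add_eq_sub]
      refine this.trans ?_
      nlinarith [ht.2, ht.1]) (convex_Icc _ _)
    (left_mem_Icc.2 hz) (right_mem_Icc.2 hz)
  simp only [Real.norm_eq_abs] at this
  have h0 : sdf w x 0 = 0 := by simp [sdf]; ring
  rw [h0, sub_zero, sub_zero, abs_of_nonneg hz] at this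
  nlinarith [this]

lemma dom_int {s : ℝ} (hs : s ∈ Ioo (0:ℝ) 1) {B A : ℝ} (hB : 0 ≤ B) (hA : 0 ≤ A) :
    IntegrableOn (fun z : ℝ => min (B * z ^ 2) A * z ^ (-1 - 2*s)) (Ioi 0) := by
  have hm : Measurable (fun z : ℝ => min (B * z ^ 2) A * z ^ (-1 - 2*s)) := by fun_prop
  rw [← Ioc_union_Ioi_eq_Ioi zero_le_one]
  refine IntegrableOn.union ?_ ?_
  · have h1 : IntegrableOn (fun z : ℝ => B * z ^ (1 - 2*s)) (Ioc 0 1) := by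
      have := (intervalIntegral.intervalIntegrable_rpow' (a := 0) (b := 1) (r := 1 - 2*s)
        (by linarith [hs.2])).const_mul B
      exact (intervalIntegrable_iff_integrableOn_Ioc_of_le zero_le_one).1 this
    refine h1.mono' hm.aestronglyMeasurable ?_
    refine (ae_restrict_iff' measurableSet_Ioc).2 (Eventually.of_forall fun z hz => ?_)
    have hp : 0 < z ^ (-1 - 2*s) := rpow_pos_of_pos hz.1 _
    have h0 : 0 ≤ min (B * z ^ 2) A := le_min (by positivity) hA
    rw [Real.norm_eq_abs, abs_of_nonneg (mul_nonneg h0 hp.le)]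
    calc _ ≤ B * z ^ 2 * z ^ (-1 - 2*s) := by gcongr; exact min_le_left _ _
      _ = B * z ^ (1 - 2*s) := by
        rw [mul_assoc, ← Real.rpow_natCast z 2, ← Real.rpow_add hz.1]; norm_num; left; ring_nf
  · have h1 : IntegrableOn (fun z : ℝ => A * z ^ (-1 - 2*s)) (Ioi 1) :=
      (integrableOn_Ioi_rpow_of_lt (by linarith [hs.1]) one_pos).const_mul A
    refine h1.mono' hm.aestronglyMeasurable ?_
    refine (ae_restrict_iff' measurableSet_Ioi).2 (Eventually.of_forall fun z hz => ?_)
    have hz0 : 0 < z := one_pos.trans hz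
    have hp : 0 < z ^ (-1 - 2*s) := rpow_pos_of_pos hz0 _
    have h0 : 0 ≤ min (B * z ^ 2) A := le_min (by positivity) hA
    rw [Real.norm_eq_abs, abs_of_nonneg (mul_nonneg h0 hp.le)]
    gcongr; exact min_le_right _ _

/-- domination of kernel products -/
lemma ker_dom {s : ℝ} {K : ℝ → ℝ} (hK : IsKer s K) {B A a : ℝ} {z : ℝ} (hz : 0 < z)
    (h1 : |a| ≤ B * z ^ 2) (h2 : |a| ≤ A) :
    ‖a * K z‖ ≤ min (B * z ^ 2) A * z ^ (-1 - 2*s) := by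
  rw [Real.norm_eq_abs, abs_mul, abs_of_nonneg (hK.nonneg z)]
  exact mul_le_mul (le_min h1 h2) (hK.le z hz) (hK.nonneg z) ((abs_nonneg _).trans (le_min h1 h2))

lemma ker_integrable {s : ℝ} (hs : s ∈ Ioo (0:ℝ) 1) {K : ℝ → ℝ} (hK : IsKer s K) {B A : ℝ}
    {a : ℝ → ℝ} (ha : Measurable a)
    (h1 : ∀ z, 0 < z → |a z| ≤ B * z ^ 2) (h2 : ∀ z, 0 < z → |a z| ≤ A) :
    IntegrableOn (fun z => a z * K z) (Ioi 0) := by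
  have hB : 0 ≤ B := by have := (abs_nonneg _).trans (h1 1 one_pos); simpa using this
  have hA : 0 ≤ A := (abs_nonneg _).trans (h2 1 one_pos)
  refine (dom_int hs hB hA).mono' (ha.mul hK.meas).aestronglyMeasurable ?_
  refine (ae_restrict_iff' measurableSet_Ioi).2 (Eventually.of_forall fun z hz => ?_)
  exact ker_dom hK hz (h1 z hz) (h2 z hz)

lemma sdf_meas {w : ℝ → ℝ} (hw : Measurable w) (x : ℝ) : Measurable (fun z => sdf w x z) := by
  unfold sdf
  have h1 : Measurable fun z => w (x + z) := hw.comp (measurable_const.add measurable_id)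
  have h2 : Measurable fun z => w (x - z) := hw.comp (measurable_const.sub measurable_id)
  exact (measurable_const.sub h1).sub h2

lemma sdf_le {w : ℝ → ℝ} {A : ℝ} (hA : ∀ x, |w x| ≤ A) (x z : ℝ) : |sdf w x z| ≤ 4 * A := by
  have h1 := abs_le.1 (hA x); have h2 := abs_le.1 (hA (x+z)); have h3 := abs_le.1 (hA (x-z))
  unfold sdf; rw [abs_le]; constructor <;> linarith [h1.1, h1.2, h2.1, h2.2, h3.1, h3.2]

lemma mol_sub_lip {ρ u : ℝ → ℝ} (h : IsTest ρ) (hu : Measurable u) {A : ℝ}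
    (hA : ∀ x, |u x| ≤ A) (x y : ℝ) :
    |mol ρ u x - mol ρ u y| ≤ (A * ∫ t, |deriv ρ t|) * |x - y| :=
  lip_of_deriv_bdd (mol_hasDerivAt h hu hA) (mol_bdd h.deriv.integrable hA) x y

lemma mol_sd_bound {ρ u : ℝ → ℝ} (h : IsTest ρ) (hu : Measurable u) {A : ℝ}
    (hA : ∀ x, |u x| ≤ A) (x : ℝ) {z : ℝ} (hz : 0 ≤ z) :
    |sdf (mol ρ u) x z| ≤ 2 * (A * ∫ t, |deriv (deriv ρ) t|) * z ^ 2 :=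
  sd_bound (mol_hasDerivAt h hu hA) (mol_sub_lip h.deriv hu hA) x hz

lemma mol_sd_integrable {s : ℝ} (hs : s ∈ Ioo (0:ℝ) 1) {K : ℝ → ℝ} (hK : IsKer s K)
    {ρ u : ℝ → ℝ} (h : IsTest ρ) (hu : Measurable u) {A : ℝ}
    (hA : ∀ x, |u x| ≤ A) (x : ℝ) :
    IntegrableOn (fun z => sdf (mol ρ u) x z * K z) (Ioi 0) :=
  ker_integrable hs hK (sdf_meas (mol_cont h hu hA).measurable x)
    (fun _ hz => mol_sd_bound h hu hA x hz.le) (fun _ _ => sdf_le (mol_bdd h.integrable hA) x _)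

lemma mol_tendsto {ρ u : ℝ → ℝ} (h : IsTest ρ) (hu : Measurable u) {A : ℝ}
    (hA : ∀ x, |u x| ≤ A) {b : ℝ} {F : Filter ℝ} [F.IsCountablyGenerated]
    (hb : Tendsto u F (nhds b)) (hF : ∀ t, Tendsto (fun x => x - t) F F) :
    Tendsto (mol ρ u) F (nhds ((∫ t, ρ t) * b)) := by
  rw [← integral_mul_const]
  unfold mol
  refine tendsto_integral_filter_of_dominated_convergence (fun t => |ρ t| * A) ?_ ?_
    (h.integrable.abs.mul_const A) ?_
  · exact Eventually.of_forall fun x => (mol_integrable h.integrable hu hA x).aestronglyMeasurable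
  · refine Eventually.of_forall fun x => Eventually.of_forall fun t => ?_
    rw [Real.norm_eq_abs, abs_mul]
    exact mul_le_mul_of_nonneg_left (hA _) (abs_nonneg _)
  · exact Eventually.of_forall fun t => (hb.comp (hF t)).const_mul _

lemma mol_tendsto_top {ρ u : ℝ → ℝ} (h : IsTest ρ) (hu : Measurable u) {A : ℝ}
    (hA : ∀ x, |u x| ≤ A) {b : ℝ} (hb : Tendsto u atTop (nhds b)) :
    Tendsto (mol ρ u) atTop (nhds ((∫ t, ρ t) * b)) :=
  mol_tendsto h hu hA hb fun t => tendsto_atTop_add_const_right _ (-t) tendsto_id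

lemma mol_tendsto_bot {ρ u : ℝ → ℝ} (h : IsTest ρ) (hu : Measurable u) {A : ℝ}
    (hA : ∀ x, |u x| ≤ A) {b : ℝ} (hb : Tendsto u atBot (nhds b)) :
    Tendsto (mol ρ u) atBot (nhds ((∫ t, ρ t) * b)) :=
  mol_tendsto h hu hA hb fun t => tendsto_atBot_add_const_right _ (-t) tendsto_id

/-- Mollifiers with support in `[-η, η]`. -/
structure IsMol (η : ℝ) (ρ : ℝ → ℝ) : Prop extends IsTest ρ where
  nonneg : ∀ t, 0 ≤ ρ t
  int_one : ∫ t, ρ t = 1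
  vanish : ∀ t, η < |t| → ρ t = 0

lemma exists_isMol {η : ℝ} (hη : 0 < η) : ∃ ρ, IsMol η ρ := by
  let φ : ContDiffBump (0:ℝ) := ⟨η / 2, η, by positivity, by linarith⟩
  refine ⟨φ.normed volume, ⟨φ.contDiff_normed, φ.hasCompactSupport_normed⟩, φ.nonneg_normed,
    φ.integral_normed, ?_⟩
  intro t ht
  have : t ∉ Function.support (φ.normed volume) := by
    rw [φ.support_normed_eq]
    simp only [Metric.mem_ball, dist_zero_right, Real.norm_eq_abs, not_lt]
    exact ht.le
  simpa using this

lemma IsMol.abs_int {η : ℝ} {ρ : ℝ → ℝ} (h : IsMol η ρ) : ∫ t, |ρ t| = 1 := by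
  rw [← h.int_one]; congr 1; ext t; exact abs_of_nonneg (h.nonneg t)

lemma mol_mono_le {η : ℝ} {ρ : ℝ → ℝ} (h : IsMol η ρ) {p q : ℝ → ℝ} {x y : ℝ}
    (hp : Integrable (fun t => ρ t * p (x - t))) (hq : Integrable (fun t => ρ t * q (y - t)))
    (hle : ∀ t, |t| ≤ η → p (x - t) ≤ q (y - t)) : mol ρ p x ≤ mol ρ q y := by
  refine integral_mono hp hq fun t => ?_
  by_cases ht : |t| ≤ η
  · exact mul_le_mul_of_nonneg_left (hle t ht) (h.nonneg t)
  · simp [h.vanish t (not_le.1 ht)]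

lemma mol_const {η : ℝ} {ρ : ℝ → ℝ} (h : IsMol η ρ) (c x : ℝ) : mol ρ (fun _ => c) x = c := by
  unfold mol; rw [integral_mul_const, h.int_one, one_mul]

/-- value comparison: mollified difference is controlled by pointwise one -/
lemma mol_sub_le {η : ℝ} {ρ : ℝ → ℝ} (h : IsMol η ρ) {p : ℝ → ℝ} (hp : Measurable p) {A : ℝ}
    (hA : ∀ x, |p x| ≤ A) {x y c : ℝ}
    (hle : ∀ t, |t| ≤ η → |p (x - t) - p (y - t)| ≤ c) : |mol ρ p x - mol ρ p y| ≤ c := by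
  have hi := mol_integrable h.integrable hp hA
  have : mol ρ p x - mol ρ p y = ∫ t, ρ t * (p (x - t) - p (y - t)) := by
    unfold mol; rw [← integral_sub (hi x) (hi y)]; congr 1; ext t; ring
  rw [this]
  have hb := norm_integral_le_of_norm_le (f := fun t => ρ t * (p (x - t) - p (y - t)))
    (h.integrable.mul_const c) (Eventually.of_forall fun t => by
      rw [Real.norm_eq_abs, abs_mul, abs_of_nonneg (h.nonneg t)]
      by_cases ht : |t| ≤ η
      · exact mul_le_mul_of_nonneg_left (hle t ht) (h.nonneg t)
      · simp [h.vanish t (not_le.1 ht)])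
  rw [integral_mul_const, h.int_one, one_mul] at hb
  exact hb

lemma mol_sub_self_le {η : ℝ} {ρ : ℝ → ℝ} (h : IsMol η ρ) {p : ℝ → ℝ} (hp : Measurable p) {A : ℝ}
    (hA : ∀ x, |p x| ≤ A) {x c : ℝ}
    (hle : ∀ t, |t| ≤ η → |p (x - t) - p x| ≤ c) : |mol ρ p x - p x| ≤ c := by
  have hi := mol_integrable h.integrable hp hA x
  have : mol ρ p x - p x = ∫ t, ρ t * (p (x - t) - p x) := by
    have h2 := integral_sub hi (h.integrable.mul_const (p x))
    rw [integral_mul_const, h.int_one, one_mul] at h2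
    unfold mol; rw [← h2]; congr 1; ext t; ring
  rw [this]
  have hb := norm_integral_le_of_norm_le (f := fun t => ρ t * (p (x - t) - p x))
    (h.integrable.mul_const c) (Eventually.of_forall fun t => by
      rw [Real.norm_eq_abs, abs_mul, abs_of_nonneg (h.nonneg t)]
      by_cases ht : |t| ≤ η
      · exact mul_le_mul_of_nonneg_left (hle t ht) (h.nonneg t)
      · simp [h.vanish t (not_le.1 ht)])
  rw [integral_mul_const, h.int_one, one_mul] at hb
  exact hb

lemma mol_bdd' {η : ℝ} {ρ u : ℝ → ℝ} (h : IsMol η ρ) {A : ℝ}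
    (hA : ∀ x, |u x| ≤ A) (x : ℝ) : |mol ρ u x| ≤ A := by
  have := mol_bdd h.integrable hA x
  rwa [h.abs_int, mul_one] at this

open Real MeasureTheory Filter Set

noncomputable def cs (s : ℝ) : ℝ := (1/4 : ℝ) ^ (2 - 2*s) / (2 - 2*s)

lemma cs_pos {s : ℝ} (hs : s ∈ Ioo (0:ℝ) 1) : 0 < cs s := by
  unfold cs
  have : 0 < 2 - 2*s := by linarith [hs.2]
  positivity

lemma int_small {s : ℝ} (hs : s ∈ Ioo (0:ℝ) 1) {r : ℝ} (hr : 0 < r) :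
    ∫ z in Ioc 0 (r/4), z ^ (1 - 2*s) = cs s * r ^ (2 - 2*s) := by
  rw [← intervalIntegral.integral_of_le (by positivity), integral_rpow (Or.inl (by linarith [hs.2]))]
  have h2 : 1 - 2*s + 1 = 2 - 2*s := by ring
  have h3 : (2 - 2*s) ≠ 0 := by have := hs.2; linarith
  rw [h2, Real.zero_rpow h3, sub_zero, cs, div_eq_mul_one_div r 4, Real.mul_rpow hr.le (by norm_num)]
  ring

lemma int_small_integrable {s : ℝ} (hs : s ∈ Ioo (0:ℝ) 1) {r : ℝ} (hr : 0 < r) :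
    IntegrableOn (fun z : ℝ => z ^ (1 - 2*s)) (Ioc 0 (r/4)) := by
  have := (intervalIntegral.intervalIntegrable_rpow' (a := 0) (b := r/4) (r := 1 - 2*s)
        (by linarith [hs.2]))
  exact (intervalIntegrable_iff_integrableOn_Ioc_of_le (by positivity)).1 this

theorem core_max {w ω : ℝ → ℝ} (hw : Continuous w) {la lb : ℝ}
    (hbot : Tendsto w atBot (nhds la)) (htop : Tendsto w atTop (nhds lb))
    {r0 M : ℝ} (hr0 : 0 < r0) (hM : 0 ≤ M)
    (hω : ContinuousOn ω (Icc 0 r0)) (hωn : ∀ r ∈ Icc 0 r0, 0 ≤ ω r)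
    {x1 r1 : ℝ} (hr1 : r1 ∈ Icc 0 r0) (h1 : M * ω r1 < w (x1 + r1) - w x1) :
    ∃ x, ∃ r ∈ Icc 0 r0, M * ω r < w (x + r) - w x ∧
      ∀ y, ∀ q ∈ Icc 0 r0, w (y + q) - w y - M * ω q ≤ w (x + r) - w x - M * ω r := by
  set δ := w (x1 + r1) - w x1 - M * ω r1 with hδ
  have hδ0 : 0 < δ := by linarith
  obtain ⟨T, hT⟩ := eventually_atTop.1 ((Metric.tendsto_nhds.1 htop) (δ/2) (by positivity))
  obtain ⟨T', hT'⟩ := eventually_atBot.1 ((Metric.tendsto_nhds.1 hbot) (δ/2) (by positivity))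
  have hout : ∀ y, ∀ q ∈ Icc 0 r0, y ∉ Icc (T' - r0) T → w (y + q) - w y - M * ω q < δ := by
    intro y q hq hy
    have hn := mul_nonneg hM (hωn q hq)
    rw [mem_Icc, not_and_or, not_le, not_le] at hy
    rcases hy with hy | hy
    · have a1 := abs_lt.1 (hT' y (by linarith)); have a2 := abs_lt.1 (hT' (y+q) (by linarith [hq.2]))
      linarith [a1.1, a1.2, a2.1, a2.2]
    · have a1 := abs_lt.1 (hT y (by linarith)); have a2 := abs_lt.1 (hT (y+q) (by linarith [hq.1]))
      linarith [a1.1, a1.2, a2.1, a2.2]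
  have hx1 : x1 ∈ Icc (T' - r0) T := by
    by_contra h
    exact lt_irrefl _ (hout x1 r1 hr1 h)
  have hc : ContinuousOn (fun p : ℝ × ℝ => w (p.1 + p.2) - w p.1 - M * ω p.2)
      (Icc (T' - r0) T ×ˢ Icc 0 r0) := by
    refine ContinuousOn.sub (by fun_prop) (continuousOn_const.mul ?_)
    exact hω.comp continuousOn_snd fun p hp => hp.2
  obtain ⟨⟨x, r⟩, hxr, hmax⟩ := (isCompact_Icc.prod isCompact_Icc).exists_isMaxOn
    ⟨(x1, r1), ⟨hx1, hr1⟩⟩ hc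
  have hge : δ ≤ w (x + r) - w x - M * ω r := hmax (a := (x1, r1)) ⟨hx1, hr1⟩
  refine ⟨x, r, hxr.2, by linarith, fun y q hq => ?_⟩
  by_cases hy : y ∈ Icc (T' - r0) T
  · exact hmax (a := (y, q)) ⟨hy, hq⟩
  · exact (hout y q hq hy).le.trans hge

theorem core {s : ℝ} (hs : s ∈ Ioo (0:ℝ) 1) {K : ℝ → ℝ} (hK : IsKer s K)
    (hK1 : ∀ z, 0 < z → z ≤ 1 → z ^ (-1 - 2*s) ≤ K z)
    {w ω : ℝ → ℝ} (hw : Continuous w) {la lb : ℝ}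
    (hbot : Tendsto w atBot (nhds la)) (htop : Tendsto w atTop (nhds lb))
    (hintg : ∀ x, IntegrableOn (fun z => sdf w x z * K z) (Ioi 0))
    {r0 M c p : ℝ} (hr0 : 0 < r0) (hr01 : r0 ≤ 1) (hM : 0 ≤ M) (hc : 0 ≤ c)
    (hω : ContinuousOn ω (Icc 0 r0)) (hω0 : ω 0 = 0) (hωn : ∀ r ∈ Icc 0 r0, 0 ≤ ω r)
    (hbig : ∀ x r, r0 ≤ r → r ≤ 2 * r0 → w (x + r) - w x ≤ M * ω r)
    (hconc : ∀ r z, 0 < r → r < r0 → 0 < z → z ≤ r / 4 →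
      c * r ^ (p - 2) * z ^ 2 ≤ 2 * ω r - ω (r + 2 * z) - ω (r - 2 * z))
    (hstrict : ∀ x r, 0 < r → r < r0 → M * ω r < w (x + r) - w x →
      (∀ y, ∀ q ∈ Icc 0 r0, w (y + q) - w y - M * ω q ≤ w (x + r) - w x - M * ω r) →
      Lop K w (x + r) - Lop K w x < M * c * cs s * r ^ (p - 2*s)) :
    ∀ x r, 0 ≤ r → r ≤ r0 → w (x + r) - w x ≤ M * ω r := by
  intro x1 r1 hr1 hr1'
  by_contra hcon
  obtain ⟨x, r, hr, hpos, hmax⟩ := core_max hw hbot htop hr0 hM hω hωn ⟨hr1, hr1'⟩ (not_le.1 hcon)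
  have hrpos : 0 < r := by
    rcases eq_or_lt_of_le hr.1 with h | h
    · rw [← h, hω0] at hpos; simp at hpos
    · exact h
  have hrlt : r < r0 := by
    rcases eq_or_lt_of_le hr.2 with h | h
    · have := hbig x r h.ge (by linarith)
      linarith
    · exact h
  have hstr := hstrict x r hrpos hrlt hpos hmax
  set Ψ := w (x + r) - w x - M * ω r with hΨ
  have hΨ0 : 0 < Ψ := by linarith
  have hmax2 : ∀ y q, 0 ≤ q → q ≤ 2 * r0 → w (y + q) - w y ≤ M * ω q + Ψ := by
    intro y q h0 h2
    rcases le_total q r0 with h | h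
    · have := hmax y q ⟨h0, h⟩; linarith
    · have := hbig y q h h2; linarith
  have hsync : ∀ z, 0 ≤ sdf w (x + r) z - sdf w x z := by
    intro z
    have h1 := hmax (x + z) r hr
    have h2 := hmax (x - z) r hr
    rw [show x + z + r = x + r + z by ring] at h1
    rw [show x - z + r = x + r - z by ring] at h2
    unfold sdf; linarith
  have hgain : ∀ z, 0 < z → z ≤ r / 4 →
      M * c * r ^ (p - 2) * z ^ 2 ≤ sdf w (x + r) z - sdf w x z := by
    intro z hz hz4
    have h1 := hmax2 (x - z) (r + 2 * z) (by linarith) (by linarith)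
    have h2 := hmax2 (x + z) (r - 2 * z) (by linarith) (by linarith)
    rw [show x - z + (r + 2 * z) = x + r + z by ring] at h1
    rw [show x + z + (r - 2 * z) = x + r - z by ring] at h2
    have h3 := mul_le_mul_of_nonneg_left (hconc r z hrpos hrlt hz hz4) hM
    unfold sdf
    nlinarith
  have hlow : M * c * cs s * r ^ (p - 2*s) ≤ Lop K w (x + r) - Lop K w x := by
    unfold Lop
    rw [← integral_sub (hintg _) (hintg _)]
    have hI : M * c * cs s * r ^ (p - 2*s) = ∫ z in Ioi (0:ℝ),
        (Ioc 0 (r/4)).indicator (fun z => M * c * r ^ (p - 2) * z ^ (1 - 2*s)) z := by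
      rw [setIntegral_indicator measurableSet_Ioc, inter_eq_right.2 Ioc_subset_Ioi_self,
        integral_const_mul, int_small hs hrpos, show p - 2*s = (p - 2) + (2 - 2*s) by ring,
        Real.rpow_add hrpos]
      ring
    rw [hI]
    refine setIntegral_mono_on ?_ ((hintg _).sub (hintg _)) measurableSet_Ioi ?_
    · exact (((integrable_indicator_iff measurableSet_Ioc).2
        ((int_small_integrable hs hrpos).const_mul _))).integrableOn
    · intro z hz
      rw [← sub_mul]
      by_cases hz4 : z ∈ Ioc 0 (r/4)
      · rw [indicator_of_mem hz4]
        have hz0 : 0 < z := hz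
        have h1 := hgain z hz hz4.2
        have h2 := hK1 z hz (by linarith [hz4.2])
        calc M * c * r ^ (p - 2) * z ^ (1 - 2*s)
            = M * c * r ^ (p - 2) * z ^ 2 * z ^ (-1 - 2*s) := by
              rw [mul_assoc _ (z ^ 2), ← Real.rpow_natCast z 2, ← Real.rpow_add hz0]
              congr 2; push_cast; ring
          _ ≤ _ := mul_le_mul h1 h2 (rpow_nonneg hz0.le _) (hsync z)
      · rw [indicator_of_notMem hz4]
        exact mul_nonneg (hsync z) (hK.nonneg z)
  linarith

/-- Quantitative concavity from a second-derivative bound. -/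
lemma second_diff_ge {φ φ1 φ2 : ℝ → ℝ} {a d κ : ℝ} (hd : 0 ≤ d)
    (h1 : ∀ t ∈ Icc (a - d) (a + d), HasDerivAt φ (φ1 t) t)
    (h2 : ∀ t ∈ Icc (a - d) (a + d), HasDerivAt φ1 (φ2 t) t)
    (hκ : ∀ t ∈ Icc (a - d) (a + d), φ2 t ≤ -κ) :
    κ * d ^ 2 ≤ 2 * φ a - φ (a + d) - φ (a - d) := by
  -- the derivative of the second difference
  have key1 : ∀ t ∈ Icc 0 d, 2 * κ * t ≤ φ1 (a - t) - φ1 (a + t) := by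
    intro t ht
    have hmono : AntitoneOn (fun y => φ1 y + κ * y) (Icc (a - d) (a + d)) := by
      refine antitoneOn_of_hasDerivWithinAt_nonpos (f' := fun y => φ2 y + κ) (convex_Icc _ _) ?_ ?_ ?_
      · intro y hy
        exact ((h2 y hy).continuousAt.add (by fun_prop)).continuousWithinAt
      · intro y hy
        have hy' := interior_subset hy
        have := (h2 y hy').add ((hasDerivAt_id y).const_mul κ)
        simp only [mul_one] at this
        exact this.hasDerivWithinAt
      · intro y hy
        have := hκ y (interior_subset hy)
        linarith
    have := hmono (a := a - t) (b := a + t) ⟨by linarith [ht.2], by linarith [ht.1]⟩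
      ⟨by linarith [ht.1], by linarith [ht.2]⟩ (by linarith [ht.1])
    simp only at this
    linarith
  have hmono : MonotoneOn (fun t => 2 * φ a - φ (a + t) - φ (a - t) - κ * t ^ 2) (Icc 0 d) := by
    have hdd : ∀ t ∈ Icc 0 d, HasDerivAt (fun t => 2 * φ a - φ (a + t) - φ (a - t) - κ * t ^ 2)
        (- φ1 (a + t) + φ1 (a - t) - κ * (2 * t)) t := by
      intro t ht
      have e1 := HasDerivAt.comp_const_add a t (h1 (a+t) ⟨by linarith [ht.1], by linarith [ht.2]⟩)
      have e2 := HasDerivAt.comp_const_sub a t (h1 (a-t) ⟨by linarith [ht.2], by linarith [ht.1]⟩)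
      have e3 := ((hasDerivAt_pow 2 t).const_mul κ)
      have e4 := (((hasDerivAt_const t (2 * φ a)).sub e1).sub e2).sub e3
      refine e4.congr_deriv ?_
      norm_num
    refine monotoneOn_of_hasDerivWithinAt_nonneg (f' := fun t => - φ1 (a + t) + φ1 (a - t) - κ * (2 * t))
      (convex_Icc _ _) ?_ ?_ ?_
    · intro y hy
      exact (hdd y hy).continuousAt.continuousWithinAt
    · intro y hy
      exact (hdd y (interior_subset hy)).hasDerivWithinAt
    · intro y hy
      have := key1 y (interior_subset hy)
      linarith
  have := hmono (left_mem_Icc.2 hd) (right_mem_Icc.2 hd) hd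
  simp only [add_zero, sub_zero] at this
  nlinarith

lemma conc_holder {α : ℝ} (h0 : 0 < α) (h1 : α < 1) {r z : ℝ} (hr : 0 < r) (hz : 0 < z)
    (hz4 : z ≤ r / 4) :
    α * (1 - α) * r ^ (α - 2) * z ^ 2 ≤ 2 * r ^ α - (r + 2 * z) ^ α - (r - 2 * z) ^ α := by
  have hpos : ∀ t ∈ Icc (r - 2 * z) (r + 2 * z), 0 < t ∧ t ≤ 2 * r := fun t ht =>
    ⟨by linarith [ht.1], by linarith [ht.2]⟩
  have := second_diff_ge (φ := fun t => t ^ α) (φ1 := fun t => α * t ^ (α - 1))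
    (φ2 := fun t => α * ((α - 1) * t ^ (α - 1 - 1))) (a := r) (d := 2 * z)
    (κ := α * (1 - α) * (2 * r) ^ (α - 2)) (by positivity)
    (fun t ht => Real.hasDerivAt_rpow_const (Or.inl (hpos t ht).1.ne'))
    (fun t ht => (Real.hasDerivAt_rpow_const (Or.inl (hpos t ht).1.ne')).const_mul α)
    (fun t ht => by
      have hle : (2 * r) ^ (α - 2) ≤ t ^ (α - 2) :=
        Real.rpow_le_rpow_of_nonpos (hpos t ht).1 (hpos t ht).2 (by linarith)
      rw [show α - 1 - 1 = α - 2 by ring]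
      have hq : 0 ≤ α * (1 - α) := mul_nonneg h0.le (by linarith)
      nlinarith [mul_le_mul_of_nonneg_left hle hq])
  refine le_trans ?_ this
  have h2 : (1/4:ℝ) ≤ 2 ^ (α - 2) := by
    have : (2:ℝ) ^ (-2:ℝ) ≤ 2 ^ (α - 2) := Real.rpow_le_rpow_of_exponent_le (by norm_num) (by linarith)
    refine le_trans (le_of_eq ?_) this
    rw [Real.rpow_neg (by norm_num)]; norm_num
  rw [Real.mul_rpow (by norm_num) hr.le]
  have hq : 0 ≤ α * (1 - α) := mul_nonneg h0.le (by linarith)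
  have hp : 0 < r ^ (α - 2) := rpow_pos_of_pos hr _
  have hX : 0 ≤ α * (1 - α) * r ^ (α - 2) * z ^ 2 := by positivity
  nlinarith [mul_le_mul_of_nonneg_left h2 hX]

/-- Lipschitz modulus -/
noncomputable def omL (θ r : ℝ) : ℝ := r - (1/4) * r ^ (1 + θ)

lemma omL_conc {θ : ℝ} (h0 : 0 < θ) (h1 : θ < 1) {r z : ℝ} (hr : 0 < r) (hz : 0 < z)
    (hz4 : z ≤ r / 4) :
    θ / 2 * r ^ ((1 + θ) - 2) * z ^ 2 ≤ 2 * omL θ r - omL θ (r + 2 * z) - omL θ (r - 2 * z) := by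
  have hpos : ∀ t ∈ Icc (r - 2 * z) (r + 2 * z), 0 < t ∧ t ≤ 2 * r := fun t ht =>
    ⟨by linarith [ht.1], by linarith [ht.2]⟩
  have := second_diff_ge (φ := omL θ) (φ1 := fun t => 1 - (1/4) * ((1+θ) * t ^ (1 + θ - 1)))
    (φ2 := fun t => 0 - (1/4) * ((1+θ) * ((1 + θ - 1) * t ^ (1 + θ - 1 - 1)))) (a := r) (d := 2 * z)
    (κ := (1/4) * (θ * (2 * r) ^ (1 + θ - 2))) (by positivity)
    (fun t ht => (hasDerivAt_id t).sub
      ((Real.hasDerivAt_rpow_const (Or.inl (hpos t ht).1.ne')).const_mul (1/4)))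
    (fun t ht => (hasDerivAt_const t (1:ℝ)).sub
      (((Real.hasDerivAt_rpow_const (Or.inl (hpos t ht).1.ne')).const_mul (1+θ)).const_mul (1/4)))
    (fun t ht => by
      have hle : (2 * r) ^ (1 + θ - 2) ≤ t ^ (1 + θ - 2) :=
        Real.rpow_le_rpow_of_nonpos (hpos t ht).1 (hpos t ht).2 (by linarith)
      have hp : 0 < (2 * r) ^ (1 + θ - 2) := rpow_pos_of_pos (by positivity) _
      rw [show 1 + θ - 1 - 1 = 1 + θ - 2 by ring, show 1 + θ - 1 = θ by ring]
      have e1 := mul_le_mul_of_nonneg_left hle h0.le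
      have e2 : 0 ≤ θ * (θ * t ^ (1 + θ - 2)) := by
        have := rpow_nonneg (hpos t ht).1.le (1 + θ - 2)
        positivity
      nlinarith)
  refine le_trans ?_ this
  have h2 : (1/2:ℝ) ≤ 2 ^ (1 + θ - 2) := by
    have : (2:ℝ) ^ (-1:ℝ) ≤ 2 ^ (1 + θ - 2) := Real.rpow_le_rpow_of_exponent_le (by norm_num) (by linarith)
    refine le_trans (le_of_eq ?_) this
    rw [Real.rpow_neg (by norm_num)]; norm_num
  rw [Real.mul_rpow (by norm_num) hr.le]
  have hp : 0 < r ^ (1 + θ - 2) := rpow_pos_of_pos hr _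
  have hX : 0 ≤ θ * r ^ (1 + θ - 2) * z ^ 2 := by positivity
  nlinarith [mul_le_mul_of_nonneg_left h2 hX]

lemma omL_cont {θ : ℝ} (h0 : 0 < θ) : Continuous (omL θ) := by
  unfold omL
  have : Continuous fun r : ℝ => r ^ (1 + θ) := Real.continuous_rpow_const (by linarith)
  fun_prop

lemma omL_zero {θ : ℝ} (h0 : 0 < θ) : omL θ 0 = 0 := by
  unfold omL; rw [Real.zero_rpow (by linarith)]; simp

lemma omL_le {θ r : ℝ} (hr : 0 ≤ r) : omL θ r ≤ r := by
  unfold omL; have := rpow_nonneg hr (1 + θ); linarith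

lemma omL_ge {θ r : ℝ} (h0 : 0 < θ) (h1 : θ < 1) (hr : 0 ≤ r) (hr2 : r ≤ 2) : r / 2 ≤ omL θ r := by
  rcases eq_or_lt_of_le hr with rfl | hr
  · rw [omL_zero h0]; simp
  unfold omL
  rw [Real.rpow_add hr, Real.rpow_one]
  have : r ^ θ ≤ 2 := by
    calc r ^ θ ≤ 2 ^ θ := Real.rpow_le_rpow hr.le hr2 h0.le
      _ ≤ 2 ^ (1:ℝ) := Real.rpow_le_rpow_of_exponent_le (by norm_num) h1.le
      _ = 2 := by norm_num
  nlinarith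

lemma omL_mono {θ : ℝ} (h0 : 0 < θ) (h1 : θ < 1) : MonotoneOn (omL θ) (Icc 0 2) := by
  refine monotoneOn_of_hasDerivWithinAt_nonneg
    (f' := fun t => 1 - (1/4) * ((1+θ) * t ^ (1 + θ - 1))) (convex_Icc _ _)
    (omL_cont h0).continuousOn ?_ ?_
  · intro t ht
    rw [interior_Icc] at ht
    exact ((hasDerivAt_id t).sub
      ((Real.hasDerivAt_rpow_const (Or.inl ht.1.ne')).const_mul (1/4))).hasDerivWithinAt
  · intro t ht
    rw [interior_Icc] at ht
    rw [show 1 + θ - 1 = θ by ring]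
    have : t ^ θ ≤ 2 := by
      calc t ^ θ ≤ 2 ^ θ := Real.rpow_le_rpow ht.1.le ht.2.le h0.le
        _ ≤ 2 ^ (1:ℝ) := Real.rpow_le_rpow_of_exponent_le (by norm_num) h1.le
        _ = 2 := by norm_num
    have := rpow_nonneg ht.1.le θ
    nlinarith

open Real MeasureTheory Filter Set

/-- Weak formulation of `L_K u = g`. -/
def WeakSol (K u g : ℝ → ℝ) : Prop := ∀ ρ, IsTest ρ → ∀ x, Lop K (mol ρ u) x = mol ρ g x

lemma mono_lims {u : ℝ → ℝ} (hu : Monotone u) {A : ℝ} (hA : ∀ x, |u x| ≤ A) :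
    ∃ la lb, Tendsto u atBot (nhds la) ∧ Tendsto u atTop (nhds lb) := by
  refine ⟨_, _, tendsto_atBot_ciInf hu ⟨-A, ?_⟩, tendsto_atTop_ciSup hu ⟨A, ?_⟩⟩
  · rintro _ ⟨x, rfl⟩; exact (abs_le.1 (hA x)).1
  · rintro _ ⟨x, rfl⟩; exact (abs_le.1 (hA x)).2

lemma mol_g_le {η L : ℝ} {ρ u g : ℝ → ℝ} (h : IsMol η ρ) (hu : Measurable u) (hg : Measurable g)
    {A B : ℝ} (hA : ∀ x, |u x| ≤ A) (hB : ∀ x, |g x| ≤ B)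
    (hLip : ∀ x y, x ≤ y → g y - g x ≤ L * (u y - u x)) {x y : ℝ} (hxy : x ≤ y) :
    mol ρ g y - mol ρ g x ≤ L * (mol ρ u y - mol ρ u x) := by
  have iu := mol_integrable h.integrable hu hA
  have ig := mol_integrable h.integrable hg hB
  unfold mol
  rw [← integral_sub (ig y) (ig x), ← integral_sub (iu y) (iu x), ← integral_const_mul]
  refine integral_mono ((ig y).sub (ig x)) (((iu y).sub (iu x)).const_mul L) fun t => ?_
  have := mul_le_mul_of_nonneg_left (hLip (x - t) (y - t) (by linarith)) (h.nonneg t)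
  simp only
  linarith

theorem lip_core {s L : ℝ} (hs : s ∈ Ioo (0:ℝ) 1) (hL : 0 ≤ L) : ∃ Λ : ℝ, 0 ≤ Λ ∧
    ∀ K : ℝ → ℝ, IsKer s K → (∀ z, 0 < z → z ≤ 1 → z ^ (-1 - 2*s) ≤ K z) →
    ∀ u g : ℝ → ℝ, Monotone u → (∀ x, |u x| ≤ 1) → Measurable g → (∃ B, ∀ x, |g x| ≤ B) →
    (∀ x y, x ≤ y → g y - g x ≤ L * (u y - u x)) → WeakSol K u g →
    ∀ x y, |u x - u y| ≤ Λ * |x - y| := by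
  obtain ⟨hs0, hs1⟩ := hs
  have hs : s ∈ Ioo (0:ℝ) 1 := ⟨hs0, hs1⟩
  have hcs := cs_pos hs
  set a : ℝ := s * cs s / (4 * (L + 1)) with ha
  have ha0 : 0 < a := by positivity
  set r0 : ℝ := min 1 (a ^ (1/s)) with hr0d
  have hr0 : 0 < r0 := lt_min one_pos (rpow_pos_of_pos ha0 _)
  have hr01 : r0 ≤ 1 := min_le_left _ _
  have hsmall : ∀ r, 0 < r → r < r0 → r ^ s < a := by
    intro r h1 h2
    have : r < a ^ (1/s) := lt_of_lt_of_le h2 (min_le_right _ _)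
    have h3 := Real.rpow_lt_rpow h1.le this hs0
    rwa [← Real.rpow_mul ha0.le, one_div, inv_mul_cancel₀ hs0.ne', Real.rpow_one] at h3
  have hom0 : 0 < omL s r0 := lt_of_lt_of_le (by positivity) (omL_ge hs0 hs1 hr0.le (by linarith))
  set M1 : ℝ := 2 / omL s r0 with hM1
  have hM10 : 0 < M1 := by positivity
  have key : ∀ K : ℝ → ℝ, IsKer s K → (∀ z, 0 < z → z ≤ 1 → z ^ (-1 - 2*s) ≤ K z) →
    ∀ u g : ℝ → ℝ, Monotone u → (∀ x, |u x| ≤ 1) → Measurable g → (∃ B, ∀ x, |g x| ≤ B) →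
    (∀ x y, x ≤ y → g y - g x ≤ L * (u y - u x)) → WeakSol K u g →
    ∀ η ρ, IsMol η ρ → ∀ x r, 0 ≤ r → r ≤ r0 →
      mol ρ u (x + r) - mol ρ u x ≤ M1 * omL s r := by
    intro K hK hK1 u g hu hu1 hg hB hLip hW η ρ hρ
    obtain ⟨B, hB⟩ := hB
    obtain ⟨la, lb, hla, hlb⟩ := mono_lims hu hu1
    have hum := hu.measurable
    set w := mol ρ u with hw
    have hωn : ∀ r ∈ Icc 0 r0, 0 ≤ omL s r := fun r hr =>
      le_trans (by linarith [hr.1]) (omL_ge hs0 hs1 hr.1 (by linarith [hr.2]))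
    have step : ∀ M, M1 ≤ M → (∀ x r, 0 ≤ r → r ≤ r0 → w (x + r) - w x ≤ 2 * M * omL s r) →
        (∀ x r, 0 ≤ r → r ≤ r0 → w (x + r) - w x ≤ M * omL s r) := by
      intro M hM h2
      have hM0 : 0 < M := hM10.trans_le hM
      refine core hs hK hK1 (mol_cont hρ.toIsTest hum hu1) (mol_tendsto_bot hρ.toIsTest hum hu1 hla)
        (mol_tendsto_top hρ.toIsTest hum hu1 hlb) (mol_sd_integrable hs hK hρ.toIsTest hum hu1)
        (c := s / 2) (p := 1 + s) hr0 hr01 hM0.le (by positivity) (omL_cont hs0).continuousOn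
        (omL_zero hs0) hωn ?_ ?_ ?_
      · intro x r h1 h3
        have e1 := abs_le.1 (mol_bdd' hρ hu1 x)
        have e2 := abs_le.1 (mol_bdd' hρ hu1 (x + r))
        have e3 : omL s r0 ≤ omL s r := omL_mono hs0 hs1 ⟨hr0.le, by linarith⟩
          ⟨by linarith, by linarith⟩ h1
        have e4 : 2 ≤ M * omL s r := by
          calc (2:ℝ) = M1 * omL s r0 := by rw [hM1]; field_simp
            _ ≤ M * omL s r := mul_le_mul hM e3 hom0.le hM0.le
        linarith [e1.1, e2.2]
      · intro r z h1 _ h3 h4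
        exact omL_conc hs0 hs1 h1 h3 h4
      · intro x r h1 h3 _ _
        rw [hW ρ hρ.toIsTest, hW ρ hρ.toIsTest]
        have e1 := mol_g_le hρ hum hg hu1 hB hLip (show x ≤ x + r by linarith)
        have e2 := h2 x r h1.le h3.le
        have e3 := omL_le (θ := s) h1.le
        have e4 := hsmall r h1 h3
        have e5 : mol ρ g (x + r) - mol ρ g x ≤ L * (2 * M * r) := by
          refine e1.trans (mul_le_mul_of_nonneg_left (e2.trans ?_) hL)
          exact mul_le_mul_of_nonneg_left e3 (by positivity)
        refine lt_of_le_of_lt e5 ?_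
        have e6 : r = r ^ s * r ^ (1 + s - 2*s) := by
          rw [← Real.rpow_add h1]; ring_nf; rw [Real.rpow_one]
        have e7 : 0 < r ^ (1 + s - 2*s) := rpow_pos_of_pos h1 _
        have e8 : 2 * L * r ^ s < s / 2 * cs s := by
          calc 2 * L * r ^ s ≤ 2 * L * a := by gcongr
            _ < 2 * (L + 1) * a := by nlinarith
            _ = s / 2 * cs s := by rw [ha]; field_simp; ring
        calc L * (2 * M * r) = M * (2 * L * r ^ s) * r ^ (1 + s - 2*s) := by
              conv_lhs => rw [e6]
              ring
          _ < M * (s / 2 * cs s) * r ^ (1 + s - 2*s) := by gcongr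
          _ = _ := by ring
    obtain ⟨j, hj⟩ := pow_unbounded_of_one_lt
      (2 * (1 * ∫ t, |deriv ρ t|) / M1) (one_lt_two (α := ℝ))
    have base : ∀ x r, 0 ≤ r → r ≤ r0 → w (x + r) - w x ≤ 2 ^ j * M1 * omL s r := by
      intro x r h1 h2
      have e1 := (le_abs_self _).trans (mol_sub_lip hρ.toIsTest hum hu1 (x + r) x)
      rw [show x + r - x = r by ring, abs_of_nonneg h1] at e1
      rw [div_lt_iff₀ hM10] at hj
      have e2 := omL_ge hs0 hs1 h1 (by linarith)
      refine e1.trans ?_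
      have e3 : (0:ℝ) ≤ ∫ t, |deriv ρ t| := integral_nonneg fun t => abs_nonneg _
      calc (1 * ∫ t, |deriv ρ t|) * r = (2 * (1 * ∫ t, |deriv ρ t|)) * (r / 2) := by ring
        _ ≤ (2 ^ j * M1) * omL s r := mul_le_mul hj.le e2 (by positivity) (by positivity)
    clear hj
    induction j with
    | zero => simpa using base
    | succ j ih =>
      refine ih (step _ ?_ ?_)
      · have : (1:ℝ) ≤ 2 ^ j := one_le_pow₀ (by norm_num)
        nlinarith
      · intro x r h1 h2
        have := base x r h1 h2
        rw [pow_succ] at this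
        linarith
  refine ⟨max M1 (2 / r0), hM10.le.trans (le_max_left _ _), ?_⟩
  intro K hK hK1 u g hu hu1 hg hB hLip hW
  have main : ∀ x y, x ≤ y → u y - u x ≤ max M1 (2 / r0) * (y - x) := by
    intro x y hxy
    rcases lt_or_ge (y - x) r0 with hlt | hge
    · have : ∀ η, 0 < η → y - x + 2 * η ≤ r0 →
          u y - u x ≤ max M1 (2 / r0) * (y - x + 2 * η) := by
        intro η hη hle
        obtain ⟨ρ, hρ⟩ := exists_isMol hη
        have e1 := key K hK hK1 u g hu hu1 hg hB hLip hW η ρ hρ (x - η) (y - x + 2 * η)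
          (by linarith) hle
        have i1 := mol_integrable hρ.integrable hu.measurable hu1
        have e2 : u y ≤ mol ρ u (x - η + (y - x + 2 * η)) := by
          rw [← mol_const hρ (u y) 0]
          refine mol_mono_le hρ (hρ.integrable.mul_const _) (i1 _) fun t ht => hu ?_
          linarith [(abs_le.1 ht).2]
        have e3 : mol ρ u (x - η) ≤ u x := by
          rw [← mol_const hρ (u x) 0]
          refine mol_mono_le hρ (i1 _) (hρ.integrable.mul_const _) fun t ht => hu ?_
          linarith [(abs_le.1 ht).1]
        have e4 := omL_le (θ := s) (show 0 ≤ y - x + 2 * η by linarith)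
        have e5 : M1 * omL s (y - x + 2 * η) ≤ max M1 (2 / r0) * (y - x + 2 * η) :=
          (mul_le_mul_of_nonneg_left e4 hM10.le).trans
            (mul_le_mul_of_nonneg_right (le_max_left _ _) (by linarith))
        linarith
      have hlim : Tendsto (fun η => max M1 (2 / r0) * (y - x + 2 * η)) (nhdsWithin 0 (Ioi 0))
          (nhds (max M1 (2 / r0) * (y - x + 2 * 0))) := by
        refine (Continuous.tendsto ?_ 0).mono_left nhdsWithin_le_nhds
        fun_prop
      rw [mul_zero, add_zero] at hlim
      refine ge_of_tendsto hlim ?_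
      have hev : ∀ᶠ η in nhdsWithin (0:ℝ) (Ioi 0), η < (r0 - (y - x)) / 2 :=
        nhdsWithin_le_nhds (Iio_mem_nhds (by linarith))
      filter_upwards [hev, self_mem_nhdsWithin] with η h1 h2
      exact this η h2 (by linarith)
    · have e1 := abs_le.1 (hu1 x); have e2 := abs_le.1 (hu1 y)
      have e3 : 2 ≤ (2 / r0) * (y - x) := by
        calc (2:ℝ) = (2 / r0) * r0 := by field_simp
          _ ≤ _ := mul_le_mul_of_nonneg_left hge (by positivity)
      have e4 : (2 / r0) * (y - x) ≤ max M1 (2 / r0) * (y - x) :=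
        mul_le_mul_of_nonneg_right (le_max_right _ _) (by linarith)
      linarith [e1.1, e2.2]
  intro x y
  rcases le_total x y with h | h
  · have := main x y h; have h3 := hu h
    rw [abs_sub_comm, abs_sub_comm x, abs_of_nonneg (by linarith), abs_of_nonneg (by linarith)]
    exact this
  · have := main y x h; have h3 := hu h
    rw [abs_of_nonneg (by linarith), abs_of_nonneg (by linarith)]
    exact this

open Real MeasureTheory Filter Set

lemma Lop_neg (K w : ℝ → ℝ) (x : ℝ) : Lop K (fun y => - w y) x = - Lop K w x := by
  unfold Lop; rw [← integral_neg]; congr 1; ext z; unfold sdf; ring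

lemma Lop_sub {K w v : ℝ → ℝ} {x : ℝ} (hw : IntegrableOn (fun z => sdf w x z * K z) (Ioi 0))
    (hv : IntegrableOn (fun z => sdf v x z * K z) (Ioi 0)) :
    Lop K (fun y => w y - v y) x = Lop K w x - Lop K v x := by
  unfold Lop; rw [← integral_sub hw hv]; congr 1; ext z; unfold sdf; ring

theorem core2 {s : ℝ} (hs : s ∈ Ioo (0:ℝ) 1) {K : ℝ → ℝ} (hK : IsKer s K)
    (hK1 : ∀ z, 0 < z → z ≤ 1 → z ^ (-1 - 2*s) ≤ K z)
    {w ω : ℝ → ℝ} (hw : Continuous w)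
    (hlim : ∃ la lb, Tendsto w atBot (nhds la) ∧ Tendsto w atTop (nhds lb))
    (hintg : ∀ x, IntegrableOn (fun z => sdf w x z * K z) (Ioi 0))
    {M c p A H : ℝ} (hc : 0 ≤ c)
    (hω : ContinuousOn ω (Icc 0 1)) (hω0 : ω 0 = 0) (hωn : ∀ r ∈ Icc (0:ℝ) 1, 0 ≤ ω r)
    (hω1 : ∀ r, 1 ≤ r → r ≤ 2 → 1/2 ≤ ω r)
    (hA : ∀ x, |w x| ≤ A)
    (hconc : ∀ r z, 0 < r → r < 1 → 0 < z → z ≤ r / 4 →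
      c * r ^ (p - 2) * z ^ 2 ≤ 2 * ω r - ω (r + 2 * z) - ω (r - 2 * z))
    (hL : ∀ x r, 0 < r → r < 1 → |Lop K w (x + r) - Lop K w x| ≤ H * r ^ (p - 2*s))
    (hM1 : 4 * A ≤ M) (hM2 : H < M * c * cs s) :
    ∀ x r, 0 ≤ r → r ≤ 1 → |w (x + r) - w x| ≤ M * ω r := by
  obtain ⟨la, lb, hla, hlb⟩ := hlim
  have hA0 : 0 ≤ A := (abs_nonneg _).trans (hA 0)
  have hM0 : 0 ≤ M := by linarith
  have h1 : ∀ x r, 0 ≤ r → r ≤ 1 → w (x + r) - w x ≤ M * ω r := by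
    refine core hs hK hK1 hw hla hlb hintg (c := c) (p := p) one_pos le_rfl hM0 hc hω hω0 hωn ?_
      hconc ?_
    · intro x r h1 h2
      have e1 := abs_le.1 (hA x); have e2 := abs_le.1 (hA (x + r))
      have e3 := hω1 r h1 (by linarith)
      nlinarith [e1.1, e2.2]
    · intro x r h1 h2 _ _
      refine lt_of_le_of_lt ((le_abs_self _).trans (hL x r h1 h2)) ?_
      exact mul_lt_mul_of_pos_right hM2 (rpow_pos_of_pos h1 _)
  have h2 : ∀ x r, 0 ≤ r → r ≤ 1 → (fun y => - w y) (x + r) - (fun y => - w y) x ≤ M * ω r := by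
    refine core hs hK hK1 (w := fun y => - w y) hw.neg hla.neg hlb.neg ?_ (c := c) (p := p)
      one_pos le_rfl hM0 hc hω hω0 hωn ?_ hconc ?_
    · intro x
      have := (hintg x).neg
      refine this.congr (Eventually.of_forall fun z => ?_)
      simp only [Pi.neg_apply]; unfold sdf; ring
    · intro x r h1 h2
      have e1 := abs_le.1 (hA x); have e2 := abs_le.1 (hA (x + r))
      have e3 := hω1 r h1 (by linarith)
      nlinarith [e1.2, e2.1]
    · intro x r h1 h2 _ _
      rw [Lop_neg, Lop_neg]
      refine lt_of_le_of_lt ?_ (mul_lt_mul_of_pos_right hM2 (rpow_pos_of_pos h1 (p - 2*s)))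
      have := (neg_le_abs _).trans (hL x r h1 h2)
      linarith
  intro x r hr hr1
  rw [abs_le]
  have a := h1 x r hr hr1
  have b := h2 x r hr hr1
  simp only at b
  constructor <;> linarith

/-- Uniform local Hölder estimate -/
def Hol (β H : ℝ) (q : ℝ → ℝ) : Prop := ∀ x y, |x - y| ≤ 1 → |q x - q y| ≤ H * |x - y| ^ β

lemma Hol.nonneg {β H : ℝ} {q : ℝ → ℝ} (h : Hol β H q) : 0 ≤ H := by
  have := (abs_nonneg _).trans (h 0 1 (by simp))
  simpa using this

lemma Hol.mono {β β' H : ℝ} {q : ℝ → ℝ} (h : Hol β H q) (hb : β' ≤ β) (hβ' : 0 < β') :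
    Hol β' H q := by
  intro x y hxy
  refine (h x y hxy).trans (mul_le_mul_of_nonneg_left ?_ h.nonneg)
  rcases eq_or_lt_of_le (abs_nonneg (x - y)) with h0 | h0
  · rw [← h0, Real.zero_rpow (by linarith), Real.zero_rpow hβ'.ne']
  · exact Real.rpow_le_rpow_of_exponent_ge h0 hxy hb

lemma mol_approx {q : ℝ → ℝ} {β H A η : ℝ} (hβ : 0 < β) (hH : Hol β H q) (hq : Measurable q)
    (hA : ∀ x, |q x| ≤ A) (h1 : η ≤ 1) {ρ : ℝ → ℝ} (hρ : IsMol η ρ) (x : ℝ) :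
    |mol ρ q x - q x| ≤ H * η ^ β := by
  refine mol_sub_self_le hρ hq hA fun t ht => ?_
  have e : |x - t - x| = |t| := by rw [show x - t - x = -t by ring, abs_neg]
  refine (hH _ _ (by rw [e]; linarith)).trans ?_
  rw [e]
  exact mul_le_mul_of_nonneg_left (Real.rpow_le_rpow (abs_nonneg _) ht hβ.le) hH.nonneg

lemma mol_hol {q : ℝ → ℝ} {β H A η : ℝ} (hH : Hol β H q) (hq : Measurable q)
    (hA : ∀ x, |q x| ≤ A) {ρ : ℝ → ℝ} (hρ : IsMol η ρ) : Hol β H (mol ρ q) := by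
  intro x y hxy
  refine mol_sub_le hρ hq hA fun t ht => ?_
  have := hH (x - t) (y - t) (by rwa [sub_sub_sub_cancel_right])
  rwa [sub_sub_sub_cancel_right] at this

/-- Data of a linear problem. -/
structure Pr (K q g : ℝ → ℝ) : Prop where
  mq : Measurable q
  mg : Measurable g
  bq : ∃ A, ∀ x, |q x| ≤ A
  bg : ∃ A, ∀ x, |g x| ≤ A
  lims : ∀ ρ, IsTest ρ → ∃ la lb, Tendsto (mol ρ q) atBot (nhds la) ∧
    Tendsto (mol ρ q) atTop (nhds lb)
  weak : WeakSol K q g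

theorem lemH {s : ℝ} (hs : s ∈ Ioo (0:ℝ) 1) {K : ℝ → ℝ} (hK : IsKer s K)
    (hK1 : ∀ z, 0 < z → z ≤ 1 → z ^ (-1 - 2*s) ≤ K z) {q g : ℝ → ℝ} (hP : Pr K q g)
    (hq : Continuous q) {α β H : ℝ} (hα0 : 0 < α) (hα1 : α < 1) 
    (hαβ : α ≤ β + 2 * s) (hH : Hol β H g) : ∃ C, Hol α C q := by
  obtain ⟨A, hA⟩ := hP.bq
  obtain ⟨A', hA'⟩ := hP.bg
  have hcs := cs_pos hs
  have hA0 : 0 ≤ A := (abs_nonneg _).trans (hA 0)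
  have hH0 := hH.nonneg
  have hc : 0 < α * (1 - α) := mul_pos hα0 (by linarith)
  set M : ℝ := 4 * A + (H + 1) / (α * (1 - α) * cs s) with hM
  have hM1 : 4 * A ≤ M := by
    have : 0 ≤ (H + 1) / (α * (1 - α) * cs s) := by positivity
    linarith
  have hM2 : H < M * (α * (1 - α)) * cs s := by
    have : M * (α * (1 - α)) * cs s = 4 * A * (α * (1 - α)) * cs s + (H + 1) := by
      have hne : 1 - α ≠ 0 := by linarith
      rw [hM]; field_simp
    rw [this]
    have : 0 ≤ 4 * A * (α * (1 - α)) * cs s := by positivity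
    linarith
  have key : ∀ η ρ, IsMol η ρ → ∀ x r, 0 ≤ r → r ≤ 1 → |mol ρ q (x + r) - mol ρ q x| ≤ M * r ^ α := by
    intro η ρ hρ
    refine core2 hs hK hK1 (mol_cont hρ.toIsTest hP.mq hA) (hP.lims ρ hρ.toIsTest)
      (mol_sd_integrable hs hK hρ.toIsTest hP.mq hA) (c := α * (1 - α)) (p := α) (A := A) (H := H)
      hc.le (Real.continuous_rpow_const hα0.le).continuousOn (Real.zero_rpow hα0.ne')
      (fun r hr => Real.rpow_nonneg hr.1 _) ?_ (mol_bdd' hρ hA) ?_ ?_ hM1 hM2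
    · intro r h1 _
      have := Real.one_le_rpow h1 hα0.le
      linarith
    · intro r z h1 _ h3 h4
      exact conc_holder hα0 hα1 h1 h3 h4
    · intro x r h1 h2
      rw [hP.weak ρ hρ.toIsTest, hP.weak ρ hρ.toIsTest]
      have e := mol_hol hH hP.mg hA' hρ (x + r) x
      rw [show x + r - x = r by ring, abs_of_pos h1] at e
      refine (e h2.le).trans (mul_le_mul_of_nonneg_left ?_ hH0)
      exact Real.rpow_le_rpow_of_exponent_ge h1 h2.le (by linarith)
  refine ⟨M, ?_⟩
  have conv : ∀ x ε, 0 < ε → ∃ η0 > 0, ∀ η ρ, η ≤ η0 → IsMol η ρ → |mol ρ q x - q x| ≤ ε := by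
    intro x ε hε
    obtain ⟨δ, hδ, h⟩ := Metric.continuousAt_iff.1 (hq.continuousAt (x := x)) ε hε
    refine ⟨δ / 2, by positivity, fun η ρ hη hρ => mol_sub_self_le hρ hP.mq hA fun t ht => ?_⟩
    have := h (x := x - t) (by
      rw [Real.dist_eq, show x - t - x = -t by ring, abs_neg]; linarith)
    rw [Real.dist_eq] at this
    exact this.le
  have main : ∀ x r, 0 ≤ r → r ≤ 1 → |q (x + r) - q x| ≤ M * r ^ α := by
    intro x r h0 h1
    refine le_of_forall_pos_le_add fun ε hε => ?_
    obtain ⟨η1, h1p, hη1⟩ := conv x (ε / 2) (by positivity)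
    obtain ⟨η2, h2p, hη2⟩ := conv (x + r) (ε / 2) (by positivity)
    obtain ⟨ρ, hρ⟩ := exists_isMol (lt_min h1p h2p)
    have a1 := abs_le.1 (hη1 _ ρ (min_le_left _ _) hρ)
    have a2 := abs_le.1 (hη2 _ ρ (min_le_right _ _) hρ)
    have a3 := abs_le.1 (key _ ρ hρ x r h0 h1)
    rw [abs_le]
    constructor <;> linarith [a1.1, a1.2, a2.1, a2.2, a3.1, a3.2]
  intro x y hxy
  rcases le_total y x with h | h
  · have := main y (x - y) (by linarith) ((le_abs_self _).trans hxy)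
    rwa [add_sub_cancel, ← abs_of_nonneg (sub_nonneg.2 h)] at this
  · have := main x (y - x) (by linarith) (by rw [abs_sub_comm] at hxy; exact (le_abs_self _).trans hxy)
    rw [add_sub_cancel] at this
    rwa [abs_sub_comm, abs_sub_comm x, abs_of_nonneg (sub_nonneg.2 h)]

lemma deriv_bdd_of_lip {w w' : ℝ → ℝ} {M : ℝ} (h : ∀ x, HasDerivAt w (w' x) x)
    (hl : ∀ x r, 0 ≤ r → r ≤ 1 → |w (x + r) - w x| ≤ M * r) (x : ℝ) : |w' x| ≤ M := by
  have h1 := (h x).tendsto_slope_zero_right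
  refine le_of_tendsto h1.abs ?_
  have hev : ∀ᶠ r in nhdsWithin (0:ℝ) (Ioi 0), r < 1 := nhdsWithin_le_nhds (Iio_mem_nhds one_pos)
  filter_upwards [hev, self_mem_nhdsWithin] with r h1 (h2 : 0 < r)
  rw [smul_eq_mul, abs_mul, abs_inv, abs_of_pos h2, inv_mul_le_iff₀ h2]
  linarith [hl x r h2.le h1.le]

theorem lemD {s : ℝ} (hs : s ∈ Ioo (0:ℝ) 1) {K : ℝ → ℝ} (hK : IsKer s K)
    (hK1 : ∀ z, 0 < z → z ≤ 1 → z ^ (-1 - 2*s) ≤ K z) {q g : ℝ → ℝ} (hP : Pr K q g)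
    {β H : ℝ} (hβ0 : 0 < β) (hβ1 : 1 - 2 * s < β)
    (hHq : Hol β H q) (hH : Hol β H g) :
    ∃ q' : ℝ → ℝ, (∀ x, HasDerivAt q (q' x) x) ∧ Continuous q' ∧ ∃ B, ∀ x, |q' x| ≤ B := by
  obtain ⟨A, hA⟩ := hP.bq
  obtain ⟨A', hA'⟩ := hP.bg
  have hcs := cs_pos hs
  have hH0 := hH.nonneg
  obtain ⟨β', hb1, hb2⟩ := exists_between (max_lt hβ0 hβ1)
  have hβ'0 : 0 < β' := (le_max_left _ _).trans_lt hb1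
  have hβ'1 : 1 - 2*s < β' := (le_max_right _ _).trans_lt hb1
  set κ := β - β' with hκ
  have hκ0 : 0 < κ := by linarith
  obtain ⟨θ, hθ0, hθ1, hθ2⟩ : ∃ θ : ℝ, 0 < θ ∧ θ < 1 ∧ 1 + θ - 2*s ≤ β' :=
    ⟨min (1/2) (β' - (1 - 2*s)), lt_min (by norm_num) (by linarith),
      (min_le_left _ _).trans_lt (by norm_num), by
        have := min_le_right (1/2) (β' - (1 - 2*s)); linarith⟩
  set D : ℝ := 8 * H + (4 * H + 1) / (θ / 2 * cs s) with hD
  have hD0 : 0 < D := by positivity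
  have key : ∀ η1 η2 δ ρ1 ρ2, 0 < δ → δ ≤ 1 → 0 < η1 → 0 < η2 → η1 ≤ δ → η2 ≤ δ →
      IsMol η1 ρ1 → IsMol η2 ρ2 →
      ∀ x, |mol (deriv ρ1) q x - mol (deriv ρ2) q x| ≤ D * δ ^ κ := by
    intro η1 η2 δ ρ1 ρ2 hδ hδ1 hη1p hη2p hη1 hη2 h1 h2
    have hδκ : 0 < δ ^ κ := rpow_pos_of_pos hδ _
    have hδβ : δ ^ β ≤ δ ^ κ := Real.rpow_le_rpow_of_exponent_ge hδ hδ1 (by linarith)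
    have ap : ∀ (r g : ℝ → ℝ) (A : ℝ), Hol β H g → Measurable g → (∀ x, |g x| ≤ A) → ∀ x, 
        |mol ρ1 g x - mol ρ2 g x| ≤ 2 * H * δ ^ β := by
      intro r g A hg hm hb x
      have e1 := abs_le.1 (mol_approx hβ0 hg hm hb (hη1.trans hδ1) h1 x)
      have e2 := abs_le.1 (mol_approx hβ0 hg hm hb (hη2.trans hδ1) h2 x)
      have e3 := mul_le_mul_of_nonneg_left (Real.rpow_le_rpow hη1p.le hη1 hβ0.le) hH0
      have e4 := mul_le_mul_of_nonneg_left (Real.rpow_le_rpow hη2p.le hη2 hβ0.le) hH0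
      rw [abs_le]; constructor <;> linarith [e1.1, e1.2, e2.1, e2.2]
    have hi1 := mol_sd_integrable hs hK h1.toIsTest hP.mq hA
    have hi2 := mol_sd_integrable hs hK h2.toIsTest hP.mq hA
    have hlip : ∀ x r, 0 ≤ r → r ≤ 1 → |(fun y => mol ρ1 q y - mol ρ2 q y) (x + r) -
        (fun y => mol ρ1 q y - mol ρ2 q y) x| ≤ D * δ ^ κ * omL θ r := by
      refine core2 hs hK hK1 (w := fun y => mol ρ1 q y - mol ρ2 q y)
        ((mol_cont h1.toIsTest hP.mq hA).sub (mol_cont h2.toIsTest hP.mq hA)) ?_ ?_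
        (c := θ / 2) (p := 1 + θ) (A := 2 * H * δ ^ κ) (H := 4 * H * δ ^ κ)
        (by positivity) (omL_cont hθ0).continuousOn (omL_zero hθ0) ?_ ?_ ?_ ?_ ?_ ?_ ?_
      · obtain ⟨a1, b1, c1, d1⟩ := hP.lims ρ1 h1.toIsTest
        obtain ⟨a2, b2, c2, d2⟩ := hP.lims ρ2 h2.toIsTest
        exact ⟨_, _, c1.sub c2, d1.sub d2⟩
      · intro x
        refine ((hi1 x).sub (hi2 x)).congr (Eventually.of_forall fun z => ?_)
        simp only [Pi.sub_apply]; unfold sdf; ring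
      · intro r hr
        exact le_trans (by linarith [hr.1]) (omL_ge hθ0 hθ1 hr.1 (by linarith [hr.2]))
      · intro r h1 h2
        exact le_trans (by linarith) (omL_ge hθ0 hθ1 (by linarith) h2)
      · intro x
        exact (ap q q A hHq hP.mq hA x).trans (by gcongr)
      · intro r z h1 _ h3 h4
        exact omL_conc hθ0 hθ1 h1 h3 h4
      · intro x r hr hr1
        rw [Lop_sub (hi1 _) (hi2 _), Lop_sub (hi1 _) (hi2 _), hP.weak ρ1 h1.toIsTest,
          hP.weak ρ1 h1.toIsTest, hP.weak ρ2 h2.toIsTest, hP.weak ρ2 h2.toIsTest]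
        have e1 := mol_hol hH hP.mg hA' h1 (x + r) x
        have e2 := mol_hol hH hP.mg hA' h2 (x + r) x
        rw [show x + r - x = r by ring, abs_of_pos hr] at e1 e2
        have e1 := abs_le.1 (e1 hr1.le)
        have e2 := abs_le.1 (e2 hr1.le)
        have e3 := abs_le.1 (ap g g A' hH hP.mg hA' (x + r))
        have e4 := abs_le.1 (ap g g A' hH hP.mg hA' x)
        have hmin : |mol ρ1 g (x + r) - mol ρ2 g (x + r) - (mol ρ1 g x - mol ρ2 g x)|
            ≤ 4 * H * (min r δ) ^ β := by
          rcases min_choice r δ with h | h <;> rw [h]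
          · have : 0 ≤ H * r ^ β := by positivity
            rw [abs_le]; constructor <;> linarith [e1.1, e1.2, e2.1, e2.2]
          · rw [abs_le]; constructor <;> linarith [e3.1, e3.2, e4.1, e4.2]
        refine hmin.trans ?_
        have hm0 : 0 < min r δ := lt_min hr hδ
        have e5 : (min r δ) ^ β = (min r δ) ^ κ * (min r δ) ^ β' := by
          rw [← Real.rpow_add hm0]; congr 1; rw [hκ]; ring
        rw [e5]
        have e6 : (min r δ) ^ κ ≤ δ ^ κ := Real.rpow_le_rpow hm0.le (min_le_right _ _) hκ0.le
        have e7 : (min r δ) ^ β' ≤ r ^ β' := Real.rpow_le_rpow hm0.le (min_le_left _ _) hβ'0.le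
        have e8 : r ^ β' ≤ r ^ (1 + θ - 2*s) := Real.rpow_le_rpow_of_exponent_ge hr hr1.le hθ2
        have e9 := mul_le_mul e6 (e7.trans e8) (Real.rpow_nonneg hm0.le _) hδκ.le
        nlinarith
      · have : 0 ≤ (4 * H + 1) / (θ / 2 * cs s) := by positivity
        rw [hD]; nlinarith
      · have : D * δ ^ κ * (θ / 2) * cs s = (8 * H * (θ / 2) * cs s + (4 * H + 1)) * δ ^ κ := by
          rw [hD]; field_simp
        rw [this]
        have : 0 ≤ 8 * H * (θ / 2) * cs s := by positivity
        nlinarith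
    refine deriv_bdd_of_lip (w := fun y => mol ρ1 q y - mol ρ2 q y)
      (fun x => (mol_hasDerivAt h1.toIsTest hP.mq hA x).sub (mol_hasDerivAt h2.toIsTest hP.mq hA x)) ?_
    intro x r h0 h1
    exact (hlip x r h0 h1).trans (mul_le_mul_of_nonneg_left (omL_le h0) (by positivity))
  have hη : ∀ n : ℕ, (0:ℝ) < 1 / ((n:ℝ) + 1) := fun n => by positivity
  choose ρ hρ using fun n : ℕ => exists_isMol (hη n)
  set b : ℕ → ℝ := fun n => D * (1 / ((n:ℝ) + 1)) ^ κ with hb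
  have hb0 : Tendsto b atTop (nhds 0) := by
    have h1 : Tendsto (fun n : ℕ => (1 / ((n:ℝ) + 1)) ^ κ) atTop (nhds ((0:ℝ) ^ κ)) :=
      tendsto_one_div_add_atTop_nhds_zero_nat.rpow_const (Or.inr hκ0.le)
    rw [Real.zero_rpow hκ0.ne'] at h1
    have h2 := h1.const_mul D
    rwa [mul_zero] at h2
  have hcau : ∀ x n m N, N ≤ n → N ≤ m →
      dist (mol (deriv (ρ n)) q x) (mol (deriv (ρ m)) q x) ≤ b N := by
    intro x n m N hn hm
    rw [Real.dist_eq]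
    have mono : ∀ k : ℕ, N ≤ k → 1 / ((k:ℝ) + 1) ≤ 1 / ((N:ℝ) + 1) := fun k hk => by
      have : (N:ℝ) ≤ k := by exact_mod_cast hk
      gcongr
    refine key _ _ (1 / ((N:ℝ) + 1)) _ _ (hη N) ?_ (hη n) (hη m) (mono n hn) (mono m hm)
      (hρ n) (hρ m) x
    rw [div_le_one (by positivity)]; have : (0:ℝ) ≤ N := by positivity
    linarith
  have hex : ∀ x, ∃ l, Tendsto (fun n => mol (deriv (ρ n)) q x) atTop (nhds l) := fun x =>
    cauchySeq_tendsto_of_complete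
      (cauchySeq_of_le_tendsto_0 b (fun n m N hn hm => hcau x n m N hn hm) hb0)
  choose q' hq' using hex
  have hclose : ∀ x n, dist (mol (deriv (ρ n)) q x) (q' x) ≤ b n := by
    intro x n
    refine le_of_tendsto (tendsto_const_nhds.dist (hq' x)) ?_
    filter_upwards [eventually_ge_atTop n] with m hm
    exact hcau x n m n le_rfl hm
  have hunif : TendstoUniformly (fun n x => mol (deriv (ρ n)) q x) q' atTop := by
    rw [Metric.tendstoUniformly_iff]
    intro ε hε
    filter_upwards [hb0.eventually (Iio_mem_nhds hε)] with n hn x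
    rw [dist_comm]
    exact (hclose x n).trans_lt hn
  refine ⟨q', ?_, ?_, ?_⟩
  · intro x
    refine hasDerivAt_of_tendstoUniformly hunif (Eventually.of_forall fun n x =>
      mol_hasDerivAt (hρ n).toIsTest hP.mq hA x) (fun x => ?_) x
    have h1 : Tendsto (fun n : ℕ => H * (1 / ((n:ℝ) + 1)) ^ β) atTop (nhds (H * (0:ℝ) ^ β)) :=
      (tendsto_one_div_add_atTop_nhds_zero_nat.rpow_const (Or.inr hβ0.le)).const_mul H
    rw [Real.zero_rpow hβ0.ne', mul_zero] at h1
    rw [tendsto_iff_dist_tendsto_zero]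
    refine squeeze_zero (fun _ => dist_nonneg) (fun n => ?_) h1
    rw [Real.dist_eq]
    refine mol_approx hβ0 hHq hP.mq hA ?_ (hρ n) x
    rw [div_le_one (by positivity)]; have : (0:ℝ) ≤ n := by positivity
    linarith
  · exact hunif.continuous (Eventually.of_forall fun n =>
      mol_cont (hρ n).toIsTest.deriv hP.mq hA).frequently
  · refine ⟨A * (∫ t, |deriv (ρ 0) t|) + b 0, fun x => ?_⟩
    have e1 := abs_le.1 (mol_bdd (hρ 0).toIsTest.deriv.integrable hA x)
    have e2 := hclose x 0
    rw [Real.dist_eq] at e2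
    have e2 := abs_le.1 e2
    rw [abs_le]; constructor <;> linarith [e1.1, e1.2, e2.1, e2.2]

open Real MeasureTheory Filter Set

lemma mol_deriv_eq {ρ u u' : ℝ → ℝ} (h : IsTest ρ) (hu : ∀ x, HasDerivAt u (u' x) x)
    (hu' : Continuous u') {A B : ℝ} (hA : ∀ x, |u x| ≤ A) (hB : ∀ x, |u' x| ≤ B) :
    mol (deriv ρ) u = mol ρ u' := by
  ext x
  have hcu : Continuous u := continuous_iff_continuousAt.2 fun x => (hu x).continuousAt
  have h1 := integral_mul_deriv_eq_deriv_mul_of_integrable (u := ρ) (v := fun t => u (x - t))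
    (u' := deriv ρ) (v' := fun t => - u' (x - t))
    (fun t _ => (h.smooth.differentiable (by simp)).differentiableAt.hasDerivAt) 
    (fun t _ => (hu (x - t)).comp_const_sub x t)
    (by
      have := (mol_integrable h.integrable hu'.measurable hB x).neg
      refine this.congr (Eventually.of_forall fun t => ?_)
      simp)
    (mol_integrable h.deriv.integrable hcu.measurable hA x)
    (mol_integrable h.integrable hcu.measurable hA x)
  unfold mol
  simp only [mul_neg, integral_neg] at h1
  linarith

lemma rpow_le_rpow_exp {r β γ : ℝ} (hr : 0 ≤ r) (hr1 : r ≤ 1) (hβ : β ≤ γ) (hγ : 0 < γ) :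
    r ^ γ ≤ r ^ β := by
  rcases eq_or_lt_of_le hr with h | h
  · rw [← h, Real.zero_rpow hγ.ne']; exact Real.rpow_nonneg le_rfl _
  · exact Real.rpow_le_rpow_of_exponent_ge h hr1 hβ

lemma Hol.weaken {β H H' : ℝ} {q : ℝ → ℝ} (h : Hol β H q) (hH : H ≤ H') : Hol β H' q :=
  fun x y hxy => (h x y hxy).trans (mul_le_mul_of_nonneg_right hH (Real.rpow_nonneg (abs_nonneg _) _))

theorem reg {s : ℝ} (hs : s ∈ Ioo (0:ℝ) 1) {K : ℝ → ℝ} (hK : IsKer s K)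
    (hK1 : ∀ z, 0 < z → z ≤ 1 → z ^ (-1 - 2*s) ≤ K z) {f : ℝ → ℝ} {γ C L Λ : ℝ}
    (hγ : max 0 (1 - 2*s) < γ) (hf : ContDiff ℝ 1 f)
    (hfC : ∀ x y : ℝ, |deriv f x - deriv f y| ≤ C * |x - y| ^ γ)
    (hL : ∀ a ∈ Icc (-1:ℝ) 1, ∀ b ∈ Icc (-1:ℝ) 1, |f a - f b| ≤ L * |a - b|)
    {u : ℝ → ℝ} (hu : Monotone u) (hu1 : ∀ x, |u x| ≤ 1)
    (hΛ : ∀ x y, |u x - u y| ≤ Λ * |x - y|)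
    (hW : WeakSol K u (fun x => f (u x))) :
    ∃ u' u'' : ℝ → ℝ, (∀ x, HasDerivAt u (u' x) x) ∧ (∀ x, HasDerivAt u' (u'' x) x) ∧
      Continuous u'' ∧ (∃ B, ∀ x, |u' x| ≤ B) ∧ (∃ B, ∀ x, |u'' x| ≤ B) ∧
      ∀ x, Lop K u x = f (u x) := by
  have hγ0 : 0 < γ := (le_max_left _ _).trans_lt hγ
  have hγ1 : 1 - 2*s < γ := (le_max_right _ _).trans_lt hγ
  have hΛ0 : 0 ≤ Λ := by have := (abs_nonneg _).trans (hΛ 0 1); simpa using this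
  have hL0 : 0 ≤ L := by
    have := (abs_nonneg _).trans (hL 0 (by simp) 1 (by simp)); simpa using this
  have hC0 : 0 ≤ C := by have := (abs_nonneg _).trans (hfC 0 1); simpa using this
  have humem : ∀ x, u x ∈ Icc (-1:ℝ) 1 := fun x => abs_le.1 (hu1 x)
  have hfc : Continuous f := hf.continuous
  have hf'c : Continuous (deriv f) := hf.continuous_deriv le_rfl
  obtain ⟨F0, hF0⟩ := isCompact_Icc.exists_bound_of_continuousOn (s := Icc (-1:ℝ) 1) hfc.continuousOn
  obtain ⟨F1, hF1⟩ := isCompact_Icc.exists_bound_of_continuousOn (s := Icc (-1:ℝ) 1) hf'c.continuousOn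
  have hF0' : ∀ x, |f (u x)| ≤ F0 := fun x => hF0 _ (humem x)
  have hF1' : ∀ x, |deriv f (u x)| ≤ F1 := fun x => hF1 _ (humem x)
  have hF10 : 0 ≤ F1 := (abs_nonneg _).trans (hF1' 0)
  obtain ⟨la, lb, hla, hlb⟩ := mono_lims hu hu1
  have hP : Pr K u (fun x => f (u x)) :=
    { mq := hu.measurable
      mg := hfc.measurable.comp hu.measurable
      bq := ⟨1, hu1⟩
      bg := ⟨F0, hF0'⟩
      lims := fun ρ hρ => ⟨_, _, mol_tendsto_bot hρ hu.measurable hu1 hla,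
        mol_tendsto_top hρ hu.measurable hu1 hlb⟩
      weak := hW }
  have hgL : ∀ x y, |f (u x) - f (u y)| ≤ L * Λ * |x - y| := by
    intro x y
    refine (hL _ (humem x) _ (humem y)).trans ?_
    rw [mul_assoc]
    exact mul_le_mul_of_nonneg_left (hΛ x y) hL0
  obtain ⟨w, hw, hwc, B, hB⟩ := lemD hs hK hK1 hP (β := 1) (H := max Λ (L * Λ)) one_pos
    (by linarith [hs.1])
    (fun x y _ => by
      rw [Real.rpow_one]
      exact (hΛ x y).trans (mul_le_mul_of_nonneg_right (le_max_left _ _) (abs_nonneg _)))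
    (fun x y _ => by
      rw [Real.rpow_one]
      exact (hgL x y).trans (mul_le_mul_of_nonneg_right (le_max_right _ _) (abs_nonneg _)))
  have hB0 : 0 ≤ B := (abs_nonneg _).trans (hB 0)
  have huc : Continuous u := continuous_iff_continuousAt.2 fun x => (hw x).continuousAt
  set g' : ℝ → ℝ := fun x => deriv f (u x) * w x with hg'
  have hg'c : Continuous g' := (hf'c.comp huc).mul hwc
  have hgd : ∀ x, HasDerivAt (fun x => f (u x)) (g' x) x := fun x =>
    ((hf.differentiable (by simp)).differentiableAt.hasDerivAt (x := u x)).comp x (hw x)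
  have hg'b : ∀ x, |g' x| ≤ F1 * B := fun x => by
    rw [hg', abs_mul]; exact mul_le_mul (hF1' x) (hB x) (abs_nonneg _) hF10
  have hP2 : Pr K w g' :=
    { mq := hwc.measurable
      mg := hg'c.measurable
      bq := ⟨B, hB⟩
      bg := ⟨_, hg'b⟩
      lims := fun ρ hρ => by
        rw [← mol_deriv_eq hρ hw hwc hu1 hB]
        exact hP.lims _ hρ.deriv
      weak := fun ρ hρ x => by
        rw [← mol_deriv_eq hρ hw hwc hu1 hB, ← mol_deriv_eq hρ hgd hg'c hF0' hg'b]
        exact hW _ hρ.deriv x }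
  have hprod : ∀ β D, 0 ≤ β → β ≤ γ → Hol β D w → Hol β (F1 * D + B * (C * Λ ^ γ)) g' := by
    intro β D hβ hβγ hD x y hxy
    have e1 : g' x - g' y = deriv f (u x) * (w x - w y) + w y * (deriv f (u x) - deriv f (u y)) := by
      rw [hg']; ring
    have e2 : |deriv f (u x) - deriv f (u y)| ≤ C * Λ ^ γ * |x - y| ^ β := by
      refine (hfC _ _).trans ?_
      rw [mul_assoc]
      refine mul_le_mul_of_nonneg_left ?_ hC0
      calc |u x - u y| ^ γ ≤ (Λ * |x - y|) ^ γ := Real.rpow_le_rpow (abs_nonneg _) (hΛ x y) hγ0.le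
        _ = Λ ^ γ * |x - y| ^ γ := Real.mul_rpow hΛ0 (abs_nonneg _)
        _ ≤ _ := mul_le_mul_of_nonneg_left (rpow_le_rpow_exp (abs_nonneg _) hxy hβγ hγ0)
              (Real.rpow_nonneg hΛ0 _)
    rw [e1]
    refine (abs_add_le _ _).trans ?_
    rw [abs_mul, abs_mul, add_mul]
    have e3 := mul_le_mul (hF1' x) (hD x y hxy) (abs_nonneg _) hF10
    have e4 := mul_le_mul (hB y) e2 (abs_nonneg _) hB0
    linarith
  obtain ⟨β1, hb1, hb2⟩ := exists_between (lt_min hγ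
    (max_lt one_pos (by linarith [hs.1]) : max 0 (1 - 2*s) < 1))
  have hb10 : 0 < β1 := (le_max_left _ _).trans_lt hb1
  have hb11 : 1 - 2*s < β1 := (le_max_right _ _).trans_lt hb1
  have hb1γ : β1 < γ := hb2.trans_le (min_le_left _ _)
  have hb1o : β1 < 1 := hb2.trans_le (min_le_right _ _)
  have chain : ∀ k : ℕ, ∃ D, Hol (min ((k:ℝ) * (2*s)) β1) D w := by
    intro k
    induction k with
    | zero =>
      refine ⟨2 * B, fun x y _ => ?_⟩
      rw [Nat.cast_zero, zero_mul, min_eq_left hb10.le, Real.rpow_zero, mul_one]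
      have e1 := abs_le.1 (hB x); have e2 := abs_le.1 (hB y)
      rw [abs_le]; constructor <;> linarith [e1.1, e1.2, e2.1, e2.2]
    | succ k ih =>
      obtain ⟨D, hD⟩ := ih
      have hs0 := hs.1
      have hk : (0:ℝ) ≤ k := Nat.cast_nonneg k
      have := hprod _ D (le_min (by positivity) hb10.le) ((min_le_right _ _).trans hb1γ.le) hD
      refine lemH hs hK hK1 hP2 hwc (lt_min (by positivity) hb10)
        ((min_le_right _ _).trans_lt hb1o) ?_ this
      rw [← min_add_add_right]
      refine le_min ((min_le_left _ _).trans (le_of_eq ?_)) ((min_le_right _ _).trans (by linarith))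
      push_cast; ring
  obtain ⟨k, hk⟩ := exists_nat_gt (β1 / (2*s))
  obtain ⟨D, hD⟩ := chain k
  rw [div_lt_iff₀ (by linarith [hs.1])] at hk
  rw [min_eq_right hk.le] at hD
  obtain ⟨w', hw', hw'c, B2, hB2⟩ := lemD hs hK hK1 hP2 hb10 hb11
    (H := max D (F1 * D + B * (C * Λ ^ γ))) (hD.weaken (le_max_left _ _))
    ((hprod β1 D hb10.le hb1γ.le hD).weaken (le_max_right _ _))
  refine ⟨w, w', hw, hw', hw'c, ⟨B, hB⟩, ⟨B2, hB2⟩, fun x => ?_⟩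
  have hη : ∀ n : ℕ, (0:ℝ) < 1 / ((n:ℝ) + 1) := fun n => by positivity
  choose ρ hρ using fun n : ℕ => exists_isMol (hη n)
  have hη1 : ∀ n : ℕ, 1 / ((n:ℝ) + 1) ≤ 1 := fun n => by
    rw [div_le_one (by positivity)]; have : (0:ℝ) ≤ n := by positivity
    linarith
  have hconv : ∀ (q : ℝ → ℝ) (A H : ℝ), Hol 1 H q → Measurable q → (∀ x, |q x| ≤ A) → ∀ x, 
      Tendsto (fun n => mol (ρ n) q x) atTop (nhds (q x)) := by
    intro q A H h1 h2 h3 x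
    have hl : Tendsto (fun n : ℕ => H * (1 / ((n:ℝ) + 1))) atTop (nhds (H * (0:ℝ))) :=
      tendsto_one_div_add_atTop_nhds_zero_nat.const_mul H
    rw [mul_zero] at hl
    rw [tendsto_iff_dist_tendsto_zero]
    refine squeeze_zero (fun _ => dist_nonneg) (fun n => ?_) hl
    rw [Real.dist_eq]
    have := mol_approx one_pos h1 h2 h3 (hη1 n) (hρ n) x
    rwa [Real.rpow_one] at this
  have hcu := hconv u 1 Λ (fun x y _ => by rw [Real.rpow_one]; exact hΛ x y) hu.measurable hu1
  have hcg := hconv (fun x => f (u x)) F0 (L * Λ) (fun x y _ => by rw [Real.rpow_one]; exact hgL x y)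
    hP.mg hF0' x
  have hwL := lip_of_deriv_bdd hw' hB2
  have hB20 : 0 ≤ B2 := (abs_nonneg _).trans (hB2 0)
  have hlim : Tendsto (fun n => Lop K (mol (ρ n) u) x) atTop (nhds (Lop K u x)) := by
    unfold Lop
    refine tendsto_integral_of_dominated_convergence
      (fun z => min (2 * B2 * z ^ 2) 4 * z ^ (-1 - 2*s)) ?_ 
      (dom_int hs (by positivity) (by norm_num)) ?_ ?_
    · intro n
      exact (mol_sd_integrable hs hK (hρ n).toIsTest hu.measurable hu1 x).aestronglyMeasurable
    · intro n
      refine (ae_restrict_iff' measurableSet_Ioi).2 (Eventually.of_forall fun z hz => ?_)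
      refine ker_dom hK hz ?_ ?_
      · refine sd_bound (w' := mol (ρ n) w) (fun x => ?_) (fun x y => ?_) x (le_of_lt hz)
        · rw [← mol_deriv_eq (hρ n).toIsTest hw hwc hu1 hB]
          exact mol_hasDerivAt (hρ n).toIsTest hu.measurable hu1 x
        · refine mol_sub_le (hρ n) hwc.measurable hB fun t _ => ?_
          have := hwL (x - t) (y - t)
          rwa [sub_sub_sub_cancel_right] at this
      · have := sdf_le (mol_bdd' (hρ n) hu1) x z
        simpa using this
    · refine Eventually.of_forall fun z => ?_
      unfold sdf
      exact ((((hcu x).const_mul 2).sub (hcu (x + z))).sub (hcu (x - z))).mul_const _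
  refine tendsto_nhds_unique hlim ?_
  refine hcg.congr fun n => ?_
  exact (hW (ρ n) (hρ n).toIsTest x).symm

open Real MeasureTheory Filter Set

theorem helly {u : ℕ → ℝ → ℝ} (hm : ∀ n, Monotone (u n)) (hb : ∀ n x, |u n x| ≤ 1) :
    ∃ φ : ℕ → ℕ, StrictMono φ ∧ ∃ v : ℝ → ℝ, Monotone v ∧ (∀ x, |v x| ≤ 1) ∧
      ∀ x, ContinuousAt v x → Tendsto (fun n => u (φ n) x) atTop (nhds (v x)) := by
  let U : ℕ → (ℚ → Icc (-1:ℝ) 1) := fun n q => ⟨u n q, abs_le.1 (hb n q)⟩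
  obtain ⟨a, φ, hφ, ha⟩ := CompactSpace.tendsto_subseq U
  have ha' : ∀ q : ℚ, Tendsto (fun n => u (φ n) q) atTop (nhds (a q : ℝ)) := by
    intro q
    have h1 := (tendsto_pi_nhds.1 ha) q
    exact (continuous_subtype_val.tendsto _).comp h1
  have amono : ∀ p q : ℚ, p ≤ q → (a p : ℝ) ≤ a q := fun p q h =>
    le_of_tendsto_of_tendsto' (ha' p) (ha' q) fun n => hm _ (by exact_mod_cast h)
  let S : ℝ → Set ℝ := fun x => Set.image (fun q : ℚ => (a q : ℝ)) {q : ℚ | (q:ℝ) < x}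
  have hne : ∀ x, (S x).Nonempty := fun x => by
    obtain ⟨q, hq⟩ := exists_rat_lt x
    exact ⟨_, q, hq, rfl⟩
  have hbdd : ∀ x, BddAbove (S x) := fun x => ⟨1, by rintro _ ⟨q, _, rfl⟩; exact (a q).2.2⟩
  let v : ℝ → ℝ := fun x => sSup (S x)
  have vlow : ∀ (x : ℝ) (q : ℚ), (q:ℝ) < x → (a q : ℝ) ≤ v x := fun x q h =>
    le_csSup (hbdd x) ⟨q, h, rfl⟩
  have vup : ∀ (x : ℝ) (q : ℚ), x ≤ (q:ℝ) → v x ≤ (a q : ℝ) := fun x q h => by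
    refine csSup_le (hne x) ?_
    rintro _ ⟨p, hp, rfl⟩
    exact amono p q (by exact_mod_cast (lt_of_lt_of_le hp h).le)
  refine ⟨φ, hφ, v, ?_, ?_, ?_⟩
  · intro x y hxy
    refine csSup_le_csSup (hbdd y) (hne x) (image_mono fun q hq => lt_of_lt_of_le hq hxy)
  · intro x
    rw [abs_le]
    constructor
    · obtain ⟨q, hq⟩ := exists_rat_lt x
      exact (a q).2.1.trans (vlow x q hq)
    · obtain ⟨q, hq⟩ := exists_rat_gt x
      exact (vup x q hq.le).trans (a q).2.2
  · intro x hx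
    rw [tendsto_order]
    constructor
    · intro c hc
      have h1 : ∀ᶠ y in nhdsWithin x (Iio x), c < v y := (hx.eventually (Ioi_mem_nhds hc)).filter_mono nhdsWithin_le_nhds
      obtain ⟨y, hy, hyx⟩ := (h1.and self_mem_nhdsWithin).exists
      obtain ⟨q, hq1, hq2⟩ := exists_rat_btwn (show y < x from hyx)
      have h2 : c < (a q : ℝ) := hy.trans_le (vup y q hq1.le)
      filter_upwards [(ha' q).eventually (Ioi_mem_nhds h2)] with n hn
      exact lt_of_lt_of_le hn (hm _ hq2.le)
    · intro c hc
      have h1 : ∀ᶠ y in nhdsWithin x (Ioi x), v y < c := (hx.eventually (Iio_mem_nhds hc)).filter_mono nhdsWithin_le_nhds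
      obtain ⟨y, hy, hyx⟩ := (h1.and self_mem_nhdsWithin).exists
      obtain ⟨q, hq1, hq2⟩ := exists_rat_btwn (show x < y from hyx)
      have h2 : (a q : ℝ) < c := (vlow y q hq2).trans_lt hy
      filter_upwards [(ha' q).eventually (Iio_mem_nhds h2)] with n hn
      exact lt_of_le_of_lt (hm _ hq1.le) hn

lemma ae_cont {v : ℝ → ℝ} (hv : Monotone v) : ∀ᵐ x, ContinuousAt v x := by
  have := hv.countable_not_continuousAt.ae_notMem volume
  filter_upwards [this] with x hx
  by_contra h
  exact hx h

lemma ae_shift {P : ℝ → Prop} (h : ∀ᵐ x, P x) (x : ℝ) : ∀ᵐ t, P (x - t) := by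
  have := (Measure.measurePreserving_sub_left (volume : Measure ℝ) x).quasiMeasurePreserving
  exact this.ae h

lemma mol_lim {u : ℕ → ℝ → ℝ} {v : ℝ → ℝ} {A : ℝ} (hm : ∀ n, Measurable (u n))
    (hA : ∀ n x, |u n x| ≤ A) (h : ∀ᵐ x, Tendsto (fun n => u n x) atTop (nhds (v x)))
    {ρ : ℝ → ℝ} (hρ : IsTest ρ) (x : ℝ) :
    Tendsto (fun n => mol ρ (u n) x) atTop (nhds (mol ρ v x)) := by
  unfold mol
  refine tendsto_integral_of_dominated_convergence (fun t => |ρ t| * A) ?_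
    (hρ.integrable.abs.mul_const A) ?_ ?_
  · exact fun n => (mol_integrable hρ.integrable (hm n) (hA n) x).aestronglyMeasurable
  · intro n; refine Eventually.of_forall fun t => ?_
    rw [Real.norm_eq_abs, abs_mul]
    exact mul_le_mul_of_nonneg_left (hA _ _) (abs_nonneg _)
  · filter_upwards [ae_shift h x] with t ht
    exact ht.const_mul _

theorem weak_lim {s : ℝ} (hs : s ∈ Ioo (0:ℝ) 1) {Kn : ℕ → ℝ → ℝ} {K : ℝ → ℝ}
    (hKn : ∀ n, IsKer s (Kn n))
    (hlimK : ∀ z, 0 < z → Tendsto (fun n => Kn n z) atTop (nhds (K z)))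
    {f : ℝ → ℝ} (hf : Continuous f)
    {u : ℕ → ℝ → ℝ} {v : ℝ → ℝ} (hm : ∀ n, Measurable (u n))
    (hA : ∀ n x, |u n x| ≤ 1) (h : ∀ᵐ x, Tendsto (fun n => u n x) atTop (nhds (v x)))
    (hW : ∀ n, WeakSol (Kn n) (u n) (fun x => f (u n x))) :
    WeakSol K v (fun x => f (v x)) := by
  intro ρ hρ x
  obtain ⟨F0, hF0⟩ := isCompact_Icc.exists_bound_of_continuousOn (s := Icc (-1:ℝ) 1) hf.continuousOn
  have h1 := mol_lim hm hA h hρ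
  have h2 : Tendsto (fun n => mol ρ (fun x => f (u n x)) x) atTop (nhds (mol ρ (fun x => f (v x)) x)) := by
    refine mol_lim (A := F0) (u := fun n x => f (u n x)) (fun n => hf.measurable.comp (hm n))
      (fun n x => hF0 _ (abs_le.1 (hA n x))) ?_ hρ x
    filter_upwards [h] with x hx
    exact (hf.tendsto _).comp hx
  refine tendsto_nhds_unique ?_ (h2.congr fun n => (hW n ρ hρ x).symm)
  unfold Lop
  have hI : (0:ℝ) ≤ ∫ t, |ρ t| := integral_nonneg fun t => abs_nonneg _
  have hI2 : (0:ℝ) ≤ ∫ t, |deriv (deriv ρ) t| := integral_nonneg fun t => abs_nonneg _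
  refine tendsto_integral_of_dominated_convergence
    (fun z => min (2 * (1 * ∫ t, |deriv (deriv ρ) t|) * z ^ 2) (4 * (1 * ∫ t, |ρ t|)) * z ^ (-1 - 2*s))
    ?_ (dom_int hs (by positivity) (by positivity)) ?_ ?_
  · exact fun n => (mol_sd_integrable hs (hKn n) hρ (hm n) (hA n) x).aestronglyMeasurable
  · intro n
    refine (ae_restrict_iff' measurableSet_Ioi).2 (Eventually.of_forall fun z hz => ?_)
    exact ker_dom (hKn n) hz (mol_sd_bound hρ (hm n) (hA n) x (le_of_lt hz))
      (sdf_le (mol_bdd hρ.integrable (hA n)) x z)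
  · refine (ae_restrict_iff' measurableSet_Ioi).2 (Eventually.of_forall fun z hz => ?_)
    unfold sdf
    exact ((((h1 x).const_mul 2).sub (h1 (x + z))).sub (h1 (x - z))).mul (hlimK z hz)

open Real MeasureTheory Filter Set

/-- base product measure -/
noncomputable def mu0 : Measure (ℝ × ℝ) := (volume.restrict (Ioi (0:ℝ))).prod volume

instance : SFinite mu0 := by unfold mu0; infer_instance

/-- kinetic density -/
noncomputable def Kin (K u : ℝ → ℝ) (p : ℝ × ℝ) : ℝ := K p.1 / 2 * (u (p.2 + p.1) - u p.2) ^ 2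

/-- total energy -/
noncomputable def En (K G u : ℝ → ℝ) : ENNReal :=
  (∫⁻ p, ENNReal.ofReal (Kin K u p) ∂mu0) + ∫⁻ x, ENNReal.ofReal (G (u x))

lemma Kin_meas {K u : ℝ → ℝ} (hK : Measurable K) (hu : Measurable u) : Measurable (Kin K u) := by
  unfold Kin
  have h1 : Measurable fun p : ℝ × ℝ => K p.1 := hK.comp measurable_fst
  have h2 : Measurable fun p : ℝ × ℝ => u (p.2 + p.1) := hu.comp (measurable_snd.add measurable_fst)
  have h3 : Measurable fun p : ℝ × ℝ => u p.2 := hu.comp measurable_snd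
  exact (h1.div_const 2).mul ((h2.sub h3).pow_const 2)

lemma En_translate {K G u : ℝ → ℝ} (hK : Measurable K) (hu : Measurable u) 
    (a : ℝ) : En K G (fun x => u (x + a)) = En K G u := by
  have hua : Measurable fun x => u (x + a) := hu.comp (measurable_id.add_const a)
  unfold En
  congr 1
  · unfold mu0
    rw [lintegral_prod _ (Kin_meas hK hua).ennreal_ofReal.aemeasurable,
      lintegral_prod _ (Kin_meas hK hu).ennreal_ofReal.aemeasurable]
    refine lintegral_congr fun z => ?_
    rw [← lintegral_add_right_eq_self (fun x => ENNReal.ofReal (Kin K u (z, x))) a]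
    refine lintegral_congr fun x => ?_
    unfold Kin
    simp only
    rw [show x + z + a = x + a + z by ring]
  · rw [← lintegral_add_right_eq_self (fun x => ENNReal.ofReal (G (u x))) a]

/-- normalized competitors -/
structure Adm (u : ℝ → ℝ) : Prop where
  mono : Monotone u
  bd : ∀ x, |u x| ≤ 1
  neg : ∀ x, x < 0 → u x ≤ 0
  pos : ∀ x, 0 < x → 0 ≤ u x

/-- the piecewise linear profile -/
noncomputable def cl (x : ℝ) : ℝ := max (-1) (min 1 x)

lemma cl_adm : Adm cl where
  mono := fun x y h => max_le_max le_rfl (min_le_min le_rfl h)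
  bd := fun x => abs_le.2 ⟨le_max_left _ _, max_le (by norm_num) (min_le_left _ _)⟩
  neg := fun x hx => max_le (by norm_num) ((min_le_right _ _).trans hx.le)
  pos := fun x hx => le_max_of_le_right (le_min (by norm_num) hx.le)

/-- The potential -/
structure Pot (G f : ℝ → ℝ) (L : ℝ) : Prop where
  fc : Continuous f
  dG : ∀ r, HasDerivAt G (- f r) r
  Lip : ∀ a ∈ Icc (-1:ℝ) 1, ∀ b ∈ Icc (-1:ℝ) 1, |f a - f b| ≤ L * |a - b|
  fm : f (-1) = 0
  fp : f 1 = 0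
  Gm : G (-1) = 0
  Gp : G 1 = 0
  Gpos : ∀ r ∈ Ioo (-1:ℝ) 1, 0 < G r

namespace Pot
variable {G f : ℝ → ℝ} {L : ℝ}

lemma cont (h : Pot G f L) : Continuous G :=
  continuous_iff_continuousAt.2 fun x => (h.dG x).continuousAt

lemma nonneg (h : Pot G f L) {r : ℝ} (hr : |r| ≤ 1) : 0 ≤ G r := by
  obtain ⟨h1, h2⟩ := abs_le.1 hr
  rcases eq_or_lt_of_le h1 with h1 | h1
  · rw [← h1, h.Gm]
  rcases eq_or_lt_of_le h2 with h2 | h2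
  · rw [h2, h.Gp]
  exact (h.Gpos r ⟨h1, h2⟩).le

lemma Lnn (h : Pot G f L) : 0 ≤ L := by
  have := (abs_nonneg _).trans (h.Lip 0 (by simp) 1 (by simp)); simpa using this

end Pot

/-- finite potential energy forces the limits -/
lemma lims_of_finite {G f u : ℝ → ℝ} {L : ℝ} (hG : Pot G f L) (hu : Monotone u)
    (hb : ∀ x, |u x| ≤ 1) (hn : ∀ x, x < 0 → u x ≤ 0) (hp : ∀ x, 0 < x → 0 ≤ u x)
    (hfin : ∫⁻ x, ENNReal.ofReal (G (u x)) < ⊤) :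
    Tendsto u atBot (nhds (-1)) ∧ Tendsto u atTop (nhds 1) := by
  obtain ⟨la, lb, hla, hlb⟩ := mono_lims hu hb
  have key : ∀ (S : Set ℝ) (c : ℝ), volume S = ⊤ → MeasurableSet S → 0 < c → (∀ x ∈ S, c ≤ G (u x)) → False := by
    intro S c hS hSm hc h
    have : (⊤ : ENNReal) ≤ ∫⁻ x, ENNReal.ofReal (G (u x)) := by
      calc (⊤ : ENNReal) = ∫⁻ x in S, ENNReal.ofReal c := by
            rw [lintegral_const, Measure.restrict_apply_univ, hS, ENNReal.mul_top]
            simpa using hc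
        _ ≤ ∫⁻ x in S, ENNReal.ofReal (G (u x)) := by
            refine setLIntegral_mono' hSm fun x hx => ENNReal.ofReal_le_ofReal (h x hx)
        _ ≤ _ := setLIntegral_le_lintegral _ _
    exact absurd hfin (not_lt.2 this)
  constructor
  · have e1 : -1 ≤ la := ge_of_tendsto' hla fun x => (abs_le.1 (hb x)).1
    have e2 : la ≤ 0 := le_of_tendsto hla (by
      filter_upwards [eventually_lt_atBot 0] with x hx using hn x hx)
    rcases eq_or_lt_of_le e1 with e | e
    · rwa [e]
    exfalso
    have hg := hG.Gpos la ⟨e, by linarith⟩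
    have h1 : ∀ᶠ x in atBot, G la / 2 < G (u x) :=
      ((hG.cont.tendsto la).comp hla).eventually (Ioi_mem_nhds (by linarith))
    obtain ⟨N, hN⟩ := eventually_atBot.1 h1
    exact key (Iic N) (G la / 2) Real.volume_Iic measurableSet_Iic (by linarith) fun x hx => (hN x hx).le
  · have e1 : lb ≤ 1 := le_of_tendsto' hlb fun x => (abs_le.1 (hb x)).2
    have e2 : 0 ≤ lb := ge_of_tendsto hlb (by
      filter_upwards [eventually_gt_atTop 0] with x hx using hp x hx)
    rcases eq_or_lt_of_le e1 with e | e
    · rwa [← e]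
    exfalso
    have hg := hG.Gpos lb ⟨by linarith, e⟩
    have h1 : ∀ᶠ x in atTop, G lb / 2 < G (u x) :=
      ((hG.cont.tendsto lb).comp hlb).eventually (Ioi_mem_nhds (by linarith))
    obtain ⟨N, hN⟩ := eventually_atTop.1 h1
    exact key (Ici N) (G lb / 2) Real.volume_Ici measurableSet_Ici (by linarith) fun x hx => (hN x hx).le

lemma adm_limit {u : ℕ → ℝ → ℝ} {v : ℝ → ℝ} (hu : ∀ n, Adm (u n)) (hv : Monotone v)
    (hb : ∀ x, |v x| ≤ 1)
    (hc : ∀ x, ContinuousAt v x → Tendsto (fun n => u n x) atTop (nhds (v x))) : Adm v := by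
  have hcount := hv.countable_not_continuousAt
  have pick : ∀ a b : ℝ, a < b → ∃ y, a < y ∧ y < b ∧ ContinuousAt v y := by
    intro a b hab
    have h2 : ¬ (Ioo a b).Countable := fun h => by
      have := h.measure_zero volume
      rw [Real.volume_Ioo] at this
      simp at this; linarith
    by_contra hcon
    push Not at hcon
    exact h2 (hcount.mono fun y hy => hcon y hy.1 hy.2)
  refine ⟨hv, hb, fun x hx => ?_, fun x hx => ?_⟩
  · obtain ⟨y, h1, h2, h3⟩ := pick x 0 hx
    exact (hv h1.le).trans (le_of_tendsto' (hc y h3) fun n => (hu n).neg y h2)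
  · obtain ⟨y, h1, h2, h3⟩ := pick 0 x hx
    exact (ge_of_tendsto' (hc y h3) fun n => (hu n).pos y h1).trans (hv h2.le)

lemma ae_mu0 {P : ℝ → Prop} (hP : ∀ᵐ x, P x) : ∀ᵐ p ∂mu0, P (p.2 + p.1) ∧ P p.2 := by
  have h2 : ∀ᵐ p ∂mu0, P p.2 := Measure.quasiMeasurePreserving_snd.ae hP
  have h1 : ∀ᵐ p ∂mu0, P (p.2 + p.1) := by
    have hq : Measure.QuasiMeasurePreserving (fun p : ℝ × ℝ => p.2 + p.1) mu0 volume := by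
      unfold mu0
      refine QuasiMeasurePreserving.prod_of_right (measurable_snd.add measurable_fst) 
        (Eventually.of_forall fun z => ?_)
      exact (measurePreserving_add_right volume z).quasiMeasurePreserving
    exact hq.ae hP
  exact h1.and h2

lemma ennreal_liminf_add (a b : ℕ → ENNReal) :
    liminf a atTop + liminf b atTop ≤ liminf (fun n => a n + b n) atTop := by
  simp only [liminf_eq_iSup_iInf_of_nat]
  rw [ENNReal.iSup_add_iSup_of_monotone]
  · refine iSup_mono fun n => le_iInf₂ fun i hi => add_le_add (iInf₂_le i hi) (iInf₂_le i hi)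
  · intro n m h
    exact le_iInf₂ fun i hi => iInf₂_le i (h.trans hi)
  · intro n m h
    exact le_iInf₂ fun i hi => iInf₂_le i (h.trans hi)

lemma En_fatou {K G f : ℝ → ℝ} {L : ℝ} {u : ℕ → ℝ → ℝ} {v : ℝ → ℝ} (hK : Measurable K)
    (hG : Pot G f L) (hu : ∀ n, Measurable (u n))
    (hc : ∀ᵐ x, Tendsto (fun n => u n x) atTop (nhds (v x))) :
    En K G v ≤ liminf (fun n => En K G (u n)) atTop := by
  unfold En
  refine le_trans (add_le_add (a := _) (b := liminf (fun n => ∫⁻ p, ENNReal.ofReal (Kin K (u n) p) ∂mu0) atTop)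
    (c := _) (d := liminf (fun n => ∫⁻ x, ENNReal.ofReal (G (u n x))) atTop) ?_ ?_) ?_
  · refine le_trans ?_ (lintegral_liminf_le fun n => (Kin_meas hK (hu n)).ennreal_ofReal)
    refine lintegral_mono_ae ?_
    filter_upwards [ae_mu0 hc] with p hp
    refine le_of_eq (Tendsto.liminf_eq ?_).symm
    refine (ENNReal.continuous_ofReal.tendsto _).comp ?_
    unfold Kin
    exact ((hp.1.sub hp.2).pow 2).const_mul _
  · refine le_trans ?_ (lintegral_liminf_le fun n =>
      ((hG.cont.measurable.comp (hu n)).ennreal_ofReal : Measurable fun x => ENNReal.ofReal (G (u n x))))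
    refine lintegral_mono_ae ?_
    filter_upwards [hc] with x hx
    refine le_of_eq (Tendsto.liminf_eq ?_).symm
    exact (ENNReal.continuous_ofReal.tendsto _).comp ((hG.cont.tendsto _).comp hx)
  · exact ennreal_liminf_add _ _

theorem exists_min {K G f : ℝ → ℝ} {L : ℝ} (hK : Measurable K) (hG : Pot G f L)
    (hfin : En K G cl < ⊤) : ∃ u, Adm u ∧ En K G u ≤ En K G cl ∧
      Tendsto u atBot (nhds (-1)) ∧ Tendsto u atTop (nhds 1) ∧
      ∀ w, Monotone w → (∀ x, |w x| ≤ 1) → Tendsto w atBot (nhds (-1)) → Tendsto w atTop (nhds 1) →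
        En K G u ≤ En K G w := by
  let S : Set ENNReal := Set.image (En K G) {u | Adm u}
  have hSne : S.Nonempty := ⟨_, cl, cl_adm, rfl⟩
  obtain ⟨e, -, he, heS⟩ := exists_seq_tendsto_sInf hSne (OrderBot.bddBelow S)
  choose u hu hue using heS
  obtain ⟨φ, hφ, v, hv, hvb, hvc⟩ := helly (fun n => (hu n).mono) (fun n => (hu n).bd)
  have hva : Adm v := adm_limit (fun n => hu (φ n)) hv hvb hvc
  have hle : En K G v ≤ sInf S := by
    refine (En_fatou hK hG (u := fun n => u (φ n)) (fun n => (hu _).mono.measurable) ?_).trans ?_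
    · filter_upwards [ae_cont hv] with x hx using hvc x hx
    · refine le_of_eq (Tendsto.liminf_eq ?_)
      simp only [hue]
      exact he.comp hφ.tendsto_atTop
  have hle2 : En K G v ≤ En K G cl := hle.trans (sInf_le ⟨cl, cl_adm, rfl⟩)
  have hGfin : ∫⁻ x, ENNReal.ofReal (G (v x)) < ⊤ :=
    lt_of_le_of_lt (le_add_left le_rfl) (hle2.trans_lt hfin)
  obtain ⟨l1, l2⟩ := lims_of_finite hG hv hvb hva.neg hva.pos hGfin
  refine ⟨v, hva, hle2, l1, l2, ?_⟩
  intro w hw hwb hw1 hw2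
  obtain ⟨p, hp⟩ := (hw1.eventually (Iio_mem_nhds (show (-1:ℝ) < 0 by norm_num))).exists
  obtain ⟨q, hq⟩ := (hw2.eventually (Ioi_mem_nhds (show (0:ℝ) < 1 by norm_num))).exists
  have hne : {x | w x < 0}.Nonempty := ⟨p, hp⟩
  have hbd : BddAbove {x | w x < 0} := ⟨q, fun x hx => by
    by_contra h
    have := hw (not_le.1 h).le
    exact absurd (lt_of_lt_of_le hq this) (not_lt.2 (le_of_lt hx))⟩
  set a := sSup {x | w x < 0} with ha
  have hadm : Adm fun x => w (x + a) := by
    refine ⟨fun x y h => hw (by linarith), fun x => hwb _, fun x hx => ?_, fun x hx => ?_⟩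
    · obtain ⟨y, hy, hxy⟩ := exists_lt_of_lt_csSup hne (show x + a < sSup {x | w x < 0} by linarith)
      exact (hw hxy.le).trans (le_of_lt hy)
    · by_contra h
      have := le_csSup hbd (show x + a ∈ {x | w x < 0} from not_le.1 h)
      linarith
  rw [← En_translate hK hw.measurable a]
  exact hle.trans (sInf_le ⟨_, hadm, rfl⟩)

open Real MeasureTheory Filter Set

/-- shear -/
def shr (p : ℝ × ℝ) : ℝ × ℝ := (p.1, p.2 + p.1)

lemma shr_eq : shr = fun p => (MeasurableEquiv.shearAddRight ℝ) p := by
  ext p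
  · rfl
  · simp [shr, MeasurableEquiv.shearAddRight, add_comm]

lemma shr_emb : MeasurableEmbedding shr := by
  rw [shr_eq]; exact (MeasurableEquiv.shearAddRight ℝ).measurableEmbedding

lemma shr_mp : MeasurePreserving shr mu0 mu0 := by
  unfold mu0
  have := (MeasurePreserving.id (volume.restrict (Ioi (0:ℝ)))).skew_product
    (g := fun z x => x + z) (μc := (volume : Measure ℝ)) (μd := volume)
    (measurable_snd.add measurable_fst)
    (Eventually.of_forall fun z => (measurePreserving_add_right volume z).map_eq)
  exact this

lemma int_prod {K : ℝ → ℝ} (hKi : IntegrableOn K (Ioi 0)) {ψ : ℝ → ℝ} (hψ : Integrable ψ) {b : ℝ × ℝ → ℝ} (hb : Measurable b) {A : ℝ}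
    (hA : ∀ p, |b p| ≤ A) : Integrable (fun p : ℝ × ℝ => K p.1 * ψ p.2 * b p) mu0 := by
  have h1 : Integrable (fun p : ℝ × ℝ => K p.1 * ψ p.2) mu0 := Integrable.mul_prod hKi hψ
  exact h1.mul_bdd (c := A) hb.aestronglyMeasurable (Eventually.of_forall hA)

lemma int_prod' {K : ℝ → ℝ} (hKi : IntegrableOn K (Ioi 0)) {ψ : ℝ → ℝ} (hψ : Integrable ψ) {b : ℝ × ℝ → ℝ} (hb : Measurable b) {A : ℝ}
    (hA : ∀ p, |b p| ≤ A) : Integrable (fun p : ℝ × ℝ => K p.1 * ψ (p.2 + p.1) * b p) mu0 := by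
  have h1 : Integrable (fun p : ℝ × ℝ => K p.1 * ψ p.2) mu0 := Integrable.mul_prod hKi hψ
  have h2 := (shr_mp.integrable_comp_emb shr_emb).2 h1
  exact h2.mul_bdd (c := A) hb.aestronglyMeasurable (Eventually.of_forall hA)

theorem kin_expand {K : ℝ → ℝ} (hKi : IntegrableOn K (Ioi 0)) (hK0 : ∀ z, 0 ≤ K z) {u ψ : ℝ → ℝ} (hu : Measurable u) (hu1 : ∀ x, |u x| ≤ 1)
    (hψm : Measurable ψ) (hψ : Integrable ψ) {A : ℝ} (hψ2 : ∀ x, |ψ x| ≤ A)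
    (hT : Integrable (Kin K u) mu0) :
    Integrable (Kin K (fun x => u x + ψ x)) mu0 ∧
    ∫ p, Kin K (fun x => u x + ψ x) p ∂mu0 ≤ (∫ p, Kin K u p ∂mu0) + (∫ x, ψ x * Lop K u x) +
      2 * (∫ z in Ioi 0, K z) * ∫ x, ψ x ^ 2 := by
  have mu1 : Measurable fun p : ℝ × ℝ => u (p.2 + p.1) := hu.comp (measurable_snd.add measurable_fst)
  have mu2 : Measurable fun p : ℝ × ℝ => u p.2 := hu.comp measurable_snd
  have mu3 : Measurable fun p : ℝ × ℝ => u (p.2 - p.1) := hu.comp (measurable_snd.sub measurable_fst)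
  have mp1 : Measurable fun p : ℝ × ℝ => ψ (p.2 + p.1) := hψm.comp (measurable_snd.add measurable_fst)
  have mp2 : Measurable fun p : ℝ × ℝ => ψ p.2 := hψm.comp measurable_snd
  have bu : ∀ a b, |u a - u b| ≤ 2 := fun a b => by
    have := abs_le.1 (hu1 a); have h2 := abs_le.1 (hu1 b)
    rw [abs_le]; constructor <;> linarith [this.1, this.2, h2.1, h2.2]
  have bp : ∀ a b, |(ψ a - ψ b) / 2| ≤ A := fun a b => by
    have := abs_le.1 (hψ2 a); have h2 := abs_le.1 (hψ2 b)
    rw [abs_le]; constructor <;> linarith [this.1, this.2, h2.1, h2.2]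
  have iA := int_prod' hKi hψ (b := fun p => u (p.2 + p.1) - u p.2) (mu1.sub mu2) (fun p => bu _ _)
  have iB := int_prod hKi hψ (b := fun p => u (p.2 + p.1) - u p.2) (mu1.sub mu2) (fun p => bu _ _)
  have iA' := int_prod hKi hψ (b := fun p => u p.2 - u (p.2 - p.1)) (mu2.sub mu3) (fun p => bu _ _)
  have iC1 := int_prod' hKi hψ (b := fun p => (ψ (p.2 + p.1) - ψ p.2) / 2) ((mp1.sub mp2).div_const 2)
    (fun p => bp _ _)
  have iC2 := int_prod hKi hψ (b := fun p => (ψ (p.2 + p.1) - ψ p.2) / 2) ((mp1.sub mp2).div_const 2)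
    (fun p => bp _ _)
  have iD1 := int_prod' hKi hψ (b := fun p => ψ (p.2 + p.1)) mp1 (fun p => hψ2 _)
  have iD2 := int_prod hKi hψ (b := fun p => ψ p.2) mp2 (fun p => hψ2 _)
  have eqK : Kin K (fun x => u x + ψ x) = fun p => Kin K u p +
      ((K p.1 * ψ (p.2 + p.1) * (u (p.2 + p.1) - u p.2) - K p.1 * ψ p.2 * (u (p.2 + p.1) - u p.2)) +
      (K p.1 * ψ (p.2 + p.1) * ((ψ (p.2 + p.1) - ψ p.2) / 2) -
        K p.1 * ψ p.2 * ((ψ (p.2 + p.1) - ψ p.2) / 2))) := by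
    ext p; unfold Kin; ring
  have eA : ∫ p, K p.1 * ψ (p.2 + p.1) * (u (p.2 + p.1) - u p.2) ∂mu0 =
      ∫ p, K p.1 * ψ p.2 * (u p.2 - u (p.2 - p.1)) ∂mu0 := by
    rw [← shr_mp.integral_comp shr_emb (fun p => K p.1 * ψ p.2 * (u p.2 - u (p.2 - p.1)))]
    refine integral_congr_ae (Eventually.of_forall fun p => ?_)
    simp [shr]
  have eD : ∫ p, K p.1 * ψ (p.2 + p.1) * ψ (p.2 + p.1) ∂mu0 =
      ∫ p, K p.1 * ψ p.2 * ψ p.2 ∂mu0 := by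
    rw [← shr_mp.integral_comp shr_emb (fun p => K p.1 * ψ p.2 * ψ p.2)]
    refine integral_congr_ae (Eventually.of_forall fun p => ?_)
    simp [shr]
  have eD2 : ∫ p, K p.1 * ψ p.2 * ψ p.2 ∂mu0 = (∫ z in Ioi 0, K z) * ∫ x, ψ x ^ 2 := by
    unfold mu0
    rw [← integral_prod_mul]
    refine integral_congr_ae (Eventually.of_forall fun p => ?_)
    simp only; ring
  have eL : ∫ p, K p.1 * ψ p.2 * (u p.2 - u (p.2 - p.1)) ∂mu0 -
      ∫ p, K p.1 * ψ p.2 * (u (p.2 + p.1) - u p.2) ∂mu0 = ∫ x, ψ x * Lop K u x := by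
    have h3 : Integrable (fun p : ℝ × ℝ => K p.1 * ψ p.2 * (u p.2 - u (p.2 - p.1)) -
      K p.1 * ψ p.2 * (u (p.2 + p.1) - u p.2)) mu0 := iA'.sub iB
    rw [← integral_sub iA' iB]
    unfold mu0 at h3 ⊢
    rw [integral_prod_symm _ h3]
    refine integral_congr_ae (Eventually.of_forall fun x => ?_)
    simp only
    unfold Lop
    rw [← integral_const_mul]
    refine integral_congr_ae (Eventually.of_forall fun z => ?_)
    simp only; unfold sdf; ring
  have i1 : Integrable (fun p : ℝ × ℝ => K p.1 * ψ (p.2 + p.1) * (u (p.2 + p.1) - u p.2) -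
      K p.1 * ψ p.2 * (u (p.2 + p.1) - u p.2)) mu0 := iA.sub iB
  have i2 : Integrable (fun p : ℝ × ℝ => K p.1 * ψ (p.2 + p.1) * ((ψ (p.2 + p.1) - ψ p.2) / 2) -
        K p.1 * ψ p.2 * ((ψ (p.2 + p.1) - ψ p.2) / 2)) mu0 := iC1.sub iC2
  have i3 : Integrable (fun p : ℝ × ℝ => 
      (K p.1 * ψ (p.2 + p.1) * (u (p.2 + p.1) - u p.2) - K p.1 * ψ p.2 * (u (p.2 + p.1) - u p.2)) +
      (K p.1 * ψ (p.2 + p.1) * ((ψ (p.2 + p.1) - ψ p.2) / 2) -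
        K p.1 * ψ p.2 * ((ψ (p.2 + p.1) - ψ p.2) / 2))) mu0 := i1.add i2
  refine ⟨?_, ?_⟩
  · rw [eqK]
    exact hT.add i3
  · rw [eqK, integral_add hT i3,
      integral_add i1 i2, integral_sub iA iB, eA, eL]
    have : ∫ p, (K p.1 * ψ (p.2 + p.1) * ((ψ (p.2 + p.1) - ψ p.2) / 2) -
        K p.1 * ψ p.2 * ((ψ (p.2 + p.1) - ψ p.2) / 2)) ∂mu0 ≤
        ∫ p, (K p.1 * ψ (p.2 + p.1) * ψ (p.2 + p.1) + K p.1 * ψ p.2 * ψ p.2) ∂mu0 := by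
      refine integral_mono (iC1.sub iC2) (iD1.add iD2) fun p => ?_
      have := mul_nonneg (hK0 p.1) (sq_nonneg (ψ (p.2 + p.1) + ψ p.2))
      simp only
      nlinarith
    rw [integral_add iD1 iD2, eD, eD2] at this
    linarith

lemma Pot.taylor {G f : ℝ → ℝ} {L : ℝ} (h : Pot G f L) {a b : ℝ} (ha : |a| ≤ 1) (hb : |b| ≤ 1) :
    G b ≤ G a - f a * (b - a) + L * (b - a) ^ 2 := by
  have ha := abs_le.1 ha
  have hb := abs_le.1 hb
  have hL := h.Lnn
  rcases lt_trichotomy a b with hab | rfl | hab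
  · obtain ⟨c, hc, he⟩ := exists_hasDerivAt_eq_slope G (fun r => - f r) hab h.cont.continuousOn
      (fun r _ => h.dG r)
    rw [eq_div_iff (by linarith)] at he
    have e1 := h.Lip c ⟨by linarith [hc.1], by linarith [hc.2]⟩ a ha
    rw [abs_of_pos (show 0 < c - a by linarith [hc.1])] at e1
    have e2 := (abs_le.1 e1).1
    have e3 : L * (c - a) ≤ L * (b - a) := mul_le_mul_of_nonneg_left (by linarith [hc.2]) hL
    have hpos : 0 < b - a := by linarith
    nlinarith
  · simp
  · obtain ⟨c, hc, he⟩ := exists_hasDerivAt_eq_slope G (fun r => - f r) hab h.cont.continuousOn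
      (fun r _ => h.dG r)
    rw [eq_div_iff (by linarith)] at he
    have e1 := h.Lip c ⟨by linarith [hc.1], by linarith [hc.2]⟩ a ha
    rw [abs_of_neg (show c - a < 0 by linarith [hc.2])] at e1
    have e2 := (abs_le.1 e1).2
    have e3 : L * (a - c) ≤ L * (a - b) := mul_le_mul_of_nonneg_left (by linarith [hc.1]) hL
    have hpos : 0 < a - b := by linarith
    nlinarith

lemma ofReal_int {α : Type*} [MeasurableSpace α] {μ : Measure α} {F : α → ℝ} (hm : Measurable F)
    (h0 : ∀ x, 0 ≤ F x) (hfin : ∫⁻ x, ENNReal.ofReal (F x) ∂μ < ⊤) : Integrable F μ := by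
  refine ⟨hm.aestronglyMeasurable, ?_⟩
  rw [hasFiniteIntegral_iff_ofReal (Eventually.of_forall h0)]
  exact hfin

open Real MeasureTheory Filter Set

theorem min_var {K G f : ℝ → ℝ} {L : ℝ} (hKm : Measurable K) (hK0 : ∀ z, 0 ≤ K z)
    (hKi : IntegrableOn K (Ioi 0)) (hG : Pot G f L) {u ψ : ℝ → ℝ} (hu : Monotone u)
    (hu1 : ∀ x, |u x| ≤ 1) (hfin : En K G u < ⊤)
    (hψm : Measurable ψ) (hψ : Integrable ψ) {A : ℝ} (hψ2 : ∀ x, |ψ x| ≤ A)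
    (hw1 : ∀ x, |u x + ψ x| ≤ 1) (hmin : En K G u ≤ En K G (fun x => u x + ψ x)) :
    0 ≤ (∫ x, ψ x * Lop K u x) - (∫ x, ψ x * f (u x)) +
      (2 * (∫ z in Ioi 0, K z) + L) * ∫ x, ψ x ^ 2 := by
  have hum := hu.measurable
  have hfin' := ENNReal.add_lt_top.1 hfin
  have hGm : Measurable G := hG.cont.measurable
  have k0 : ∀ w p, 0 ≤ Kin K w p := fun w p => by
    unfold Kin; exact mul_nonneg (div_nonneg (hK0 _) (by norm_num)) (sq_nonneg _)
  have iT := ofReal_int (Kin_meas hKm hum) (k0 u) hfin'.1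
  have iG : Integrable (fun x => G (u x)) := ofReal_int (hGm.comp hum) (fun x => hG.nonneg (hu1 x)) hfin'.2
  obtain ⟨iTw, hTw⟩ := kin_expand hKi hK0 hum hu1 hψm hψ hψ2 iT
  have iψ2 : Integrable fun x => ψ x ^ 2 := by
    have := hψ.mul_bdd (c := A) hψm.aestronglyMeasurable (Eventually.of_forall hψ2)
    simpa [sq] using this
  have ifu : Integrable fun x => ψ x * f (u x) := by
    obtain ⟨B, hB⟩ := isCompact_Icc.exists_bound_of_continuousOn
      (s := Icc (-1:ℝ) 1) hG.fc.continuousOn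
    exact hψ.mul_bdd (c := B) (hG.fc.measurable.comp hum).aestronglyMeasurable
      (Eventually.of_forall fun x => hB _ (abs_le.1 (hu1 x)))
  have hT : ∀ x, G (u x + ψ x) ≤ G (u x) - ψ x * f (u x) + L * ψ x ^ 2 := fun x => by
    have := hG.taylor (hu1 x) (hw1 x)
    rw [add_sub_cancel_left] at this
    linarith [mul_comm (f (u x)) (ψ x)]
  have i1 : Integrable fun x => G (u x) - ψ x * f (u x) := iG.sub ifu
  have i2 : Integrable fun x => G (u x) - ψ x * f (u x) + L * ψ x ^ 2 := i1.add (iψ2.const_mul L)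
  have iGw : Integrable fun x => G (u x + ψ x) := by
    refine i2.mono' (hGm.comp (hum.add hψm)).aestronglyMeasurable (Eventually.of_forall fun x => ?_)
    rw [Real.norm_eq_abs, abs_of_nonneg (hG.nonneg (hw1 x))]
    exact hT x
  have hGw := integral_mono iGw i2 hT
  rw [integral_add i1 (iψ2.const_mul L), integral_sub iG ifu, integral_const_mul] at hGw
  unfold En at hmin
  rw [← ofReal_integral_eq_lintegral_ofReal iT (Eventually.of_forall (k0 u)),
    ← ofReal_integral_eq_lintegral_ofReal iG (Eventually.of_forall fun x => hG.nonneg (hu1 x)),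
    ← ofReal_integral_eq_lintegral_ofReal iTw (Eventually.of_forall (k0 _)),
    ← ofReal_integral_eq_lintegral_ofReal iGw (Eventually.of_forall fun x => hG.nonneg (hw1 x)),
    ← ENNReal.ofReal_add (integral_nonneg (k0 u)) (integral_nonneg fun x => hG.nonneg (hu1 x)),
    ← ENNReal.ofReal_add (integral_nonneg (k0 _)) (integral_nonneg fun x => hG.nonneg (hw1 x)),
    ENNReal.ofReal_le_ofReal_iff (add_nonneg (integral_nonneg (k0 _)) (integral_nonneg fun x => hG.nonneg (hw1 x)))]
    at hmin
  nlinarith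

theorem el_ae {K G f : ℝ → ℝ} {L : ℝ} (hKm : Measurable K) (hK0 : ∀ z, 0 ≤ K z)
    (hKi : IntegrableOn K (Ioi 0)) (hG : Pot G f L) (hm : L < 2 * ∫ z in Ioi 0, K z)
    {u : ℝ → ℝ} (hu : Monotone u)
    (hu1 : ∀ x, |u x| ≤ 1) (hfin : En K G u < ⊤) (hb : Tendsto u atBot (nhds (-1)))
    (ht : Tendsto u atTop (nhds 1))
    (hmin : ∀ w, Monotone w → (∀x,|w x|≤1) → Tendsto w atBot (nhds (-1)) →
      Tendsto w atTop (nhds 1) → En K G u ≤ En K G w) :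
    ∀ᵐ x, Lop K u x = f (u x) := by
  set m := 2 * ∫ z in Ioi 0, K z with hmd
  have hL := hG.Lnn
  have hum := hu.measurable
  set Ku : ℝ → ℝ := fun x => ∫ z in Ioi 0, (u (x + z) + u (x - z)) * K z with hKu
  have iKu : ∀ x, IntegrableOn (fun z => (u (x + z) + u (x - z)) * K z) (Ioi 0) := fun x => by
    have h1 : Measurable fun z => u (x + z) + u (x - z) :=
      (hum.comp (measurable_const.add measurable_id)).add (hum.comp (measurable_const.sub measurable_id))
    refine Integrable.bdd_mul (c := 2) hKi h1.aestronglyMeasurable (Eventually.of_forall fun z => ?_)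
    rw [Real.norm_eq_abs]
    exact (abs_add_le _ _).trans (by linarith [hu1 (x + z), hu1 (x - z)])
  have Kmono : Monotone Ku := fun x y hxy => by
    refine integral_mono (iKu x) (iKu y) fun z => ?_
    exact mul_le_mul_of_nonneg_right (add_le_add (hu (by linarith)) (hu (by linarith))) (hK0 z)
  have Kb : ∀ x, |Ku x| ≤ m := fun x => by
    have e : ∀ z, |(u (x + z) + u (x - z)) * K z| ≤ 2 * K z := fun z => by
      rw [abs_mul, abs_of_nonneg (hK0 z)]
      exact mul_le_mul_of_nonneg_right ((abs_add_le _ _).trans (by linarith [hu1 (x + z), hu1 (x - z)])) (hK0 z)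
    calc |Ku x| ≤ ∫ z in Ioi 0, |(u (x + z) + u (x - z)) * K z| := abs_integral_le_integral_abs
      _ ≤ ∫ z in Ioi 0, 2 * K z := integral_mono (iKu x).abs (hKi.const_mul 2) e
      _ = m := by rw [integral_const_mul]
  have Lu : ∀ x, Lop K u x = m * u x - Ku x := fun x => by
    simp only [hKu, hmd]
    unfold Lop sdf
    have : (fun z => (2 * u x - u (x + z) - u (x - z)) * K z) =
      fun z => 2 * u x * K z - (u (x + z) + u (x - z)) * K z := by ext z; ring
    rw [this, integral_sub (hKi.const_mul _) (iKu x), integral_const_mul]; ring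
  -- the function h
  have hinc : ∀ a ∈ Icc (-1:ℝ) 1, ∀ b ∈ Icc (-1:ℝ) 1, a ≤ b →
      (m - L) * (b - a) ≤ (m * b - f b) - (m * a - f a) := fun a ha b hb hab => by
    have := (abs_le.1 (hG.Lip b hb a ha)).2
    rw [abs_of_nonneg (by linarith : 0 ≤ b - a)] at this
    linarith
  have hex : ∀ x, ∃ v ∈ Icc (-1:ℝ) 1, m * v - f v = Ku x := fun x => by
    have hc : ContinuousOn (fun t => m * t - f t) (Icc (-1:ℝ) 1) :=
      ((continuous_const.mul continuous_id).sub hG.fc).continuousOn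
    have := intermediate_value_Icc (by norm_num : (-1:ℝ) ≤ 1) hc
    have h2 : Ku x ∈ Icc (m * (-1) - f (-1)) (m * 1 - f 1) := by
      rw [hG.fm, hG.fp]
      have := abs_le.1 (Kb x)
      constructor <;> linarith [this.1, this.2]
    obtain ⟨v, hv, he⟩ := this h2
    exact ⟨v, hv, he⟩
  choose v hv1 hv using hex
  have vmono : Monotone v := fun x y hxy => by
    by_contra hlt
    push Not at hlt
    have h1 := hinc _ (hv1 y) _ (hv1 x) hlt.le
    rw [hv, hv] at h1
    have h2 := Kmono hxy
    nlinarith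
  -- key
  have key : ∀ n : ℕ, ∀ᵐ x, (if |x| ≤ (n:ℝ) then max (u (-n)) (min (v x) (u n)) else u x) - u x = 0 := by
    intro n
    have hn : (0:ℝ) ≤ n := Nat.cast_nonneg n
    set w1 : ℝ → ℝ := fun x => if |x| ≤ (n:ℝ) then max (u (-n)) (min (v x) (u n)) else u x with hw1
    have hnn : u (-n) ≤ u n := hu (by linarith)
    have w1mono : Monotone w1 := by
      intro x y hxy
      simp only [hw1]
      split_ifs with h1 h2 h2
      · exact max_le_max le_rfl (min_le_min (vmono hxy) le_rfl)
      · have h3 : (n:ℝ) ≤ y := by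
          by_contra hc
          push Not at hc
          exact h2 (abs_le.2 ⟨by linarith [(abs_le.1 h1).1], hc.le⟩)
        exact (max_le hnn (min_le_right _ _)).trans (hu h3)
      · have h3 : x ≤ -n := by
          by_contra hc
          push Not at hc
          exact h1 (abs_le.2 ⟨hc.le, by linarith [(abs_le.1 h2).2]⟩)
        exact (hu h3).trans (le_max_left _ _)
      · exact hu hxy
    have w1b : ∀ x, |w1 x| ≤ 1 := fun x => by
      simp only [hw1]
      split_ifs
      · exact abs_le.2 ⟨le_max_of_le_left (abs_le.1 (hu1 _)).1,
          max_le (abs_le.1 (hu1 _)).2 (min_le_of_left_le (hv1 x).2)⟩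
      · exact hu1 x
    set φ : ℝ → ℝ := fun x => w1 x - u x with hφ
    have φm : Measurable φ := w1mono.measurable.sub hum
    have φb : ∀ x, |φ x| ≤ 2 := fun x => by
      have h1 := abs_le.1 (w1b x); have h2 := abs_le.1 (hu1 x)
      simp only [hφ]
      rw [abs_le]; constructor <;> linarith [h1.1, h1.2, h2.1, h2.2]
    have φ0 : ∀ x, (n:ℝ) < |x| → φ x = 0 := fun x hx => by
      simp only [hφ, hw1, if_neg (not_le.2 hx), sub_self]
    have φi : Integrable φ := by
      have : IntegrableOn φ (Icc (-(n:ℝ)) n) :=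
        Measure.integrableOn_of_bounded (M := 2) (by simp) φm.aestronglyMeasurable
          (Eventually.of_forall φb)
      refine (integrableOn_iff_integrable_of_support_subset ?_).1 this
      intro x hx
      by_contra hc
      exact hx (φ0 x (by
        by_contra h; push Not at h; exact hc (abs_le.1 h)))
    have φsq : Integrable fun x => φ x ^ 2 := by
      have := φi.mul_bdd (c := 2) φm.aestronglyMeasurable (Eventually.of_forall φb)
      simpa [sq] using this
    have pt : ∀ x, φ x * (Lop K u x - f (u x)) ≤ - ((m - L) * φ x ^ 2) := fun x => by
      by_cases hx : |x| ≤ (n:ℝ)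
      · have hx' := abs_le.1 hx
        have e1 : u (-n) ≤ u x := hu hx'.1
        have e2 : u x ≤ u n := hu hx'.2
        have eφ : φ x = max (u (-n)) (min (v x) (u n)) - u x := by simp only [hφ, hw1, if_pos hx]
        have eL : Lop K u x - f (u x) = (m * u x - f (u x)) - (m * v x - f (v x)) := by
          rw [Lu, hv]; ring
        rw [eL]
        have hux := abs_le.1 (hu1 x)
        rcases le_total (u x) (v x) with h | h
        · have h1 := hinc _ hux _ (hv1 x) h
          have h2 : 0 ≤ φ x := by
            rw [eφ]; linarith [le_max_right (u (-n)) (min (v x) (u n)), le_min h e2]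
          have h3 : φ x ≤ v x - u x := by
            rw [eφ]; linarith [max_le (e1.trans h) (min_le_left (v x) (u n))]
          have h4 : (m - L) * φ x ≤ (m - L) * (v x - u x) :=
            mul_le_mul_of_nonneg_left h3 (by linarith)
          nlinarith
        · have h1 := hinc _ (hv1 x) _ hux h
          have h2 : φ x ≤ 0 := by
            rw [eφ]; linarith [max_le e1 ((min_le_left (v x) (u n)).trans h)]
          have h3 : v x - u x ≤ φ x := by
            rw [eφ]
            have : v x ≤ min (v x) (u n) := le_min le_rfl (h.trans e2)
            linarith [le_max_right (u (-n)) (min (v x) (u n))]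
          have h4 : (m - L) * (v x - u x) ≤ (m - L) * φ x :=
            mul_le_mul_of_nonneg_left h3 (by linarith)
          nlinarith
      · rw [φ0 x (not_le.1 hx)]; simp
    set τ := (m - L) / (2 * (m + L)) with hτ
    have hτ0 : 0 < τ := div_pos (by linarith) (by linarith)
    have hτ1 : τ ≤ 1 := by rw [hτ, div_le_one (by linarith)]; linarith
    have hτe : (m + L) * τ = (m - L) / 2 := by
      have : m + L ≠ 0 := by linarith
      rw [hτ]; field_simp
    have weq : (fun x => u x + τ * φ x) = fun x => (1 - τ) * u x + τ * w1 x := by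
      ext x; simp only [hφ]; ring
    have wmono : Monotone fun x => u x + τ * φ x := by
      rw [weq]
      exact (hu.const_mul (by linarith)).add (w1mono.const_mul hτ0.le)
    have wb : ∀ x, |u x + τ * φ x| ≤ 1 := fun x => by
      have := congrFun weq x
      beta_reduce at this
      rw [this]
      have h1 := abs_le.1 (w1b x); have h2 := abs_le.1 (hu1 x)
      rw [abs_le]; constructor <;> nlinarith [h1.1, h1.2, h2.1, h2.2]
    have wev1 : (fun x => u x + τ * φ x) =ᶠ[atTop] u := by
      filter_upwards [eventually_gt_atTop (n:ℝ)] with x hx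
      rw [φ0 x (lt_of_lt_of_le hx (le_abs_self x))]; simp
    have wev2 : (fun x => u x + τ * φ x) =ᶠ[atBot] u := by
      filter_upwards [eventually_lt_atBot (-(n:ℝ))] with x hx
      rw [φ0 x (lt_of_lt_of_le (by linarith) (neg_le_abs x))]; simp
    have hmw := hmin _ wmono wb (hb.congr' wev2.symm) (ht.congr' wev1.symm)
    have hv := min_var hKm hK0 hKi hG hu hu1 hfin (ψ := fun x => τ * φ x) (A := 2)
      (measurable_const.mul φm) (φi.const_mul τ) (fun x => by
        rw [abs_mul, abs_of_pos hτ0]; nlinarith [φb x, abs_nonneg (φ x)]) wb hmw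
    have iLu : Integrable fun x => φ x * Lop K u x := by
      have : Lop K u = fun x => m * u x - Ku x := funext Lu
      rw [this]
      refine φi.mul_bdd (c := m + m) ((measurable_const.mul hum).sub Kmono.measurable).aestronglyMeasurable
        (Eventually.of_forall fun x => ?_)
      rw [Real.norm_eq_abs]
      refine (abs_sub _ _).trans (add_le_add ?_ (Kb x))
      rw [abs_mul, abs_of_nonneg (by linarith : 0 ≤ m)]
      nlinarith [hu1 x]
    have ifu : Integrable fun x => φ x * f (u x) := by
      obtain ⟨B, hB⟩ := isCompact_Icc.exists_bound_of_continuousOn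
        (s := Icc (-1:ℝ) 1) hG.fc.continuousOn
      exact φi.mul_bdd (c := B) (hG.fc.measurable.comp hum).aestronglyMeasurable
        (Eventually.of_forall fun x => hB _ (abs_le.1 (hu1 x)))
    have hle : (∫ x, φ x * Lop K u x) - (∫ x, φ x * f (u x)) ≤ - ((m - L) * ∫ x, φ x ^ 2) := by
      rw [← integral_sub iLu ifu, ← integral_const_mul, ← integral_neg]
      refine integral_mono (iLu.sub ifu) (φsq.const_mul _).neg fun x => ?_
      have := pt x
      simp only
      linarith [mul_sub (φ x) (Lop K u x) (f (u x))]
    have e1 : ∫ x, τ * φ x * Lop K u x = τ * ∫ x, φ x * Lop K u x := by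
      rw [← integral_const_mul]; congr 1; ext x; ring
    have e2 : ∫ x, τ * φ x * f (u x) = τ * ∫ x, φ x * f (u x) := by
      rw [← integral_const_mul]; congr 1; ext x; ring
    have e3 : ∫ x, (τ * φ x) ^ 2 = τ ^ 2 * ∫ x, φ x ^ 2 := by
      rw [← integral_const_mul]; congr 1; ext x; ring
    rw [e1, e2, e3, ← hmd] at hv
    set S := ∫ x, φ x ^ 2
    have hS0 : 0 ≤ S := integral_nonneg fun x => sq_nonneg _
    have e4 : (m + L) * (τ ^ 2 * S) = τ * ((m - L) / 2) * S := by rw [← hτe]; ring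
    have e5 := mul_le_mul_of_nonneg_left hle hτ0.le
    have e6 : 0 < τ * (m - L) := mul_pos hτ0 (by linarith)
    have hS : S = 0 := by nlinarith
    have := (integral_eq_zero_iff_of_nonneg (fun x => sq_nonneg (φ x)) φsq).1 hS
    filter_upwards [this] with x hx
    exact pow_eq_zero_iff (two_ne_zero) |>.1 hx
  filter_upwards [ae_all_iff.2 key] with x hx
  have h1 : Tendsto (fun n : ℕ => max (u (-n)) (min (v x) (u n))) atTop (nhds (max (-1) (min (v x) 1))) := by
    refine Tendsto.max ?_ (Tendsto.min tendsto_const_nhds (ht.comp tendsto_natCast_atTop_atTop))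
    exact hb.comp (tendsto_neg_atTop_atBot.comp tendsto_natCast_atTop_atTop)
  rw [min_eq_left (hv1 x).2, max_eq_right (hv1 x).1] at h1
  have h2 : Tendsto (fun n : ℕ => max (u (-n)) (min (v x) (u n))) atTop (nhds (u x)) := by
    refine tendsto_const_nhds.congr' ?_
    filter_upwards [eventually_ge_atTop ⌈|x|⌉₊] with n hn
    have := hx n
    rw [if_pos ((Nat.le_ceil _).trans (Nat.cast_le.2 hn))] at this
    linarith
  have h3 := tendsto_nhds_unique h1 h2
  rw [Lu, ← hv x, h3]; ring

theorem weak_of_ae {K u g : ℝ → ℝ} (hKi : IntegrableOn K (Ioi 0)) (hu : Measurable u)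
    (hu1 : ∀ x, |u x| ≤ 1) (h : ∀ᵐ x, Lop K u x = g x) : WeakSol K u g := by
  intro ρ hρ x
  have e1 : ∀ z, sdf (mol ρ u) x z * K z = ∫ t, K z * ρ t * sdf u (x - t) z := fun z => by
    unfold sdf mol
    have i0 := mol_integrable hρ.integrable hu hu1
    have hrw : ∀ t, K z * ρ t * (2 * u (x - t) - u (x - t + z) - u (x - t - z)) =
      K z * (2 * (ρ t * u (x - t)) - ρ t * u (x + z - t) - ρ t * u (x - z - t)) := fun t => by
      rw [show x - t + z = x + z - t by ring, show x - t - z = x - z - t by ring]; ring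
    simp_rw [hrw]
    have i4 : Integrable fun t => 2 * (ρ t * u (x - t)) - ρ t * u (x + z - t) :=
      ((i0 x).const_mul 2).sub (i0 (x + z))
    rw [integral_const_mul, integral_sub i4 (i0 (x - z)),
      integral_sub ((i0 x).const_mul 2) (i0 (x + z)), integral_const_mul]
    ring
  have hintg : Integrable (fun p : ℝ × ℝ => K p.1 * ρ p.2 * sdf u (x - p.2) p.1) mu0 := by
    refine int_prod hKi hρ.integrable (b := fun p => sdf u (x - p.2) p.1) ?_ (A := 4 * 1) (fun p => ?_)
    · unfold sdf
      fun_prop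
    · exact sdf_le hu1 _ _
  unfold Lop
  simp_rw [e1]
  have hsw := integral_integral_swap (μ := volume.restrict (Ioi (0:ℝ))) (ν := volume)
    (f := fun z t => K z * ρ t * sdf u (x - t) z) hintg
  rw [hsw]
  unfold mol
  refine integral_congr_ae ?_
  filter_upwards [ae_shift h x] with t ht
  rw [← ht]
  unfold Lop
  rw [← integral_const_mul]
  congr 1; ext z; ring

theorem exists_trunc {K G f : ℝ → ℝ} {L : ℝ} (hKm : Measurable K) (hK0 : ∀ z, 0 ≤ K z)
    (hKi : IntegrableOn K (Ioi 0)) (hG : Pot G f L) (hm : L < 2 * ∫ z in Ioi 0, K z)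
    (hfin : En K G cl < ⊤) :
    ∃ u, Adm u ∧ En K G u ≤ En K G cl ∧ WeakSol K u (fun x => f (u x)) := by
  obtain ⟨u, h1, h2, h3, h4, h5⟩ := exists_min hKm hG hfin
  exact ⟨u, h1, h2, weak_of_ae hKi h1.mono.measurable h1.bd
    (el_ae hKm hK0 hKi hG hm h1.mono h1.bd (h2.trans_lt hfin) h3 h4 h5)⟩

open Real MeasureTheory Filter Set

/-- truncated fractional kernel -/
noncomputable def fker (s : ℝ) (S : Set ℝ) : ℝ → ℝ := S.indicator (fun z => z ^ (-1 - 2*s))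

lemma ker_isKer (s : ℝ) {S : Set ℝ} (hS : MeasurableSet S) (hS0 : S ⊆ Ioi 0) : IsKer s (fker s S) where
  meas := (measurable_id.pow_const _).indicator hS
  nonneg := fun z => indicator_nonneg (fun _ hz => rpow_nonneg (le_of_lt (hS0 hz)) _) z
  le := fun z hz => indicator_le_self' (fun _ _ => rpow_nonneg hz.le _) z

lemma cl_lip (x z : ℝ) (hz : 0 ≤ z) : |cl (x + z) - cl x| ≤ z := by
  have h1 : cl x ≤ cl (x + z) := cl_adm.mono (by linarith)
  rw [abs_of_nonneg (by linarith)]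
  have : cl (x + z) ≤ cl x + z := by
    unfold cl
    rcases le_total x 1 with h | h
    · rw [min_eq_right h]
      refine max_le ?_ ?_
      · linarith [le_max_left (-1) x]
      · exact (min_le_right _ _).trans (by linarith [le_max_right (-1) x])
    · rw [min_eq_left h]
      refine max_le ?_ ?_
      · linarith [le_max_left (-1) (1:ℝ)]
      · exact (min_le_left _ _).trans (by linarith [le_max_right (-1) (1:ℝ)])
  linarith

lemma cl_one {x : ℝ} (h : 1 ≤ x) : cl x = 1 := by
  unfold cl; rw [min_eq_left h]; norm_num
lemma cl_neg {x : ℝ} (h : x ≤ -1) : cl x = -1 := by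
  unfold cl; rw [min_eq_right (by linarith), max_eq_left h]

lemma en_cl_bound {s : ℝ} (hs : s ∈ Ioo (0:ℝ) 1) {G f : ℝ → ℝ} {L R : ℝ} (hG : Pot G f L) :
    ∃ E : ENNReal, E < ⊤ ∧ ∀ S ⊆ Ioo (0:ℝ) R, En (fker s S) G cl ≤ E := by
  have hi : IntegrableOn (fun z : ℝ => z ^ (1 - 2*s)) (Ioo 0 R) := by
    rcases le_or_gt R 0 with h | h
    · simp [Ioo_eq_empty_of_le h]
    · exact (intervalIntegral.integrableOn_Ioo_rpow_iff h).2 (by linarith [hs.2])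
  set q : ℝ → ENNReal := (Ioo 0 R).indicator (fun z => ENNReal.ofReal (z ^ (1 - 2*s)))
  set r : ℝ → ENNReal := (Icc (-1 - R) 1).indicator (fun _ => 1)
  have qfin : ∫⁻ z in Ioi 0, q z < ⊤ := by
    refine (setLIntegral_le_lintegral _ _).trans_lt ?_
    rw [lintegral_indicator measurableSet_Ioo]
    exact hi.lintegral_lt_top
  obtain ⟨B, hB⟩ := isCompact_Icc.exists_bound_of_continuousOn
      (s := Icc (-1:ℝ) 1) hG.cont.continuousOn
  refine ⟨(∫⁻ z in Ioi 0, q z) * (∫⁻ x, r x) +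
    ∫⁻ x, (Icc (-1:ℝ) 1).indicator (fun _ => ENNReal.ofReal B) x, ?_, ?_⟩
  · refine ENNReal.add_lt_top.2 ⟨ENNReal.mul_lt_top qfin ?_, ?_⟩
    · rw [lintegral_indicator measurableSet_Icc]; simp
    · rw [lintegral_indicator measurableSet_Icc]; simp
      exact ENNReal.mul_lt_top ENNReal.ofReal_lt_top (by simp)
  · intro S hS
    unfold En
    refine add_le_add ?_ ?_
    · have : ∫⁻ p, q p.1 * r p.2 ∂mu0 = (∫⁻ z in Ioi 0, q z) * (∫⁻ x, r x) := by
        unfold mu0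
        refine lintegral_prod_mul ?_ ?_
        · exact (Measurable.indicator (by fun_prop) measurableSet_Ioo).aemeasurable
        · exact (Measurable.indicator measurable_const measurableSet_Icc).aemeasurable
      rw [← this]
      refine lintegral_mono fun p => ?_
      by_cases hp : p.1 ∈ S
      · have hp' := hS hp
        by_cases hx : p.2 ∈ Icc (-1 - R) 1
        · simp only [q, r, indicator_of_mem hp', indicator_of_mem hx, mul_one]
          refine ENNReal.ofReal_le_ofReal ?_
          unfold Kin fker
          rw [indicator_of_mem hp]
          have h1 : (cl (p.2 + p.1) - cl p.2) ^ 2 ≤ p.1 ^ 2 :=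
            sq_le_sq' (by linarith [(abs_le.1 (cl_lip p.2 p.1 hp'.1.le)).1])
              (abs_le.1 (cl_lip p.2 p.1 hp'.1.le)).2
          have h2 : p.1 ^ (1 - 2*s) = p.1 ^ (-1 - 2*s) * p.1 ^ 2 := by
            rw [← rpow_natCast, ← rpow_add hp'.1]; norm_num; ring_nf
          have h3 : 0 ≤ p.1 ^ (-1 - 2*s) := rpow_nonneg hp'.1.le _
          rw [h2]
          nlinarith [mul_le_mul_of_nonneg_left h1 h3, mul_nonneg h3 (sq_nonneg p.1)]
        · have : Kin (fker s S) cl p = 0 := by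
            unfold Kin
            have : cl (p.2 + p.1) = cl p.2 := by
              rw [mem_Icc, not_and_or] at hx
              rcases hx with hx | hx
              · rw [cl_neg (by linarith [hp'.1, hp'.2]), cl_neg (by linarith [hp'.1, hp'.2])]
              · rw [cl_one (by linarith [hp'.1, hp'.2]), cl_one (by linarith [hp'.1, hp'.2])]
            rw [this]; simp
          rw [this]; simp
      · have : Kin (fker s S) cl p = 0 := by
          unfold Kin fker
          rw [indicator_of_notMem hp]; simp
        rw [this]; simp
    · refine lintegral_mono fun x => ?_
      by_cases hx : x ∈ Icc (-1:ℝ) 1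
      · rw [indicator_of_mem hx]
        exact ENNReal.ofReal_le_ofReal ((le_abs_self _).trans (hB _ (abs_le.1 (cl_adm.bd x))))
      · have : G (cl x) = 0 := by
          rw [mem_Icc, not_and_or] at hx
          rcases hx with hx | hx
          · rw [cl_neg (by linarith), hG.Gm]
          · rw [cl_one (by linarith), hG.Gp]
        rw [this]; simp

lemma ker_Ioo_int {s : ℝ} (hs : s ∈ Ioo (0:ℝ) 1) {R : ℝ} (n : ℕ) :
    IntegrableOn (fker s (Ioo (exp (-n)) R)) (Ioi 0) := by
  have : Integrable (fker s (Ioo (exp (-n)) R)) := by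
    unfold fker
    rw [integrable_indicator_iff measurableSet_Ioo]
    exact (integrableOn_Ioi_rpow_of_lt (by linarith [hs.1]) (exp_pos _)).mono_set Ioo_subset_Ioi_self
  exact this.integrableOn

lemma ker_Ioo_mass {s : ℝ} (hs : s ∈ Ioo (0:ℝ) 1) {R : ℝ} (hR : 1 ≤ R) (n : ℕ) :
    (n:ℝ) ≤ ∫ z in Ioi 0, fker s (Ioo (exp (-n)) R) z := by
  have he : exp (-n) ≤ 1 := exp_le_one_iff.2 (by simp)
  have h1 : ∫ z in (exp (-n))..1, z⁻¹ = n := by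
    rw [integral_inv_of_pos (exp_pos _) one_pos, log_div one_ne_zero (exp_pos _).ne', log_one, log_exp]
    ring
  have hsub : Ioo (exp (-n)) R ⊆ Ioi 0 := fun z hz => (exp_pos _).trans hz.1
  have hK := ker_isKer s (measurableSet_Ioo (a := exp (-n)) (b := R)) hsub
  rw [intervalIntegral.integral_of_le he, integral_Ioc_eq_integral_Ioo] at h1
  have hii : IntegrableOn (fun z : ℝ => z⁻¹) (Ioo (exp (-n)) 1) := by
    have : IntervalIntegrable (fun z : ℝ => z⁻¹) volume (exp (-n)) 1 := by
      refine intervalIntegral.intervalIntegrable_inv (fun x hx => ?_) continuousOn_id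
      rw [uIcc_of_le he] at hx
      exact ((exp_pos _).trans_le hx.1).ne'
    exact ((intervalIntegrable_iff_integrableOn_Ioc_of_le he).1 this).mono_set Ioo_subset_Ioc_self
  calc (n:ℝ) = ∫ z in Ioo (exp (-n)) 1, z⁻¹ := h1.symm
    _ ≤ ∫ z in Ioo (exp (-n)) 1, fker s (Ioo (exp (-n)) R) z := by
        refine setIntegral_mono_on hii ((ker_Ioo_int hs n).mono_set
          fun z hz => (exp_pos _).trans hz.1) measurableSet_Ioo fun z hz => ?_
        have hz0 : 0 < z := (exp_pos _).trans hz.1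
        unfold fker
        rw [indicator_of_mem (mem_Ioo.2 ⟨hz.1, hz.2.trans_le hR⟩), ← rpow_neg_one]
        exact rpow_le_rpow_of_exponent_ge hz0 hz.2.le (by linarith [hs.1])
    _ ≤ _ := setIntegral_mono_set (ker_Ioo_int hs n) (Eventually.of_forall hK.nonneg)
        (Eventually.of_forall fun z hz => (exp_pos _).trans hz.1)

theorem exists_R {s : ℝ} (hs : s ∈ Ioo (0:ℝ) 1) {G f : ℝ → ℝ} {L R : ℝ} (hG : Pot G f L)
    (hR : 1 ≤ R) : ∃ u, Adm u ∧ WeakSol (fker s (Ioo 0 R)) u (fun x => f (u x)) ∧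
      Tendsto u atBot (nhds (-1)) ∧ Tendsto u atTop (nhds 1) := by
  obtain ⟨E, hE, hEb⟩ := en_cl_bound hs (R := R) hG
  obtain ⟨N, hN⟩ := exists_nat_gt L
  have hsub : ∀ n : ℕ, Ioo (exp (-n)) R ⊆ Ioo 0 R := fun n z hz => ⟨(exp_pos _).trans hz.1, hz.2⟩
  have hker : ∀ n : ℕ, IsKer s (fker s (Ioo (exp (-n)) R)) := fun n =>
    ker_isKer s measurableSet_Ioo fun z hz => (hsub n hz).1
  have hex : ∀ n : ℕ, ∃ u, Adm u ∧ En (fker s (Ioo (exp (-(n + N : ℕ))) R)) G u ≤ E ∧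
      WeakSol (fker s (Ioo (exp (-(n + N : ℕ))) R)) u (fun x => f (u x)) := fun n => by
    have hb := hEb _ (hsub (n + N))
    have hm := ker_Ioo_mass hs hR (n + N)
    have hLN : L < 2 * ∫ z in Ioi 0, fker s (Ioo (exp (-(n + N : ℕ))) R) z := by
      push_cast at hm ⊢
      have := hG.Lnn
      have h0 : (0:ℝ) ≤ n := Nat.cast_nonneg n
      linarith
    obtain ⟨u, h1, h2, h3⟩ := exists_trunc (hker _).meas (hker _).nonneg (ker_Ioo_int hs _) hG hLN
      (hb.trans_lt hE)
    exact ⟨u, h1, h2.trans hb, h3⟩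
  choose u hu hue huw using hex
  obtain ⟨φ, hφ, v, hv, hvb, hvc⟩ := helly (fun n => (hu n).mono) (fun n => (hu n).bd)
  have hva : Adm v := adm_limit (fun n => hu (φ n)) hv hvb hvc
  have hae : ∀ᵐ x, Tendsto (fun n => u (φ n) x) atTop (nhds (v x)) := by
    filter_upwards [ae_cont hv] with x hx using hvc x hx
  have hfin : ∫⁻ x, ENNReal.ofReal (G (v x)) < ⊤ := by
    have h1 := En_fatou (K := fun _ => 0) measurable_const hG (u := fun n => u (φ n))
      (fun n => (hu _).mono.measurable) hae
    have h2 : ∀ w, En (fun _ => 0) G w = ∫⁻ x, ENNReal.ofReal (G (w x)) := fun w => by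
      unfold En Kin; simp
    rw [h2] at h1
    refine (h1.trans ?_).trans_lt hE
    refine liminf_le_of_le (by isBoundedDefault) fun b hb => ?_
    obtain ⟨n, hn⟩ := hb.exists
    refine hn.trans (le_trans ?_ (hue (φ n)))
    rw [h2]; exact le_add_left le_rfl
  obtain ⟨l1, l2⟩ := lims_of_finite hG hv hvb hva.neg hva.pos hfin
  refine ⟨v, hva, ?_, l1, l2⟩
  refine weak_lim hs (Kn := fun n => fker s (Ioo (exp (-(φ n + N : ℕ))) R)) (fun n => hker _) ?_ hG.fc
    (fun n => (hu (φ n)).mono.measurable) (fun n => (hu (φ n)).bd) hae (fun n => huw (φ n))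
  intro z hz
  refine tendsto_const_nhds.congr' ?_
  have ht : Tendsto (fun n => exp (-((φ n + N : ℕ) : ℝ))) atTop (nhds 0) := by
    refine tendsto_exp_atBot.comp (tendsto_neg_atTop_atBot.comp
      (tendsto_natCast_atTop_atTop.comp (tendsto_atTop_mono (fun n => Nat.le_add_right _ _) hφ.tendsto_atTop)))
  filter_upwards [ht.eventually (gt_mem_nhds hz)] with n hn
  unfold fker
  by_cases h : z < R
  · rw [indicator_of_mem (mem_Ioo.2 ⟨hz, h⟩), indicator_of_mem (mem_Ioo.2 ⟨hn, h⟩)]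
  · rw [indicator_of_notMem (fun hc => h hc.2), indicator_of_notMem (fun hc => h hc.2)]

open Real MeasureTheory Filter Set

lemma ker_dct {s : ℝ} (hs : s ∈ Ioo (0:ℝ) 1) {ι : Type*} {l : Filter ι} [l.IsCountablyGenerated]
    {Kn : ι → ℝ → ℝ} {K : ℝ → ℝ} (hK : ∀ n, IsKer s (Kn n))
    (hlim : ∀ z, 0 < z → Tendsto (fun n => Kn n z) l (nhds (K z)))
    {a : ι → ℝ → ℝ} {b : ℝ → ℝ} {B A : ℝ} (hB : 0 ≤ B) (hA : 0 ≤ A) (ha : ∀ n, Measurable (a n))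
    (h1 : ∀ n z, 0 < z → |a n z| ≤ B * z ^ 2) (h2 : ∀ n z, 0 < z → |a n z| ≤ A)
    (hab : ∀ z, 0 < z → Tendsto (fun n => a n z) l (nhds (b z))) :
    Tendsto (fun n => ∫ z in Ioi 0, a n z * Kn n z) l (nhds (∫ z in Ioi 0, b z * K z)) := by
  refine tendsto_integral_filter_of_dominated_convergence
    (fun z => min (B * z ^ 2) A * z ^ (-1 - 2*s)) ?_ ?_ (dom_int hs hB hA) ?_
  · exact Eventually.of_forall fun n => ((ha n).mul (hK n).meas).aestronglyMeasurable
  · exact Eventually.of_forall fun n => (ae_restrict_iff' measurableSet_Ioi).2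
      (Eventually.of_forall fun z hz => ker_dom (hK n) hz (h1 n z hz) (h2 n z hz))
  · exact (ae_restrict_iff' measurableSet_Ioi).2
      (Eventually.of_forall fun z hz => (hab z hz).mul (hlim z hz))

/-- the Hamiltonian bound density -/
def Bz (u : ℝ → ℝ) (x z : ℝ) : ℝ := (u x - u (x - z)) * (u (x + z) - u (x - z))

lemma Bz_meas {u : ℝ → ℝ} (hu : Measurable u) (x : ℝ) : Measurable (Bz u x) := by
  unfold Bz; fun_prop

section
variable {u : ℝ → ℝ} {Λ : ℝ}

lemma diff_abs2 (hu1 : ∀ x, |u x| ≤ 1) (x y : ℝ) : |u x - u y| ≤ 2 := by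
  have h1 := abs_le.1 (hu1 x); have h2 := abs_le.1 (hu1 y)
  rw [abs_le]; constructor <;> linarith [h1.1, h1.2, h2.1, h2.2]

lemma Bz_b1 (hΛ0 : 0 ≤ Λ) (hΛ : ∀ x y, |u x - u y| ≤ Λ * |x - y|) (x z : ℝ) (hz : 0 < z) :
    |Bz u x z| ≤ 2 * Λ ^ 2 * z ^ 2 := by
  unfold Bz
  rw [abs_mul]
  have h1 := hΛ x (x - z)
  have h2 := hΛ (x + z) (x - z)
  rw [show x - (x - z) = z by ring, abs_of_pos hz] at h1
  rw [show x + z - (x - z) = 2 * z by ring, abs_of_pos (by linarith : 0 < 2 * z)] at h2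
  calc _ ≤ (Λ * z) * (Λ * (2 * z)) := mul_le_mul h1 h2 (abs_nonneg _) (by positivity)
    _ = _ := by ring

lemma Bz_b2 (hu1 : ∀ x, |u x| ≤ 1) (x z : ℝ) : |Bz u x z| ≤ 4 := by
  unfold Bz
  rw [abs_mul]
  calc _ ≤ 2 * 2 := mul_le_mul (diff_abs2 hu1 _ _) (diff_abs2 hu1 _ _) (abs_nonneg _) (by norm_num)
    _ = (4:ℝ) := by norm_num
end

lemma inner_bound {u u' : ℝ → ℝ} (hd : ∀ x, HasDerivAt u (u' x) x) (hc : Continuous u')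
    (hu : Monotone u) {x0 x z : ℝ} (hz : 0 < z) :
    ∫ t in x0..x, -(u' t * sdf u t z) ≤ Bz u x z + (u x0 - u (x0 - z)) ^ 2 / 2 := by
  have huc : Continuous u := continuous_iff_continuousAt.2 fun x => (hd x).continuousAt
  have hu'0 : ∀ t, 0 ≤ u' t := fun t => by
    rw [← (hd t).deriv]; exact hu.deriv_nonneg
  set a : ℝ → ℝ := fun t => u' t * (u (t + z) - u t) with ha
  have hac : Continuous a := by fun_prop
  have ha0 : ∀ t, 0 ≤ a t := fun t => mul_nonneg (hu'0 t) (by linarith [hu (show t ≤ t + z by linarith)])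
  set P : ℝ → ℝ := fun x => ∫ t in (0:ℝ)..x, a t with hP
  have hPd : ∀ t, HasDerivAt P (a t) t := fun t =>
    intervalIntegral.integral_hasDerivAt_right (hac.intervalIntegrable _ _)
      (hac.stronglyMeasurableAtFilter _ _) hac.continuousAt
  set Q : ℝ → ℝ := fun t => P t - P (t - z) - (u t - u (t - z)) ^ 2 / 2 with hQ
  have hQd : ∀ t, HasDerivAt Q (-(u' t * sdf u t z)) t := fun t => by
    have h1 : HasDerivAt (fun t => P (t - z)) (a (t - z)) t := by
      simpa using HasDerivAt.comp_sub_const t z (hPd (t - z))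
    have h2 : HasDerivAt (fun t => u (t - z)) (u' (t - z)) t := by
      simpa using HasDerivAt.comp_sub_const t z (hd (t - z))
    have := ((hPd t).sub h1).sub ((((hd t).sub h2).pow 2).div_const 2)
    refine this.congr_deriv ?_
    simp only [ha, sdf, sub_add_cancel, Pi.sub_apply]
    push_cast
    ring
  have hcc : Continuous fun t => -(u' t * sdf u t z) := by
    unfold sdf; fun_prop
  rw [intervalIntegral.integral_eq_sub_of_hasDerivAt (fun t _ => hQd t) (hcc.intervalIntegrable _ _)]
  have hPdiff : ∀ y, P y - P (y - z) = ∫ t in (y - z)..y, a t := fun y =>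
    intervalIntegral.integral_interval_sub_left (hac.intervalIntegrable _ _) (hac.intervalIntegrable _ _)
  have h1 : 0 ≤ P x0 - P (x0 - z) := by
    rw [hPdiff]; exact intervalIntegral.integral_nonneg (by linarith) fun t _ => ha0 t
  have h2 : P x - P (x - z) ≤ Bz u x z := by
    rw [hPdiff]
    have e1 : ∫ t in (x - z)..x, u' t * (u (x + z) - u (x - z)) = Bz u x z := by
      rw [intervalIntegral.integral_mul_const,
        intervalIntegral.integral_eq_sub_of_hasDerivAt (fun t _ => hd t) (hc.intervalIntegrable _ _)]
      rfl
    rw [← e1]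
    refine intervalIntegral.integral_mono_on (by linarith) (hac.intervalIntegrable _ _)
      (Continuous.intervalIntegrable (by fun_prop) _ _) fun t ht => ?_
    refine mul_le_mul_of_nonneg_left ?_ (hu'0 t)
    linarith [hu (show t + z ≤ x + z by linarith [ht.2]), hu ht.1]
  simp only [hQ]
  nlinarith [sq_nonneg (u x - u (x - z))]

theorem ham {s : ℝ} (hs : s ∈ Ioo (0:ℝ) 1) {K : ℝ → ℝ} (hK : IsKer s K) {G f : ℝ → ℝ} {L Λ : ℝ}
    (hG : Pot G f L) {u u' : ℝ → ℝ} (hd : ∀ x, HasDerivAt u (u' x) x) (hc : Continuous u')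
    {B : ℝ} (hB : ∀ x y, |u' x - u' y| ≤ B * |x - y|)
    (hu : Monotone u) (hu1 : ∀ x, |u x| ≤ 1) (hΛ0 : 0 ≤ Λ) (hΛ : ∀ x y, |u x - u y| ≤ Λ * |x - y|)
    (hlim : Tendsto u atBot (nhds (-1))) (hE : ∀ x, Lop K u x = f (u x)) (x : ℝ) :
    G (u x) ≤ ∫ z in Ioi 0, Bz u x z * K z := by
  have huc : Continuous u := continuous_iff_continuousAt.2 fun x => (hd x).continuousAt
  have hum := huc.measurable
  have hB0 : 0 ≤ B := by have := (abs_nonneg _).trans (hB 0 1); simpa using this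
  have iB : IntegrableOn (fun z => Bz u x z * K z) (Ioi 0) :=
    ker_integrable hs hK (Bz_meas hum x) (fun z hz => Bz_b1 hΛ0 hΛ x z hz) (fun z _ => Bz_b2 hu1 x z)
  have md : ∀ x0, Measurable fun z => (u x0 - u (x0 - z)) ^ 2 / 2 := fun x0 => by fun_prop
  have d1 : ∀ x0 z, 0 < z → |(u x0 - u (x0 - z)) ^ 2 / 2| ≤ Λ ^ 2 * z ^ 2 := fun x0 z hz => by
    rw [abs_of_nonneg (by positivity)]
    have h1 := hΛ x0 (x0 - z)
    rw [show x0 - (x0 - z) = z by ring, abs_of_pos hz] at h1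
    have h2 : (u x0 - u (x0 - z)) ^ 2 ≤ (Λ * z) ^ 2 := sq_le_sq' (by linarith [(abs_le.1 h1).1]) (abs_le.1 h1).2
    nlinarith [sq_nonneg (Λ * z)]
  have d2 : ∀ x0 z, 0 < z → |(u x0 - u (x0 - z)) ^ 2 / 2| ≤ 2 := fun x0 z hz => by
    rw [abs_of_nonneg (by positivity)]
    have h1 := diff_abs2 hu1 x0 (x0 - z)
    have h2 : (u x0 - u (x0 - z)) ^ 2 ≤ 2 ^ 2 := sq_le_sq' (by linarith [(abs_le.1 h1).1]) (abs_le.1 h1).2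
    linarith
  have iD : ∀ x0, IntegrableOn (fun z => (u x0 - u (x0 - z)) ^ 2 / 2 * K z) (Ioi 0) := fun x0 =>
    ker_integrable hs hK (md x0) (d1 x0) (d2 x0)
  have step : ∀ x0 ≤ x, G (u x) - G (u x0) ≤ (∫ z in Ioi 0, Bz u x z * K z) +
      ∫ z in Ioi 0, (u x0 - u (x0 - z)) ^ 2 / 2 * K z := by
    intro x0 hx0
    have hGd : ∀ t, HasDerivAt (fun t => G (u t)) (-f (u t) * u' t) t := fun t =>
      (hG.dG (u t)).comp t (hd t)
    have hGc : Continuous fun t => -f (u t) * u' t := by have := hG.fc; fun_prop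
    have e1 : ∫ t in x0..x, -f (u t) * u' t = G (u x) - G (u x0) :=
      intervalIntegral.integral_eq_sub_of_hasDerivAt (fun t _ => hGd t) (hGc.intervalIntegrable _ _)
    have e2 : ∫ t in x0..x, -f (u t) * u' t =
        ∫ t in Ioc x0 x, ∫ z in Ioi 0, -(u' t * sdf u t z) * K z := by
      rw [intervalIntegral.integral_of_le hx0]
      congr 1; ext t
      rw [← hE t]; unfold Lop
      rw [← integral_neg, ← integral_mul_const]
      congr 1; ext z; ring
    obtain ⟨M, hM⟩ := (isCompact_Icc (a := x0) (b := x)).exists_bound_of_continuousOn hc.continuousOn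
    have hintg : Integrable (Function.uncurry fun t z => -(u' t * sdf u t z) * K z)
        ((volume.restrict (Ioc x0 x)).prod (volume.restrict (Ioi 0))) := by
      have h1 : Integrable (fun p : ℝ × ℝ => M * (min (2 * B * p.2 ^ 2) 4 * p.2 ^ (-1 - 2*s)))
          ((volume.restrict (Ioc x0 x)).prod (volume.restrict (Ioi 0))) :=
        Integrable.mul_prod (f := fun _ => M) (integrable_const M)
          (dom_int hs (by linarith : 0 ≤ 2 * B) (by norm_num : (0:ℝ) ≤ 4))
      refine h1.mono' ?_ ?_
      · have := hc.measurable
        have := hK.meas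
        have h3 : Measurable fun p : ℝ × ℝ => -(u' p.1 * sdf u p.1 p.2) * K p.2 := by
          unfold sdf; fun_prop
        exact h3.aestronglyMeasurable
      · rw [Measure.prod_restrict]
        refine (ae_restrict_iff' (measurableSet_Ioc.prod measurableSet_Ioi)).2
          (Eventually.of_forall fun p hp => ?_)
        have k1 := ker_dom hK (B := 2 * B) (A := 4) (a := sdf u p.1 p.2) (z := p.2) hp.2
          (sd_bound hd hB p.1 (le_of_lt hp.2)) ((sdf_le hu1 _ _).trans (by norm_num))
        have k2 := hM p.1 ⟨hp.1.1.le, hp.1.2⟩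
        have : Function.uncurry (fun t z => -(u' t * sdf u t z) * K z) p =
          - (u' p.1 * (sdf u p.1 p.2 * K p.2)) := by
          simp [Function.uncurry]; ring
        rw [this, norm_neg, norm_mul]
        exact mul_le_mul k2 k1 (norm_nonneg _) ((norm_nonneg _).trans k2)
    rw [← e1, e2, integral_integral_swap hintg, ← integral_add iB (iD x0)]
    refine setIntegral_mono_on hintg.integral_prod_right (iB.add (iD x0)) measurableSet_Ioi fun z hz => ?_
    have hib := inner_bound hd hc hu (x0 := x0) (x := x) hz
    rw [intervalIntegral.integral_of_le hx0] at hib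
    rw [integral_mul_const]
    have := mul_le_mul_of_nonneg_right hib (hK.nonneg z)
    linarith
  have t1 : Tendsto (fun x0 => ∫ z in Ioi 0, (u x0 - u (x0 - z)) ^ 2 / 2 * K z) atBot
      (nhds (∫ z in Ioi 0, (0:ℝ) * K z)) := by
    refine ker_dct hs (Kn := fun _ => K) (fun _ => hK) (fun _ _ => tendsto_const_nhds)
      (by positivity) (by norm_num) md d1 d2 fun z hz => ?_
    have h1 : Tendsto (fun x0 => u (x0 - z)) atBot (nhds (-1)) :=
      hlim.comp (tendsto_atBot_add_const_right _ (-z) tendsto_id)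
    have := ((hlim.sub h1).pow 2).div_const 2
    simpa using this
  have t2 : Tendsto (fun x0 => G (u x0)) atBot (nhds (G (-1))) := (hG.cont.tendsto _).comp hlim
  rw [hG.Gm] at t2
  have t3 := ge_of_tendsto ((tendsto_const_nhds (x := ∫ z in Ioi 0, Bz u x z * K z)).add t1 |>.sub
    (tendsto_const_nhds (x := G (u x)) |>.sub t2)) (b := 0) (by
      filter_upwards [eventually_le_atBot x] with x0 hx0
      have := step x0 hx0
      linarith)
  simp at t3
  linarith

/-- limit passage -/
theorem level2 {s : ℝ} (hs : s ∈ Ioo (0:ℝ) 1) {G f : ℝ → ℝ} {L C γ : ℝ} (hG : Pot G f L)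
    (hγ : max 0 (1 - 2*s) < γ) (hf : ContDiff ℝ 1 f)
    (hfC : ∀ x y : ℝ, |deriv f x - deriv f y| ≤ C * |x - y| ^ γ) :
    ∃ u u' u'' : ℝ → ℝ, Monotone u ∧ (∀ x, |u x| ≤ 1) ∧ (∀ x, HasDerivAt u (u' x) x) ∧
      (∀ x, HasDerivAt u' (u'' x) x) ∧
      Continuous u'' ∧ (∃ B, ∀ x, |u' x| ≤ B) ∧ (∃ B, ∀ x, |u'' x| ≤ B) ∧
      (∀ x, Lop (fker s (Ioi 0)) u x = f (u x)) ∧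
      Tendsto u atBot (nhds (-1)) ∧ Tendsto u atTop (nhds 1) := by
  obtain ⟨Λ, hΛ0, hΛ⟩ := lip_core hs hG.Lnn
  have hLw : ∀ u : ℝ → ℝ, Monotone u → (∀ x, |u x| ≤ 1) → ∀ K, IsKer s K →
      (∀ z, 0 < z → z ≤ 1 → z ^ (-1 - 2*s) ≤ K z) → WeakSol K u (fun x => f (u x)) →
      ∀ x y, |u x - u y| ≤ Λ * |x - y| := by
    intro u hu hu1 K hK hK1 hW
    refine hΛ K hK hK1 u _ hu hu1 (hG.fc.measurable.comp hu.measurable) ?_ ?_ hW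
    · obtain ⟨B, hB⟩ := isCompact_Icc.exists_bound_of_continuousOn
        (s := Icc (-1:ℝ) 1) hG.fc.continuousOn
      exact ⟨B, fun x => hB _ (abs_le.1 (hu1 x))⟩
    · intro x y hxy
      have h1 := (abs_le.1 (hG.Lip (u y) (abs_le.1 (hu1 y)) (u x) (abs_le.1 (hu1 x)))).2
      rwa [abs_of_nonneg (by linarith [hu hxy])] at h1
  have hkn : ∀ n : ℕ, IsKer s (fker s (Ioo 0 ((n:ℝ) + 2))) := fun n =>
    ker_isKer s measurableSet_Ioo fun z hz => hz.1
  have hkn1 : ∀ n : ℕ, ∀ z, 0 < z → z ≤ 1 → z ^ (-1 - 2*s) ≤ fker s (Ioo 0 ((n:ℝ) + 2)) z := by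
    intro n z hz hz1
    have h0 : (0:ℝ) ≤ n := Nat.cast_nonneg n
    unfold fker
    rw [indicator_of_mem (mem_Ioo.2 ⟨hz, by linarith⟩)]
  have hk : IsKer s (fker s (Ioi 0)) := ker_isKer s measurableSet_Ioi subset_rfl
  have hk1 : ∀ z, 0 < z → z ≤ 1 → z ^ (-1 - 2*s) ≤ fker s (Ioi 0) z := by
    intro z hz hz1
    unfold fker
    rw [indicator_of_mem (mem_Ioi.2 hz)]
  have hklim : ∀ z, 0 < z → Tendsto (fun n : ℕ => fker s (Ioo 0 ((n:ℝ) + 2)) z) atTop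
      (nhds (fker s (Ioi 0) z)) := by
    intro z hz
    refine tendsto_const_nhds.congr' ?_
    filter_upwards [eventually_ge_atTop ⌈z⌉₊] with n hn
    have := (Nat.le_ceil z).trans (Nat.cast_le.2 hn)
    unfold fker
    rw [indicator_of_mem (mem_Ioi.2 hz), indicator_of_mem (mem_Ioo.2 ⟨hz, by linarith⟩)]
  have hex : ∀ n : ℕ, ∃ u, Adm u ∧ WeakSol (fker s (Ioo 0 ((n:ℝ) + 2))) u (fun x => f (u x)) ∧
      Tendsto u atBot (nhds (-1)) ∧ Tendsto u atTop (nhds 1) := fun n =>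
    exists_R hs hG (by have h0 : (0:ℝ) ≤ n := Nat.cast_nonneg n
                       linarith)
  choose u hu huw hub hut using hex
  have hul : ∀ n x y, |u n x - u n y| ≤ Λ * |x - y| := fun n =>
    hLw _ (hu n).mono (hu n).bd _ (hkn n) (hkn1 n) (huw n)
  have hGn : ∀ n x, G (u n x) ≤ ∫ z in Ioi 0, Bz (u n) x z * fker s (Ioo 0 ((n:ℝ) + 2)) z := by
    intro n
    obtain ⟨u', u'', hd, hd2, -, -, ⟨B, hB⟩, hE⟩ := reg hs (hkn n) (hkn1 n) hγ hf hfC hG.Lip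
      (hu n).mono (hu n).bd (hul n) (huw n)
    exact ham hs (hkn n) hG hd (continuous_iff_continuousAt.2 fun x => (hd2 x).continuousAt)
      (lip_of_deriv_bdd hd2 hB) (hu n).mono (hu n).bd hΛ0 (hul n) (hub n) hE
  obtain ⟨φ, hφ, v, hv, hvb, hvc⟩ := helly (fun n => (hu n).mono) (fun n => (hu n).bd)
  have hva : Adm v := adm_limit (fun n => hu (φ n)) hv hvb hvc
  have hae : ∀ᵐ x, Tendsto (fun n => u (φ n) x) atTop (nhds (v x)) := by
    filter_upwards [ae_cont hv] with x hx using hvc x hx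
  have hvw : WeakSol (fker s (Ioi 0)) v (fun x => f (v x)) :=
    weak_lim hs (fun n => hkn (φ n)) (fun z hz => (hklim z hz).comp hφ.tendsto_atTop) hG.fc
      (fun n => (hu (φ n)).mono.measurable) (fun n => (hu (φ n)).bd) hae (fun n => huw (φ n))
  have hvl := hLw v hv hvb _ hk hk1 hvw
  obtain ⟨v', v'', hd, hd2, hc2, hB1, hB2, hE⟩ := reg hs hk hk1 hγ hf hfC hG.Lip hv hvb hvl hvw
  have hcv : Continuous v := continuous_iff_continuousAt.2 fun x => (hd x).continuousAt
  have hvt : ∀ x, Tendsto (fun n => u (φ n) x) atTop (nhds (v x)) := fun x => hvc x hcv.continuousAt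
  have hGv : ∀ x, G (v x) ≤ ∫ z in Ioi 0, Bz v x z * fker s (Ioi 0) z := by
    intro x
    refine le_of_tendsto_of_tendsto' ((hG.cont.tendsto _).comp (hvt x))
      (ker_dct hs (Kn := fun n => fker s (Ioo 0 ((φ n : ℝ) + 2)))
        (fun n => hkn (φ n)) (fun z hz => (hklim z hz).comp hφ.tendsto_atTop)
        (a := fun n => Bz (u (φ n)) x) (b := Bz v x) (B := 2 * Λ ^ 2) (A := 4)
        (by positivity) (by norm_num) (fun n => Bz_meas (hu _).mono.measurable x)
        (fun n z hz => Bz_b1 hΛ0 (hul _) x z hz) (fun n z _ => Bz_b2 (hu _).bd x z) ?_)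
      (fun n => hGn (φ n) x)
    intro z hz
    exact ((hvt x).sub (hvt _)).mul ((hvt _).sub (hvt _))
  obtain ⟨la, lb, hla, hlb⟩ := mono_lims hv hvb
  have hlim0 : ∀ (l : Filter ℝ) [l.IsCountablyGenerated] [l.NeBot] (c : ℝ), Tendsto v l (nhds c) →
      (∀ z, 0 < z → Tendsto (fun x => x - z) l l) → (∀ z, 0 < z → Tendsto (fun x => x + z) l l) →
      G c ≤ 0 := by
    intro l _ _ c hl h1 h2
    have t : Tendsto (fun x => ∫ z in Ioi 0, Bz v x z * fker s (Ioi 0) z) l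
        (nhds (∫ z in Ioi 0, (0:ℝ) * fker s (Ioi 0) z)) := by
      refine ker_dct hs (Kn := fun _ => fker s (Ioi 0)) (fun _ => hk) (fun _ _ => tendsto_const_nhds)
        (B := 2 * Λ ^ 2) (A := 4) (by positivity) (by norm_num) (fun x => Bz_meas hcv.measurable x)
        (fun x z hz => Bz_b1 hΛ0 hvl x z hz) (fun x z _ => Bz_b2 hvb x z) ?_
      intro z hz
      have := (hl.sub (hl.comp (h1 z hz))).mul ((hl.comp (h2 z hz)).sub (hl.comp (h1 z hz)))
      simpa [Bz] using this
    have := le_of_tendsto_of_tendsto' ((hG.cont.tendsto _).comp hl) t hGv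
    simpa using this
  have ga := hlim0 atBot la hla (fun z _ => tendsto_atBot_add_const_right _ (-z) tendsto_id)
    (fun z _ => tendsto_atBot_add_const_right _ z tendsto_id)
  have gb := hlim0 atTop lb hlb (fun z _ => tendsto_atTop_add_const_right _ (-z) tendsto_id)
    (fun z _ => tendsto_atTop_add_const_right _ z tendsto_id)
  have la1 : -1 ≤ la := ge_of_tendsto' hla fun x => (abs_le.1 (hvb x)).1
  have lb1 : lb ≤ 1 := le_of_tendsto' hlb fun x => (abs_le.1 (hvb x)).2
  have la0 : la ≤ 0 := le_of_tendsto hla (by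
    filter_upwards [eventually_lt_atBot (0:ℝ)] with x hx using hva.neg x hx)
  have lb0 : 0 ≤ lb := ge_of_tendsto hlb (by
    filter_upwards [eventually_gt_atTop (0:ℝ)] with x hx using hva.pos x hx)
  have ea : la = -1 := by
    by_contra hne
    have := hG.Gpos la ⟨lt_of_le_of_ne la1 (Ne.symm hne), by linarith⟩
    linarith
  have eb : lb = 1 := by
    by_contra hne
    have := hG.Gpos lb ⟨by linarith, lt_of_le_of_ne lb1 hne⟩
    linarith
  rw [ea] at hla
  rw [eb] at hlb
  exact ⟨v, v', v'', hv, hvb, hd, hd2, hc2, hB1, hB2, hE, hla, hlb⟩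

open Real MeasureTheory Filter Set

lemma ker_lower {s : ℝ} {F : ℝ → ℝ} {R : ℝ} (hs : s ∈ Ioo (0:ℝ) 1) {r : ℝ} (hr : 0 ≤ r)
    (hF0 : ∀ z, 0 < z → 0 ≤ F z)
    (hFi : IntegrableOn (fun z => F z * fker s (Ioi 0) z) (Ioi 0)) (hF : IntegrableOn F (Ioo r R)) :
    R ^ (-1 - 2*s) * ∫ z in Ioo r R, F z ≤ ∫ z in Ioi 0, F z * fker s (Ioi 0) z := by
  have hk : IsKer s (fker s (Ioi 0)) := ker_isKer s measurableSet_Ioi subset_rfl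
  have hsub : Ioo r R ⊆ Ioi 0 := fun z hz => lt_of_le_of_lt hr hz.1
  rw [← integral_const_mul]
  refine le_trans (setIntegral_mono_on (hF.const_mul _) (hFi.mono_set hsub) measurableSet_Ioo
    fun z hz => ?_) (setIntegral_mono_set hFi ?_ (Eventually.of_forall hsub))
  · have hz0 := hsub hz
    unfold fker
    rw [indicator_of_mem hz0, mul_comm]
    refine mul_le_mul_of_nonneg_left ?_ (hF0 z hz0)
    exact rpow_le_rpow_of_nonpos hz0 hz.2.le (by linarith [hs.1])
  · exact (ae_restrict_iff' measurableSet_Ioi).2 (Eventually.of_forall fun z hz =>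
      mul_nonneg (hF0 z hz) (hk.nonneg z))

lemma exists_pen (x0 : ℝ) : ∃ q q' : ℝ → ℝ, Continuous q ∧ (∀ x, HasDerivAt q (q' x) x) ∧
    (∃ B, 0 ≤ B ∧ ∀ x y, |q' x - q' y| ≤ B * |x - y|) ∧ q x0 = 0 ∧ (∀ x, 0 ≤ q x) ∧ (∀ x, q x ≤ 1) ∧
    ∀ x, x ∉ Icc (x0 - 1) (x0 + 1) → q x = 1 := by
  let b : ContDiffBump x0 := ⟨1/2, 1, by norm_num, by norm_num⟩
  have ht : IsTest b := ⟨b.contDiff, b.hasCompactSupport⟩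
  have hd : ∀ x, HasDerivAt b (deriv b x) x := fun x =>
    ((ht.smooth.differentiable (by simp)) x).hasDerivAt
  have hd2 : ∀ x, HasDerivAt (deriv b) (deriv (deriv b) x) x := fun x =>
    ((ht.deriv.smooth.differentiable (by simp)) x).hasDerivAt
  obtain ⟨B, hB⟩ := ht.deriv.deriv.supp.exists_bound_of_continuous ht.deriv.deriv.cont
  refine ⟨fun x => 1 - b x, fun x => - deriv b x, continuous_const.sub ht.cont, fun x => ?_,
    ⟨B, (norm_nonneg _).trans (hB 0), fun x y => ?_⟩, ?_, fun x => ?_, fun x => ?_, fun x hx => ?_⟩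
  · simpa using (hd x).const_sub 1
  · have := lip_of_deriv_bdd hd2 hB x y
    rwa [← abs_neg, show -(-deriv b x - -deriv b y) = deriv b x - deriv b y by ring]
  · have : b x0 = 1 := b.one_of_mem_closedBall (by simp [b])
    simp [this]
  · linarith [b.le_one (x := x)]
  · linarith [b.nonneg (x := x)]
  · have : b x = 0 := b.zero_of_le_dist (by
      rw [Real.dist_eq]
      by_contra hc
      push Not at hc
      have := abs_lt.1 hc
      simp only [b] at this
      exact hx ⟨by linarith [this.1], by linarith [this.2]⟩)
    simp [this]

theorem pos_key {s : ℝ} (hs : s ∈ Ioo (0:ℝ) 1) {f : ℝ → ℝ} {L : ℝ} (hL0 : 0 ≤ L)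
    (hL : ∀ a ∈ Icc (-1:ℝ) 1, ∀ b ∈ Icc (-1:ℝ) 1, |f a - f b| ≤ L * |a - b|)
    {u u' : ℝ → ℝ} (hu : Monotone u) (hu1 : ∀ x, |u x| ≤ 1) (hd : ∀ x, HasDerivAt u (u' x) x)
    (hc : Continuous u') {B : ℝ} (hB0 : 0 ≤ B) (hB : ∀ x y, |u' x - u' y| ≤ B * |x - y|)
    (hE : ∀ x, Lop (fker s (Ioi 0)) u x = f (u x)) {x0 : ℝ} (h0 : u' x0 = 0) {R : ℝ} (hR : 1 < R) :
    ∃ M, ∀ κ, 0 < κ → u (x0 - 1 + R) - u (x0 + 2) ≤ M * κ := by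
  have hk : IsKer s (fker s (Ioi 0)) := ker_isKer s measurableSet_Ioi subset_rfl
  have huc : Continuous u := continuous_iff_continuousAt.2 fun x => (hd x).continuousAt
  obtain ⟨q, q', qc, qd, ⟨Bq, hBq0, hBq⟩, q0, qn, q1, qout⟩ := exists_pen x0
  have qa : ∀ x, |q x| ≤ 1 := fun x => abs_le.2 ⟨by linarith [qn x], q1 x⟩
  set Cq := ∫ z in Ioi 0, min (2 * Bq * z ^ 2) 4 * z ^ (-1 - 2*s) with hCq
  have sq1 : ∀ x z, 0 < z → |sdf q x z| ≤ 2 * Bq * z ^ 2 := fun x z hz => sd_bound qd hBq x hz.le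
  have sq2 : ∀ x z, |sdf q x z| ≤ 4 := fun x z => (sdf_le qa x z).trans (by norm_num)
  have iq : ∀ x, IntegrableOn (fun z => sdf q x z * fker s (Ioi 0) z) (Ioi 0) := fun x =>
    ker_integrable hs hk (sdf_meas qc.measurable x) (sq1 x) (fun z _ => sq2 x z)
  have Lq : ∀ x, |Lop (fker s (Ioi 0)) q x| ≤ Cq := fun x => by
    have hdom := dom_int hs (B := 2 * Bq) (A := 4) (by linarith) (by norm_num)
    rw [← Real.norm_eq_abs, hCq]
    unfold Lop
    refine norm_integral_le_of_norm_le hdom ?_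
    exact (ae_restrict_iff' measurableSet_Ioi).2 (Eventually.of_forall fun z hz =>
      ker_dom hk hz (sq1 x z hz) (sq2 x z))
  have su1 : ∀ x z, 0 < z → |sdf u x z| ≤ 2 * B * z ^ 2 := fun x z hz => sd_bound hd hB x hz.le
  have su2 : ∀ x z, |sdf u x z| ≤ 4 := fun x z => (sdf_le hu1 x z).trans (by norm_num)
  have iu : ∀ x, IntegrableOn (fun z => sdf u x z * fker s (Ioi 0) z) (Ioi 0) := fun x =>
    ker_integrable hs hk (sdf_meas huc.measurable x) (su1 x) (fun z _ => su2 x z)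
  set c := R ^ (-1 - 2*s) with hcd
  have hc0 : 0 < c := rpow_pos_of_pos (by linarith) _
  refine ⟨2 * R + (L + Cq) / c, fun κ hκ => ?_⟩
  set h := κ / (2 * (B + 1)) with hh
  have hh0 : 0 < h := by positivity
  have hBh : B * h ≤ κ / 2 := by
    have : (B + 1) * h = κ / 2 := by rw [hh]; field_simp
    nlinarith
  set p : ℝ → ℝ := fun x => (u (x + h) - u x) / h with hp
  have hpu : ∀ x, |p x - u' x| ≤ κ / 2 := fun x => by
    obtain ⟨y, hy, he⟩ := exists_hasDerivAt_eq_slope u u' (show x < x + h by linarith) huc.continuousOn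
      (fun t _ => hd t)
    rw [add_sub_cancel_left] at he
    have : p x = u' y := he.symm
    rw [this]
    refine (hB y x).trans (le_trans (mul_le_mul_of_nonneg_left ?_ hB0) hBh)
    rw [abs_of_pos (by linarith [hy.1])]; linarith [hy.2]
  have hp0 : ∀ x, 0 ≤ p x := fun x => div_nonneg (by linarith [hu (show x ≤ x + h by linarith)]) hh0.le
  have hpc : Continuous p := by fun_prop
  have hpx0 : p x0 ≤ κ / 2 := by
    have := (abs_le.1 (hpu x0)).2; rw [h0] at this; linarith
  -- minimum
  obtain ⟨y, hy, hymin⟩ := (isCompact_Icc (a := x0 - 1) (b := x0 + 1)).exists_isMinOn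
    ⟨x0, by constructor <;> linarith⟩ (f := fun x => p x + κ * q x) (by fun_prop)
  have hy0 : p y + κ * q y ≤ p x0 := by
    have := hymin (show x0 ∈ Icc (x0 - 1) (x0 + 1) by constructor <;> linarith)
    simpa [q0] using this
  have hyall : ∀ x, p y + κ * q y ≤ p x + κ * q x := fun x => by
    by_cases hx : x ∈ Icc (x0 - 1) (x0 + 1)
    · exact hymin hx
    · rw [qout x hx]
      linarith [hp0 x]
  have hpy : p y ≤ κ / 2 := by nlinarith [mul_nonneg hκ.le (qn y)]
  have sp : ∀ z, sdf p y z = (sdf u (y + h) z - sdf u y z) / h := fun z => by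
    simp only [hp, sdf]
    rw [show y + z + h = y + h + z by ring, show y - z + h = y + h - z by ring]; ring
  have ip : IntegrableOn (fun z => sdf p y z * fker s (Ioi 0) z) (Ioi 0) := by
    have : (fun z => sdf p y z * fker s (Ioi 0) z) =
      fun z => (sdf u (y + h) z * fker s (Ioi 0) z - sdf u y z * fker s (Ioi 0) z) / h := by
      ext z; rw [sp]; ring
    rw [this]
    exact ((iu (y + h)).sub (iu y)).div_const h
  have Lp : Lop (fker s (Ioi 0)) p y = (f (u (y + h)) - f (u y)) / h := by
    rw [← hE, ← hE]
    unfold Lop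
    rw [← integral_sub (iu (y + h)) (iu y), ← integral_div]
    congr 1; ext z; rw [sp]; ring
  have Lp2 : -(L * p y) ≤ Lop (fker s (Ioi 0)) p y := by
    rw [Lp]
    have h1 := hL _ (abs_le.1 (hu1 (y + h))) _ (abs_le.1 (hu1 y))
    rw [abs_of_nonneg (by linarith [hu (show y ≤ y + h by linarith)] : 0 ≤ u (y + h) - u y)] at h1
    have h2 := (abs_le.1 h1).1
    rw [le_div_iff₀ hh0]
    have h3 : p y * h = u (y + h) - u y := by simp only [hp]; field_simp
    rw [← h3] at h2
    linarith
  set F : ℝ → ℝ := fun z => -(sdf p y z + κ * sdf q y z) with hF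
  have Feq : ∀ z, F z = p (y + z) + κ * q (y + z) + (p (y - z) + κ * q (y - z)) -
      2 * (p y + κ * q y) := fun z => by simp only [hF, sdf]; ring
  have hF0 : ∀ z, 0 < z → 0 ≤ F z := fun z _ => by
    rw [Feq]; linarith [hyall (y + z), hyall (y - z)]
  have eF : (fun z => F z * fker s (Ioi 0) z) = fun z => -(sdf p y z * fker s (Ioi 0) z) -
      κ * (sdf q y z * fker s (Ioi 0) z) := by ext z; simp only [hF]; ring
  have iF : IntegrableOn (fun z => F z * fker s (Ioi 0) z) (Ioi 0) := by
    rw [eF]; exact ip.neg.sub ((iq y).const_mul κ)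
  have IF : ∫ z in Ioi 0, F z * fker s (Ioi 0) z = - Lop (fker s (Ioi 0)) p y -
      κ * Lop (fker s (Ioi 0)) q y := by
    rw [eF]
    unfold Lop
    rw [← integral_const_mul, ← integral_neg]
    exact integral_sub ip.neg ((iq y).const_mul κ)
  have Fc : Continuous F := by
    have : F = fun z => p (y + z) + κ * q (y + z) + (p (y - z) + κ * q (y - z)) -
      2 * (p y + κ * q y) := funext Feq
    rw [this]; fun_prop
  have iF2 : IntegrableOn F (Ioo 1 R) :=
    (Fc.integrableOn_Icc (a := 1) (b := R)).mono_set Ioo_subset_Icc_self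
  have hlow := ker_lower hs (r := 1) (R := R) zero_le_one hF0 iF iF2
  rw [IF] at hlow
  have hup : - Lop (fker s (Ioi 0)) p y - κ * Lop (fker s (Ioi 0)) q y ≤ (L + Cq) * κ := by
    have h1 := (abs_le.1 (Lq y)).1
    have h2 : L * p y ≤ L * κ := mul_le_mul_of_nonneg_left (by linarith) hL0
    nlinarith
  have hI : ∫ z in Ioo 1 R, F z ≤ (L + Cq) / c * κ := by
    rw [div_mul_eq_mul_div, le_div_iff₀ hc0]
    linarith
  have hc2 : Continuous fun z => u' (y + z) - 2 * κ := by fun_prop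
  have hI2 : ∫ z in Ioo 1 R, (u' (y + z) - 2 * κ) ≤ ∫ z in Ioo 1 R, F z := by
    refine setIntegral_mono_on ((hc2.integrableOn_Icc (a := 1) (b := R)).mono_set Ioo_subset_Icc_self)
      iF2 measurableSet_Ioo fun z _ => ?_
    rw [Feq]
    have h1 := (abs_le.1 (hpu (y + z))).1
    nlinarith [hp0 (y - z), mul_nonneg hκ.le (qn (y + z)), mul_nonneg hκ.le (qn (y - z))]
  have hI3 : ∫ z in Ioo 1 R, (u' (y + z) - 2 * κ) = u (y + R) - u (y + 1) - 2 * κ * (R - 1) := by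
    rw [← integral_Ioc_eq_integral_Ioo, ← intervalIntegral.integral_of_le hR.le]
    rw [intervalIntegral.integral_eq_sub_of_hasDerivAt (f := fun z => u (y + z) - 2 * κ * z)
      (fun z _ => ?_) (hc2.intervalIntegrable _ _)]
    · ring
    · have h1 : HasDerivAt (fun t => u (y + t)) (u' (y + z)) z := by
        simpa using HasDerivAt.comp_const_add y z (hd (y+z))
      have h2 : HasDerivAt (fun t : ℝ => 2 * κ * t) (2 * κ) z := by
        simpa using (hasDerivAt_id z).const_mul (2 * κ)
      exact h1.sub h2
  have m1 : u (x0 - 1 + R) ≤ u (y + R) := hu (by linarith [hy.1])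
  have m2 : u (y + 1) ≤ u (x0 + 2) := hu (by linarith [hy.2])
  nlinarith

theorem pos_deriv {s : ℝ} (hs : s ∈ Ioo (0:ℝ) 1) {f : ℝ → ℝ} {L : ℝ} (hL0 : 0 ≤ L)
    (hL : ∀ a ∈ Icc (-1:ℝ) 1, ∀ b ∈ Icc (-1:ℝ) 1, |f a - f b| ≤ L * |a - b|) (hf1 : f 1 = 0)
    {u u' : ℝ → ℝ} (hu : Monotone u) (hu1 : ∀ x, |u x| ≤ 1) (hd : ∀ x, HasDerivAt u (u' x) x)
    (hc : Continuous u') {B : ℝ} (hB0 : 0 ≤ B) (hB : ∀ x y, |u' x - u' y| ≤ B * |x - y|)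
    (hE : ∀ x, Lop (fker s (Ioi 0)) u x = f (u x)) (hb : Tendsto u atBot (nhds (-1)))
    (ht : Tendsto u atTop (nhds 1)) (x0 : ℝ) : 0 < u' x0 := by
  have hk : IsKer s (fker s (Ioi 0)) := ker_isKer s measurableSet_Ioi subset_rfl
  have huc : Continuous u := continuous_iff_continuousAt.2 fun x => (hd x).continuousAt
  have hnn : 0 ≤ u' x0 := by rw [← (hd x0).deriv]; exact hu.deriv_nonneg
  by_contra hcon
  have h0 : u' x0 = 0 := le_antisymm (not_lt.1 hcon) hnn
  have hle : ∀ R, 1 < R → u (x0 - 1 + R) ≤ u (x0 + 2) := fun R hR => by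
    obtain ⟨M, hM⟩ := pos_key hs hL0 hL hu hu1 hd hc hB0 hB hE h0 hR
    have t : Tendsto (fun κ => M * κ) (nhdsWithin 0 (Ioi 0)) (nhds (M * 0)) :=
      ((continuous_const.mul continuous_id).tendsto (0:ℝ)).mono_left nhdsWithin_le_nhds
    rw [mul_zero] at t
    have := ge_of_tendsto t (eventually_mem_nhdsWithin.mono fun κ hκ => hM κ hκ)
    linarith
  set y := x0 + 2 with hy
  have hy1 : u y = 1 := by
    refine le_antisymm (abs_le.1 (hu1 y)).2 (le_of_tendsto ht ?_)
    filter_upwards [eventually_gt_atTop x0] with x hx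
    have := hle (x - x0 + 1) (by linarith)
    rwa [show x0 - 1 + (x - x0 + 1) = x by ring] at this
  have hLy := hE y
  rw [hy1, hf1] at hLy
  obtain ⟨N, hN⟩ := eventually_atBot.1 (hb.eventually (gt_mem_nhds (show (-1:ℝ) < 0 by norm_num)))
  set r := max 0 (y - N) with hr
  have hr0 : 0 ≤ r := le_max_left _ _
  have hF0 : ∀ z, 0 < z → 0 ≤ sdf u y z := fun z _ => by
    unfold sdf; rw [hy1]
    linarith [(abs_le.1 (hu1 (y + z))).2, (abs_le.1 (hu1 (y - z))).2]
  have iu : IntegrableOn (fun z => sdf u y z * fker s (Ioi 0) z) (Ioi 0) :=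
    ker_integrable hs hk (sdf_meas huc.measurable y) (fun z hz => sd_bound hd hB y (le_of_lt hz))
      (fun z _ => sdf_le hu1 y z)
  have sc : Continuous fun z => sdf u y z := by unfold sdf; fun_prop
  have iS : IntegrableOn (fun z => sdf u y z) (Ioo r (r + 1)) :=
    (sc.integrableOn_Icc (a := r) (b := r + 1)).mono_set Ioo_subset_Icc_self
  have hlow := ker_lower hs (r := r) (R := r + 1) hr0 hF0 iu iS
  have h1 : (1:ℝ) ≤ ∫ z in Ioo r (r + 1), sdf u y z := by
    calc (1:ℝ) = ∫ z in Ioo r (r + 1), (1:ℝ) := by simp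
      _ ≤ _ := by
        refine setIntegral_mono_on (integrableOn_const (by simp)) iS measurableSet_Ioo fun z hz => ?_
        unfold sdf; rw [hy1]
        have hz1 : y - N < z := lt_of_le_of_lt (le_max_right _ _) hz.1
        have := hN (y - z) (by linarith)
        linarith [(abs_le.1 (hu1 (y + z))).2]
  have h2 : 0 < (r + 1) ^ (-1 - 2*s) := rpow_pos_of_pos (by linarith) _
  unfold Lop at hLy
  rw [hLy] at hlow
  nlinarith

/-- Sufficiency: under the conditions on `G`, a layer solution exists. -/
theorem statement1 (s γ : ℝ) (hs : s ∈ Set.Ioo (0:ℝ) 1)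
    (hγ : max 0 (1 - 2*s) < γ)
    (f : ℝ → ℝ) (hf : IsC1Holder γ f)
    (hfm : f (-1) = 0) (hfp : f 1 = 0)
    (hGeq : potG f (-1) = potG f 1)
    (hG : ∀ r ∈ Set.Ioo (-1:ℝ) 1, potG f (-1) < potG f r) :
    ∃ v : ℝ → ℝ, IsLayerSolution s f v := by
  obtain ⟨hf1, C, hC⟩ := hf
  have hs0 : 0 < s := hs.1
  have hc : 0 < fracLapCoef s := by
    have h1 : 0 < Real.Gamma (s + 1/2) := Real.Gamma_pos_of_pos (by linarith)
    have h2 : 0 < Real.Gamma (1 - s) := Real.Gamma_pos_of_pos (by linarith [hs.2])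
    have h3 : 0 < Real.sqrt π := Real.sqrt_pos.2 Real.pi_pos
    have h4 : 0 < (4:ℝ) ^ s := Real.rpow_pos_of_pos (by norm_num) _
    unfold fracLapCoef
    positivity
  set c := fracLapCoef s with hcdef
  have hfc : Continuous f := hf1.continuous
  have hfd : ∀ x, HasDerivAt f (deriv f x) x := fun x =>
    (hf1.differentiable (by norm_num) x).hasDerivAt
  have hfdc : Continuous (deriv f) := hf1.continuous_deriv (by norm_num)
  obtain ⟨L, hL⟩ := (isCompact_Icc (a := (-1:ℝ)) (b := 1)).exists_bound_of_continuousOn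
    hfdc.continuousOn
  have hPot : Pot (fun r => (potG f r - potG f (-1)) / c) (fun x => f x / c) (L / c) :=
    { fc := hfc.div_const c
      dG := fun r => by
        have h := (intervalIntegral.integral_hasDerivAt_right (hfc.intervalIntegrable 0 r)
          (hfc.stronglyMeasurableAtFilter _ _) hfc.continuousAt).neg
        have h2 := (h.sub_const (potG f (-1))).div_const c
        rw [neg_div] at h2
        exact h2
      Lip := fun a ha b hb => by
        have h := Convex.norm_image_sub_le_of_norm_hasDerivWithin_le (f := f) (f' := deriv f)
          (C := L) (s := Icc (-1:ℝ) 1) (fun x _ => (hfd x).hasDerivWithinAt) hL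
          (convex_Icc _ _) hb ha
        rw [Real.norm_eq_abs, Real.norm_eq_abs] at h
        rw [← sub_div, abs_div, abs_of_pos hc, div_mul_eq_mul_div]
        exact div_le_div_of_nonneg_right h hc.le
      fm := by simp [hfm]
      fp := by simp [hfp]
      Gm := by simp
      Gp := by simp [hGeq]
      Gpos := fun r hr => div_pos (sub_pos.2 (hG r hr)) hc }
  have hg1 : ContDiff ℝ 1 (fun x => f x / c) := hf1.div_const c
  have hgC : ∀ x y : ℝ, |deriv (fun x => f x / c) x - deriv (fun x => f x / c) y|
      ≤ C / c * |x - y| ^ γ := fun x y => by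
    rw [((hfd x).div_const c).deriv, ((hfd y).div_const c).deriv, ← sub_div, abs_div,
      abs_of_pos hc, div_mul_eq_mul_div]
    exact div_le_div_of_nonneg_right (hC x y) hc.le
  obtain ⟨u, u', u'', hu, hu1, hd, hd2, hcc, -, ⟨B, hB⟩, hE, hb, ht⟩ :=
    level2 hs hPot hγ hg1 hgC
  have hu'c : Continuous u' := continuous_iff_continuousAt.2 fun x => (hd2 x).continuousAt
  have hpos := pos_deriv hs hPot.Lnn hPot.Lip hPot.fp hu hu1 hd hu'c
    ((abs_nonneg _).trans (hB 0)) (lip_of_deriv_bdd hd2 hB) hE hb ht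
  have e1 : deriv u = u' := funext fun x => (hd x).deriv
  have e2 : deriv u' = u'' := funext fun x => (hd2 x).deriv
  refine ⟨u, ⟨1, hu1⟩, ?_, fun x => ?_, fun x => ?_, hb, ht⟩
  · rw [show (2 : WithTop ℕ∞) = 1 + 1 from by norm_num, contDiff_succ_iff_deriv]
    refine ⟨fun x => (hd x).differentiableAt, by simp, ?_⟩
    rw [e1, contDiff_one_iff_deriv, e2]
    exact ⟨fun x => (hd2 x).differentiableAt, hcc⟩
  · have h : ∫ y in Set.Ioi (0:ℝ), (2 * u x - u (x + y) - u (x - y)) * y ^ (-1 - 2*s)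
        = Lop (fker s (Ioi 0)) u x := by
      unfold Lop
      refine setIntegral_congr_fun measurableSet_Ioi fun y hy => ?_
      simp only [fker, indicator_of_mem hy, sdf]
    unfold fracLap
    rw [h, hE, ← hcdef]
    field_simp
  · rw [(hd x).deriv]; exact hpos x
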